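/- For integers m, n with −1 ≤ m < n, if L_m = L_n then both m and n lie in the set {−1, 0, 1, 2, 3, 5, 12, 54, 66, 1259, 2389}. Moreover L_{−1} = L_5 = L_{12} = L_{1259}, L_0 = L_3 = L_{54}, L_1 = L_{66}, and L_2 = L_{2389}; consequently, for −1 ≤ m < n one has L_m = L_n if and only if (m,n) ∈ {(−1,5), (−1,12), (−1,1259), (5,12), (5,1259), (12,1259), (0,3), (0,54), (3,54), (1,66), (2,2389)}. -/

import Mathlib

open Polynomial

/-- The simplest cubic polynomial `f_m(X) = X³ − mX² − (m+3)X − 1` over `ℚ`. -/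
noncomputable def f (m : ℤ) : ℚ[X] :=
  X ^ 3 - C (m : ℚ) * X ^ 2 - C ((m : ℚ) + 3) * X - 1

/-- The simplest cubic field `L_m`: the splitting field of `f_m` over `ℚ` inside a fixed
algebraic closure of `ℚ`. -/
noncomputable def L (m : ℤ) : IntermediateField ℚ (AlgebraicClosure ℚ) :=
  IntermediateField.adjoin ℚ ((f m).rootSet (AlgebraicClosure ℚ))


namespace SC

lemma coeff_prod_sum {ι : Type*} (s : Finset ι) (g : ι → ℝ[X]) (d : ι → ℕ)
    (h : ∀ i ∈ s, (g i).natDegree ≤ d i) :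
    (∏ i ∈ s, g i).coeff (∑ i ∈ s, d i) = ∏ i ∈ s, (g i).coeff (d i) := by
  classical
  induction s using Finset.induction_on with
  | empty => simp
  | insert a s ha ih =>
    rw [Finset.prod_insert ha, Finset.sum_insert ha, Finset.prod_insert ha,
      ← ih (fun i hi => h i (Finset.mem_insert_of_mem hi))]
    apply coeff_mul_add_eq_of_natDegree_le (h a (Finset.mem_insert_self a s))
    exact (natDegree_prod_le _ _).trans
      (Finset.sum_le_sum fun i hi => h i (Finset.mem_insert_of_mem hi))

lemma coeff_det_sum {n : ℕ} (M : Matrix (Fin n) (Fin n) ℝ[X]) (d : Fin n → ℕ)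
    (h : ∀ i j, (M i j).natDegree ≤ d j) :
    M.det.coeff (∑ j, d j) = (Matrix.of fun i j => (M i j).coeff (d j)).det := by
  rw [Matrix.det_apply, Matrix.det_apply, finsetSum_coeff]
  refine Finset.sum_congr rfl fun σ _ => ?_
  rw [Polynomial.coeff_smul, coeff_prod_sum _ _ _ (fun i _ => h (σ i) i)]
  rfl

lemma zero_est (L K : ℕ) (p : Fin L → ℝ[X]) (hdeg : ∀ l, (p l).natDegree ≤ K) (t Z : ℝ)
    (ht : 1 < t) (S : Finset ℝ) (hS : K * L < S.card)
    (hv : ∀ x ∈ S, ∃ y : ℝ, y ≠ 0 ∧ ∀ j < L,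
      ∑ l : Fin L, (p l).eval (x + Z * j) * (t ^ j) ^ (l : ℕ) * y ^ (l : ℕ) = 0) :
    ∀ l, p l = 0 := by
  classical
  by_contra! hne
  obtain ⟨l0, hl0⟩ := hne
  set I := {l : Fin L // p l ≠ 0} with hI
  set n := Fintype.card I with hn
  have hnL : n ≤ L := by
    have := Fintype.card_subtype_le (fun l : Fin L => p l ≠ 0)
    rwa [Fintype.card_fin] at this
  let e : Fin n ≃ I := (Fintype.equivFin I).symm
  have hnpos : 0 < n := Fintype.card_pos_iff.mpr ⟨⟨l0, hl0⟩⟩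
  let M : Matrix (Fin n) (Fin n) ℝ[X] := Matrix.of fun j i =>
    (p (e i)).comp (X + C (Z * (j : ℕ))) * C ((t ^ ((e i : Fin L) : ℕ)) ^ (j : ℕ))
  let d : Fin n → ℕ := fun i => (p (e i)).natDegree
  have hdegM : ∀ i j, (M i j).natDegree ≤ d j := by
    intro i j
    simp only [M, Matrix.of_apply, d]
    refine (natDegree_mul_C_le _ _).trans ?_
    rw [natDegree_comp, natDegree_X_add_C, mul_one]
  have hco : ∀ i j, (M i j).coeff (d j) =
      (p (e j)).leadingCoeff * (t ^ ((e j : Fin L) : ℕ)) ^ (i : ℕ) := by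
    intro i j
    simp only [M, Matrix.of_apply, d, coeff_mul_C]
    congr 1
    have h1 : ((p (e j)).comp (X + C (Z * (i : ℕ)))).natDegree = (p (e j)).natDegree := by
      rw [natDegree_comp, natDegree_X_add_C, mul_one]
    conv_lhs => rw [← h1]
    rw [coeff_natDegree, leadingCoeff_comp (by rw [natDegree_X_add_C]; norm_num), leadingCoeff_X_add_C]
    simp
  have hdetne : M.det ≠ 0 := by
    intro h0
    have h1 := coeff_det_sum M d hdegM
    rw [h0, coeff_zero] at h1
    have h2 : (Matrix.of fun i j => (M i j).coeff (d j)) =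
        Matrix.of fun i j => (p (e j)).leadingCoeff *
          (Matrix.vandermonde (fun j => t ^ ((e j : Fin L) : ℕ))).transpose i j := by
      ext i j
      simp [hco, Matrix.vandermonde_apply]
    rw [h2, Matrix.det_mul_row, Matrix.det_transpose] at h1
    have h3 := mul_eq_zero.mp h1.symm
    rcases h3 with h3 | h3
    · rw [Finset.prod_eq_zero_iff] at h3
      obtain ⟨i, _, hi⟩ := h3
      exact (e i).2 (leadingCoeff_eq_zero.mp hi)
    · refine (Matrix.det_vandermonde_ne_zero_iff.mpr ?_) h3
      intro i j hij
      have := pow_right_injective₀ (by linarith) (by linarith) hij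
      exact e.injective (Subtype.ext (Fin.ext this))
  have hroot : ∀ x ∈ S, M.det.IsRoot x := by
    intro x hx
    obtain ⟨y, hy, hsum⟩ := hv x hx
    rw [IsRoot.def, ← coe_evalRingHom, RingHom.map_det]
    refine Matrix.exists_mulVec_eq_zero_iff.mp ⟨fun i => y ^ ((e i : Fin L) : ℕ), ?_, ?_⟩
    · intro h
      have := congrFun h ⟨0, hnpos⟩
      simp [hy] at this
    · ext j
      have hj := hsum j (j.2.trans_le hnL)
      have hj2 : ∑ l : Fin L, (p l).eval (x + Z * (j : ℕ)) * (t ^ (j : ℕ)) ^ (l : ℕ) * y ^ (l : ℕ)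
        = ∑ l : I, (p l).eval (x + Z * (j : ℕ)) * (t ^ (j : ℕ)) ^ ((l : Fin L) : ℕ) * y ^ ((l : Fin L) : ℕ) := by
        symm
        apply Finset.sum_of_injOn (fun l : I => (l : Fin L)) (Subtype.val_injective.injOn)
        · simp
        · intro l _ hl
          have : p l = 0 := by
            by_contra hc
            exact hl ⟨⟨l, hc⟩, by simp, rfl⟩
          simp [this]
        · intro i _; rfl
      rw [hj2] at hj
      rw [← Equiv.sum_comp e] at hj
      rw [Matrix.mulVec, dotProduct, Pi.zero_apply, ← hj]
      refine Finset.sum_congr rfl fun i _ => ?_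
      simp [M, ← pow_mul, mul_comm]
  have hcard : S.card ≤ M.det.natDegree := by
    have h1 : S ⊆ M.det.roots.toFinset := fun x hx => by
      rw [Multiset.mem_toFinset, mem_roots hdetne]; exact hroot x hx
    exact (Finset.card_le_card h1).trans ((Multiset.toFinset_card_le _).trans (card_roots' _))
  have hdeg2 : M.det.natDegree ≤ K * L := by
    rw [Matrix.det_apply]
    refine natDegree_sum_le_of_forall_le _ _ fun σ _ => ?_
    refine (natDegree_smul_le _ _).trans ((natDegree_prod_le _ _).trans ?_)
    calc ∑ i, (M (σ i) i).natDegree ≤ ∑ i : Fin n, K :=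
          Finset.sum_le_sum fun i _ => (hdegM _ _).trans (hdeg _)
      _ = n * K := by simp
      _ ≤ K * L := by rw [mul_comm]; exact Nat.mul_le_mul_left _ hnL
  omega

/-- a full column rank matrix has a nonzero maximal minor -/
lemma exists_minor {ρ κ : Type*} [Fintype ρ] [Fintype κ] [DecidableEq κ] (M : Matrix ρ κ ℝ)
    (h : ∀ v : κ → ℝ, M.mulVec v = 0 → v = 0) :
    ∃ e : κ → ρ, Function.Injective e ∧ (M.submatrix e id).det ≠ 0 := by
  classical
  obtain ⟨b, hb, hspan, hli⟩ := exists_linearIndependent ℝ (Set.range M.row)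
  have htop : Submodule.span ℝ (Set.range M.row) = ⊤ := by
    have h1 : M.rank = Fintype.card κ := by
      rw [Matrix.rank, LinearMap.finrank_range_of_inj]
      · simp
      · rw [injective_iff_map_eq_zero]
        intro v hv
        exact h v (by simpa using hv)
    apply Submodule.eq_top_of_finrank_eq
    rw [← Matrix.rank_eq_finrank_span_row, h1]; simp
  let B : Module.Basis b ℝ (κ → ℝ) := Module.Basis.mk hli (by rw [Subtype.range_coe, hspan, htop])
  have : Fintype b := ((Set.finite_range M.row).subset hb).fintype
  have hc : Fintype.card κ = Fintype.card b := by
    have := Module.finrank_eq_card_basis B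
    rw [← this]; simp
  let q : κ ≃ b := Fintype.equivOfCardEq hc
  have hr : ∀ k : κ, ∃ i : ρ, M.row i = (q k : κ → ℝ) := fun k => hb (q k).2
  choose e he using hr
  refine ⟨e, ?_, ?_⟩
  · intro i j hij
    apply q.injective; apply Subtype.ext; rw [← he, ← he, hij]
  · have : LinearIndependent ℝ (M.submatrix e id).row := by
      have h2 := hli.comp q q.injective
      have h3 : (M.submatrix e id).row = Subtype.val ∘ q := by
        ext k j
        have := congrFun (he k) j
        simpa using this
      rw [h3]; exact h2
    rw [Matrix.linearIndependent_rows_iff_isUnit, Matrix.isUnit_iff_isUnit_det] at this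
    exact this.ne_zero
end SC


namespace SC

/-- Newton coefficients of monomials -/
noncomputable def cc (u : ℕ → ℝ) : ℕ → ℕ → ℝ
  | 0, 0 => 1
  | 0, _ + 1 => 0
  | t + 1, 0 => u 0 * cc u t 0
  | t + 1, j + 1 => cc u t j + u (j + 1) * cc u t (j + 1)

noncomputable def nb (u : ℕ → ℝ) (h : ℕ) (x : ℝ) : ℝ := ∏ s ∈ Finset.range h, (x - u s)

lemma cc_nonneg (u : ℕ → ℝ) (hu : ∀ i, 0 ≤ u i) : ∀ t j, 0 ≤ cc u t j
  | 0, 0 => by simp [cc]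
  | 0, _ + 1 => by simp [cc]
  | t + 1, 0 => by rw [cc]; exact mul_nonneg (hu 0) (cc_nonneg u hu t 0)
  | t + 1, j + 1 => by
    rw [cc]; exact add_nonneg (cc_nonneg u hu t j) (mul_nonneg (hu _) (cc_nonneg u hu t _))

lemma cc_le (u : ℕ → ℝ) (hu : ∀ i, 0 ≤ u i) (hu1 : ∀ i, u i ≤ 1) : ∀ t j, cc u t j ≤ t.choose j
  | 0, 0 => by simp [cc]
  | 0, _ + 1 => by simp [cc]
  | t + 1, 0 => by
    rw [cc]
    have h1 := cc_le u hu hu1 t 0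
    have h2 := cc_nonneg u hu t 0
    simp only [Nat.choose_zero_right, Nat.cast_one] at *
    nlinarith [hu 0, hu1 0]
  | t + 1, j + 1 => by
    rw [cc, Nat.choose_succ_succ]; push_cast
    have h1 := cc_le u hu hu1 t j
    have h3 := cc_le u hu hu1 t (j+1)
    have h2 := cc_nonneg u hu t (j+1)
    nlinarith [hu (j+1), hu1 (j+1)]

lemma nb_succ (u : ℕ → ℝ) (h : ℕ) (x : ℝ) : nb u (h + 1) x = nb u h x * (x - u h) := by
  simp [nb, Finset.prod_range_succ]

lemma cc_step (u : ℕ → ℝ) (x : ℝ) (t N : ℕ) :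
    x * ∑ h ∈ Finset.range (N + 1), cc u t h * nb u h x =
      ∑ h ∈ Finset.range (N + 1), cc u (t + 1) h * nb u h x + cc u t N * nb u (N + 1) x := by
  induction N with
  | zero => simp [cc, nb]; ring
  | succ N ih =>
    rw [Finset.sum_range_succ, mul_add, ih, Finset.sum_range_succ _ (N + 1), nb_succ u (N + 1),
      nb_succ u N, cc]
    ring

lemma cc_sum (u : ℕ → ℝ) (x : ℝ) (N : ℕ) (hx : nb u (N + 1) x = 0) (t : ℕ) :
    x ^ t = ∑ h ∈ Finset.range (N + 1), cc u t h * nb u h x := by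
  induction t with
  | zero =>
    rw [Finset.sum_range_succ', Finset.sum_eq_zero]
    · simp [cc, nb]
    · intro i _; simp [cc]
  | succ t ih =>
    have := cc_step u x t N
    rw [hx, mul_zero, add_zero, ← ih] at this
    rw [← this, pow_succ, mul_comm]

lemma choose_le (t j : ℕ) (ρ : ℝ) (hρ : 0 < ρ) : (t.choose j : ℝ) ≤ (1 + ρ) ^ t * (ρ⁻¹) ^ j := by
  rcases le_or_gt j t with h | h
  · have h1 : ρ ^ j * (t.choose j : ℝ) ≤ (1 + ρ) ^ t := by
      rw [add_comm, add_pow]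
      have := Finset.single_le_sum (f := fun m => ρ ^ m * 1 ^ (t - m) * (t.choose m : ℝ))
        (s := Finset.range (t + 1)) (fun i _ => by positivity) (Finset.mem_range.mpr (Nat.lt_succ_of_le h))
      simpa using this
    rw [inv_pow, ← div_eq_mul_inv, le_div_iff₀ (by positivity), mul_comm]; exact h1
  · rw [Nat.choose_eq_zero_of_lt h, Nat.cast_zero]; positivity

lemma interp_det (N : ℕ) (u : Fin N → ℝ) (hu : ∀ i, 0 ≤ u i) (hu1 : ∀ i, u i ≤ 1)
    (φ : Fin N → ℕ → ℝ) (hφ : ∀ i t, 0 ≤ φ i t) (ρ B : ℝ) (hρ : 0 < ρ)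
    (hs : ∀ i, Summable fun t => φ i t * (1 + ρ) ^ t)
    (hB : ∀ i, ∑' t, φ i t * (1 + ρ) ^ t ≤ B) (M : Matrix (Fin N) (Fin N) ℝ)
    (hM : ∀ i j, HasSum (fun t => φ i t * u j ^ t) (M i j)) :
    |M.det| ≤ (N.factorial : ℝ) * ∏ h : Fin N, (B * (ρ⁻¹) ^ (h : ℕ)) := by
  rcases Nat.eq_zero_or_pos N with h0 | h0
  · subst h0; simp
  obtain ⟨N', rfl⟩ : ∃ N', N = N' + 1 := ⟨N - 1, by omega⟩
  set v : ℕ → ℝ := fun s => if h : s < N' + 1 then u ⟨s, h⟩ else 0 with hv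
  have hv0 : ∀ i, 0 ≤ v i := fun i => by simp only [hv]; split_ifs; exacts [hu _, le_rfl]
  have hv1 : ∀ i, v i ≤ 1 := fun i => by simp only [hv]; split_ifs; exacts [hu1 _, zero_le_one]
  have hvu : ∀ j : Fin (N' + 1), v j = u j := fun j => by simp only [hv]; rw [dif_pos j.2]
  have hle : ∀ i t h, φ i t * cc v t h ≤ φ i t * (1 + ρ) ^ t * (ρ⁻¹) ^ h := fun i t h => by
    rw [mul_assoc]
    exact mul_le_mul_of_nonneg_left ((cc_le v hv0 hv1 t h).trans (choose_le t h ρ hρ)) (hφ i t)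
  have hsc : ∀ i h, Summable fun t => φ i t * cc v t h := fun i h =>
    Summable.of_nonneg_of_le (fun t => mul_nonneg (hφ i t) (cc_nonneg v hv0 t h)) (fun t => hle i t h)
      ((hs i).mul_right _)
  let C : Matrix (Fin (N' + 1)) (Fin (N' + 1)) ℝ := Matrix.of fun i h => ∑' t, φ i t * cc v t h
  let V : Matrix (Fin (N' + 1)) (Fin (N' + 1)) ℝ := Matrix.of fun h j => nb v h (u j)
  have hCb : ∀ i h, |C i h| ≤ B * (ρ⁻¹) ^ (h : ℕ) := by
    intro i h
    have h1 : 0 ≤ C i h := tsum_nonneg fun t => mul_nonneg (hφ i t) (cc_nonneg v hv0 t h)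
    rw [abs_of_nonneg h1]
    calc C i h ≤ ∑' t, φ i t * (1 + ρ) ^ t * (ρ⁻¹) ^ (h : ℕ) :=
          (hsc i h).tsum_le_tsum (fun t => hle i t h) ((hs i).mul_right _)
      _ = (∑' t, φ i t * (1 + ρ) ^ t) * (ρ⁻¹) ^ (h : ℕ) := tsum_mul_right
      _ ≤ _ := mul_le_mul_of_nonneg_right (hB i) (by positivity)
  have hnb0 : ∀ j : Fin (N' + 1), ∀ h : ℕ, (j : ℕ) < h → nb v h (u j) = 0 := by
    intro j h hj
    exact Finset.prod_eq_zero (Finset.mem_range.mpr hj) (by rw [hvu, sub_self])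
  have hMCV : M = C * V := by
    ext i j
    rw [Matrix.mul_apply]
    refine (hM i j).unique ?_
    have h1 : HasSum (fun t => ∑ h : Fin (N' + 1), φ i t * cc v t h * nb v h (u j))
        (∑ h : Fin (N' + 1), C i h * V h j) :=
      hasSum_sum fun h _ => ((hsc i h).hasSum.mul_right _)
    convert h1 using 2 with t
    rw [cc_sum v (u j) N' (hnb0 j _ j.2) t, Finset.mul_sum, ← Fin.sum_univ_eq_sum_range (fun h => φ i t * (cc v t h * nb v h (u j)))]
    exact Finset.sum_congr rfl fun h _ => by ring
  have hV : |V.det| ≤ 1 := by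
    have hup : V.IsUpperTriangular := by
      intro i j hij
      exact hnb0 j i hij
    rw [Matrix.det_of_isUpperTriangular hup, Finset.abs_prod]
    refine Finset.prod_le_one (fun _ _ => abs_nonneg _) fun j _ => ?_
    simp only [V, Matrix.of_apply, nb, Finset.abs_prod]
    refine Finset.prod_le_one (fun _ _ => abs_nonneg _) fun s _ => ?_
    rw [abs_le]; constructor <;> linarith [hu j, hu1 j, hv0 s, hv1 s]
  have hC : |C.det| ≤ ((N' + 1).factorial : ℝ) * ∏ h : Fin (N' + 1), (B * (ρ⁻¹) ^ (h : ℕ)) := by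
    rw [Matrix.det_apply]
    refine (Finset.abs_sum_le_sum_abs _ _).trans ?_
    have : ∀ σ ∈ (Finset.univ : Finset (Equiv.Perm (Fin (N' + 1)))),
        |Equiv.Perm.sign σ • ∏ i, C (σ i) i| ≤ ∏ h : Fin (N' + 1), (B * (ρ⁻¹) ^ (h : ℕ)) := by
      intro σ _
      rw [Units.smul_def, zsmul_eq_mul, abs_mul, Finset.abs_prod]
      have h1 : |((Equiv.Perm.sign σ : ℤ) : ℝ)| = 1 := by
        rcases Int.units_eq_one_or (Equiv.Perm.sign σ) with h | h <;> simp [h]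
      rw [h1, one_mul]
      exact Finset.prod_le_prod (fun _ _ => abs_nonneg _) fun i _ => hCb _ _
    refine (Finset.sum_le_card_nsmul _ _ _ this).trans ?_
    rw [Finset.card_univ, Fintype.card_perm, Fintype.card_fin, nsmul_eq_mul]
  rw [hMCV, Matrix.det_mul, abs_mul]
  calc |C.det| * |V.det| ≤ |C.det| * 1 := mul_le_mul_of_nonneg_left hV (abs_nonneg _)
    _ ≤ _ := by rw [mul_one]; exact hC

lemma prod_lip {ι : Type*} (s : Finset ι) (x y : ι → ℝ) (G η : ℝ) (hG : 1 ≤ G)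
    (hx : ∀ i ∈ s, |x i| ≤ G) (hy : ∀ i ∈ s, |y i| ≤ G) (hxy : ∀ i ∈ s, |x i - y i| ≤ η) (hη : 0 ≤ η) :
    |∏ i ∈ s, x i - ∏ i ∈ s, y i| ≤ s.card * G ^ s.card * η := by
  classical
  induction s using Finset.induction_on with
  | empty => simp
  | insert a s ha ih =>
    have ih := ih (fun i hi => hx i (Finset.mem_insert_of_mem hi))
      (fun i hi => hy i (Finset.mem_insert_of_mem hi)) (fun i hi => hxy i (Finset.mem_insert_of_mem hi))
    rw [Finset.prod_insert ha, Finset.prod_insert ha, Finset.card_insert_of_notMem ha]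
    have h1 : |∏ i ∈ s, y i| ≤ G ^ s.card := by
      rw [Finset.abs_prod]
      calc ∏ i ∈ s, |y i| ≤ ∏ i ∈ s, G := Finset.prod_le_prod (fun _ _ => abs_nonneg _)
            fun i hi => hy i (Finset.mem_insert_of_mem hi)
        _ = _ := by simp
    have h2 := hx a (Finset.mem_insert_self _ _)
    have h3 := hxy a (Finset.mem_insert_self _ _)
    have e1 : x a * ∏ i ∈ s, x i - y a * ∏ i ∈ s, y i =
      x a * (∏ i ∈ s, x i - ∏ i ∈ s, y i) + (x a - y a) * ∏ i ∈ s, y i := by ring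
    rw [e1]
    have hGp : 0 ≤ G ^ s.card := by positivity
    calc _ ≤ |x a| * |∏ i ∈ s, x i - ∏ i ∈ s, y i| + |x a - y a| * |∏ i ∈ s, y i| := by
          refine (abs_add_le _ _).trans ?_; rw [abs_mul, abs_mul]
      _ ≤ G * (s.card * G ^ s.card * η) + η * G ^ s.card := by gcongr
      _ ≤ G * (s.card * G ^ s.card * η) + η * (G ^ s.card * G) := by
          have : G ^ s.card ≤ G ^ s.card * G := le_mul_of_one_le_right hGp hG
          gcongr
      _ = _ := by push_cast; ring

lemma det_lip {N : ℕ} (A B : Matrix (Fin N) (Fin N) ℝ) (G η : ℝ) (hG : 1 ≤ G)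
    (hx : ∀ i j, |A i j| ≤ G) (hy : ∀ i j, |B i j| ≤ G) (hxy : ∀ i j, |A i j - B i j| ≤ η)
    (hη : 0 ≤ η) : |A.det| ≤ |B.det| + N.factorial * (N * G ^ N * η) := by
  have h : |A.det - B.det| ≤ N.factorial * (N * G ^ N * η) := by
    rw [Matrix.det_apply, Matrix.det_apply, ← Finset.sum_sub_distrib]
    refine (Finset.abs_sum_le_sum_abs _ _).trans ?_
    have : ∀ σ ∈ (Finset.univ : Finset (Equiv.Perm (Fin N))),
        |Equiv.Perm.sign σ • ∏ i, A (σ i) i - Equiv.Perm.sign σ • ∏ i, B (σ i) i| ≤ N * G ^ N * η := by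
      intro σ _
      rw [← smul_sub, Units.smul_def, zsmul_eq_mul, abs_mul]
      have h1 : |((Equiv.Perm.sign σ : ℤ) : ℝ)| = 1 := by
        rcases Int.units_eq_one_or (Equiv.Perm.sign σ) with h | h <;> simp [h]
      rw [h1, one_mul]
      have := prod_lip Finset.univ (fun i => A (σ i) i) (fun i => B (σ i) i) G η hG
        (fun i _ => hx _ _) (fun i _ => hy _ _) (fun i _ => hxy _ _) hη
      simpa using this
    refine (Finset.sum_le_card_nsmul _ _ _ this).trans ?_
    rw [Finset.card_univ, Fintype.card_perm, Fintype.card_fin, nsmul_eq_mul]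
  have := abs_sub_abs_le_abs_sub A.det B.det
  linarith
end SC


namespace SC

def NormHyp (t : ℝ) : Prop := ∀ P : ℤ[X], aeval t P ≠ 0 →
  1 ≤ |aeval t P| * |aeval (-1 / (1 + t)) P| * |aeval (-(1 + t) / t) P|

/-- matrix of integer polynomials -/
noncomputable def pm (Xx Z : ℕ) (K L : ℕ) (pr ps : Fin (K * L) → ℕ) :
    Matrix (Fin (K * L)) (Fin (K * L)) ℤ[X] := Matrix.of fun i j =>
  C (((Z * pr j + Xx * ps j : ℕ) : ℤ) ^ ((finProdFinEquiv.symm i).1 : ℕ)) *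
    ((X : ℤ[X]) ^ (pr j) * (1 + X) ^ (ps j)) ^ ((finProdFinEquiv.symm i).2 : ℕ)

lemma aeval_pm (Xx Z K L : ℕ) (pr ps : Fin (K * L) → ℕ) (x : ℝ) :
    aeval x (pm Xx Z K L pr ps).det = (Matrix.of fun i j : Fin (K * L) =>
      (((Z * pr j + Xx * ps j : ℕ) : ℝ) ^ ((finProdFinEquiv.symm i).1 : ℕ)) *
    (x ^ (pr j) * (1 + x) ^ (ps j)) ^ ((finProdFinEquiv.symm i).2 : ℕ)).det := by
  rw [AlgHom.map_det]
  congr 1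
  ext i j
  simp [pm]

lemma exists_points (t : ℝ) (ht : 1 < t) (Xx Z K L R S : ℕ) (hco : Nat.Coprime Xx Z)
    (hR : R + L ≤ Xx) (hK : 0 < K) (hKL : (K - 1) * L < R * S) (hX : 0 < Xx) :
    ∃ pr ps : Fin (K * L) → ℕ, (∀ i, pr i < R + L) ∧ (∀ i, ps i < S) ∧
      (aeval t (pm Xx Z K L pr ps).det : ℝ) ≠ 0 := by
  classical
  let M : Matrix (Fin (R + L) × Fin S) (Fin (K * L)) ℝ := Matrix.of fun rs i =>
    (((Z * rs.1 + Xx * rs.2 : ℕ) : ℝ) ^ ((finProdFinEquiv.symm i).1 : ℕ)) *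
    (t ^ (rs.1 : ℕ) * (1 + t) ^ (rs.2 : ℕ)) ^ ((finProdFinEquiv.symm i).2 : ℕ)
  have hinj : ∀ v : Fin (K * L) → ℝ, M.mulVec v = 0 → v = 0 := by
    intro v hv
    let p : Fin L → ℝ[X] := fun l => ∑ k : Fin K, C (v (finProdFinEquiv (k, l))) * X ^ (k : ℕ)
    have hp : ∀ l, p l = 0 := by
      refine zero_est L (K - 1) p ?_ t Z ht
        ((Finset.range R ×ˢ Finset.range S).image fun rs => ((Z * rs.1 + Xx * rs.2 : ℕ) : ℝ)) ?_ ?_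
      · intro l
        refine natDegree_sum_le_of_forall_le _ _ fun k _ => ?_
        exact (natDegree_C_mul_X_pow_le _ _).trans (by have := k.2; omega)
      · rw [Finset.card_image_of_injOn]
        · simpa using hKL
        · rintro ⟨r, s⟩ h1 ⟨r', s'⟩ h2 h
          simp only [Finset.coe_product, Set.mem_prod, Finset.mem_coe, Finset.mem_range] at h1 h2
          have h3 : Z * r + Xx * s = Z * r' + Xx * s' := by
            have : ((Z * r + Xx * s : ℕ) : ℝ) = ((Z * r' + Xx * s' : ℕ) : ℝ) := h
            exact_mod_cast this
          have h4 : Z * r ≡ Z * r' [MOD Xx] := by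
            have e1 : Z * r + Xx * s ≡ Z * r [MOD Xx] := by simp [Nat.ModEq]
            have e2 : Z * r' + Xx * s' ≡ Z * r' [MOD Xx] := by simp [Nat.ModEq]
            exact e1.symm.trans (h3 ▸ e2)
          have h5 : r ≡ r' [MOD Xx] := Nat.ModEq.cancel_left_of_coprime hco h4
          have h6 : r = r' := Nat.ModEq.eq_of_lt_of_lt h5 (by omega) (by omega)
          subst h6
          have h7 : Xx * s = Xx * s' := by omega
          have h8 := Nat.eq_of_mul_eq_mul_left hX h7
          rw [h8]
      · intro x hx
        rw [Finset.mem_image] at hx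
        obtain ⟨⟨r, s⟩, hrs, rfl⟩ := hx
        simp only [Finset.mem_product, Finset.mem_range] at hrs
        refine ⟨t ^ r * (1 + t) ^ s, by positivity, ?_⟩
        intro j hj
        have h1 := congrFun hv (⟨r + j, by omega⟩, ⟨s, hrs.2⟩)
        rw [Matrix.mulVec, dotProduct, ← Equiv.sum_comp finProdFinEquiv, Fintype.sum_prod_type,
          Finset.sum_comm] at h1
        rw [← h1.trans (Pi.zero_apply _)]
        refine Finset.sum_congr rfl fun l _ => ?_
        simp only [p, eval_finsetSum, Finset.sum_mul, M, Matrix.of_apply, Equiv.symm_apply_apply,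
          eval_mul, eval_C, eval_pow, eval_X]
        refine Finset.sum_congr rfl fun k _ => ?_
        push_cast
        rw [pow_add, mul_pow, mul_pow, mul_pow]
        have : (Z : ℝ) * r + Xx * s + Z * j = Z * (r + j) + Xx * s := by ring
        rw [this]
        ring
    ext i
    have h1 := congrArg (fun q => q.coeff ((finProdFinEquiv.symm i).1 : ℕ)) (hp (finProdFinEquiv.symm i).2)
    simp only [p, finsetSum_coeff, coeff_C_mul, coeff_X_pow, coeff_zero] at h1
    rw [Finset.sum_eq_single (finProdFinEquiv.symm i).1] at h1
    · rw [if_pos rfl, mul_one, Prod.mk.eta, Equiv.apply_symm_apply] at h1; exact h1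
    · intro b _ hb
      rw [if_neg (fun h => hb (Fin.ext h.symm)), mul_zero]
    · simp
  obtain ⟨e, he, hdet⟩ := exists_minor M hinj
  refine ⟨fun i => (e i).1, fun i => (e i).2, fun i => (e i).1.2, fun i => (e i).2.2, ?_⟩
  rw [aeval_pm, ← Matrix.det_transpose]
  exact hdet

lemma hasSum_phi (k : ℕ) (w A u : ℝ) :
    HasSum (fun n => (if n < k then 0 else A * (w ^ (n - k) / ((n - k).factorial : ℝ))) * u ^ n)
      (A * u ^ k * Real.exp (w * u)) := by
  rw [← hasSum_nat_add_iff' k]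
  rw [Finset.sum_eq_zero (fun i hi => by rw [if_pos (Finset.mem_range.mp hi), zero_mul]), sub_zero]
  have h := (NormedSpace.exp_series_hasSum_exp' (𝕂 := ℝ) (w * u)).mul_left (A * u ^ k)
  rw [← Real.exp_eq_exp_ℝ] at h
  refine h.congr_fun ?_
  intro n
  rw [if_neg (by omega), Nat.add_sub_cancel, smul_eq_mul, mul_pow, pow_add]; ring

lemma det_le' {N : ℕ} (A : Matrix (Fin N) (Fin N) ℝ) (G : ℝ) (h : ∀ i j, |A i j| ≤ G) :
    |A.det| ≤ N.factorial * G ^ N := by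
  have := Matrix.det_le (A := A) (abv := AbsoluteValue.abs) (x := G) h
  simpa using this
end SC


namespace SC

set_option maxHeartbeats 2000000 in
lemma core_ineq (t : ℝ) (ht : 1 < t) (NH : NormHyp t) (Xx Z K L R S : ℕ) (hco : Nat.Coprime Xx Z)
    (hR : R + L ≤ Xx) (hK : 0 < K) (hL : 0 < L) (hS : 0 < S) (hKL : (K - 1) * L < R * S) (hX : 0 < Xx)
    (hΛ : L * (R + L : ℕ) * |Xx * Real.log t - Z * Real.log (1 + t)| ≤ 1)
    (Xm V ρ B G η : ℝ) (hXm : Xm = ((Z * (R + L) + Xx * S : ℕ) : ℝ))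
    (hV : V = Real.log t * (R + L : ℕ) + Real.log (1 + t) * S + 1) (hρ : ρ = Real.exp 1)
    (hB : B = Xm ^ K * (1 + ρ) ^ K * Real.exp (L * V * (1 + ρ)))
    (hG : G = Xm ^ K * Real.exp (L * V))
    (hη : η = G * (2 * (L * (R + L : ℕ) * |Xx * Real.log t - Z * Real.log (1 + t)|))) :
    1 ≤ (((K * L).factorial : ℝ) * ∏ h : Fin (K * L), (B * (ρ⁻¹) ^ (h : ℕ)) +
      (K * L).factorial * ((K * L : ℕ) * G ^ (K * L) * η)) *
      ((K * L).factorial * (Xm ^ K) ^ (K * L)) *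
      ((K * L).factorial * (Xm ^ K * 2 ^ ((R + L) * L)) ^ (K * L)) := by
  obtain ⟨pr, ps, hpr, hps, hne⟩ := exists_points t ht Xx Z K L R S hco hR hK hKL hX
  have h1 := NH _ hne
  rw [aeval_pm, aeval_pm, aeval_pm] at h1
  set a := Real.log t with ha
  set c := Real.log (1 + t) with hc
  have ha0 : 0 < a := Real.log_pos ht
  have hc0 : 0 < c := Real.log_pos (by linarith)
  have hta : t = Real.exp a := (Real.exp_log (by linarith)).symm
  have htc : 1 + t = Real.exp c := (Real.exp_log (by linarith)).symm
  set Λ := (Xx : ℝ) * a - Z * c with hΛd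
  have hXr : (1 : ℝ) ≤ Xx := by exact_mod_cast hX
  have hXm1 : (1 : ℝ) ≤ Xm := by
    rw [hXm]; exact_mod_cast (by nlinarith : 1 ≤ Z * (R + L) + Xx * S)
  have hXm0 : 0 < Xm := by linarith
  have hLr : (1 : ℝ) ≤ L := by exact_mod_cast hL
  have hRpos : (0 : ℝ) ≤ ((R + L : ℕ) : ℝ) := by positivity
  -- the integers x_j
  have hxm : ∀ j, ((Z * pr j + Xx * ps j : ℕ) : ℝ) ≤ Xm := by
    intro j
    rw [hXm]
    exact_mod_cast Nat.add_le_add (Nat.mul_le_mul_left _ (hpr j).le) (Nat.mul_le_mul_left _ (hps j).le)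
  have hk : ∀ i : Fin (K * L), ((finProdFinEquiv.symm i).1 : ℕ) ≤ K := fun i => (Fin.is_lt _).le
  have hl : ∀ i : Fin (K * L), ((finProdFinEquiv.symm i).2 : ℕ) ≤ L := fun i => (Fin.is_lt _).le
  generalize hki : (fun i : Fin (K * L) => ((finProdFinEquiv.symm i).1 : ℕ)) = kk at *
  have hki' : ∀ i : Fin (K * L), ((finProdFinEquiv.symm i).1 : ℕ) = kk i := fun i => congrFun hki i
  generalize hli : (fun i : Fin (K * L) => ((finProdFinEquiv.symm i).2 : ℕ)) = ll at *
  have hli' : ∀ i : Fin (K * L), ((finProdFinEquiv.symm i).2 : ℕ) = ll i := fun i => congrFun hli i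
  simp only [hki', hli'] at h1 hk hl
  generalize hxj : (fun j => ((Z * pr j + Xx * ps j : ℕ) : ℝ)) = xx at *
  have hxj' : ∀ j, ((Z * pr j + Xx * ps j : ℕ) : ℝ) = xx j := fun j => congrFun hxj j
  simp only [hxj'] at h1 hxm
  have hx0 : ∀ j, 0 ≤ xx j := fun j => by rw [← hxj']; positivity
  have hxk : ∀ i j, |xx j ^ kk i| ≤ Xm ^ K := by
    intro i j
    rw [abs_of_nonneg (pow_nonneg (hx0 j) _)]
    exact (pow_le_pow_left₀ (hx0 j) (hxm j) _).trans (pow_le_pow_right₀ hXm1 (hk i))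
  have hXK : 1 ≤ Xm ^ K := one_le_pow₀ hXm1
  -- conjugates
  have hd2 : |(Matrix.of fun i j => xx j ^ kk i * ((-1 / (1 + t)) ^ pr j * (1 + -1 / (1 + t)) ^ ps j) ^ ll i).det|
      ≤ (K * L).factorial * (Xm ^ K) ^ (K * L) := by
    refine det_le' _ _ fun i j => ?_
    rw [Matrix.of_apply, abs_mul]
    refine (mul_le_mul (hxk i j) (?_ : _ ≤ (1 : ℝ)) (abs_nonneg _) (by positivity)).trans (by rw [mul_one])
    rw [abs_pow, abs_mul, abs_pow, abs_pow]
    have e1 : |-1 / (1 + t)| ≤ 1 := by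
      rw [abs_div, abs_neg, abs_one, abs_of_pos (by linarith), div_le_one (by linarith)]; linarith
    have e2 : |1 + -1 / (1 + t)| ≤ 1 := by
      have : 1 + -1 / (1 + t) = t / (1 + t) := by field_simp; ring
      rw [this, abs_of_pos (by positivity), div_le_one (by linarith)]; linarith
    exact pow_le_one₀ (by positivity) (mul_le_one₀ (pow_le_one₀ (abs_nonneg _) e1) (by positivity)
      (pow_le_one₀ (abs_nonneg _) e2))
  have hd3 : |(Matrix.of fun i j => xx j ^ kk i * ((-(1 + t) / t) ^ pr j * (1 + -(1 + t) / t) ^ ps j) ^ ll i).det|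
      ≤ (K * L).factorial * (Xm ^ K * 2 ^ ((R + L) * L)) ^ (K * L) := by
    refine det_le' _ _ fun i j => ?_
    rw [Matrix.of_apply, abs_mul]
    refine mul_le_mul (hxk i j) ?_ (abs_nonneg _) (by positivity)
    rw [abs_pow, abs_mul, abs_pow, abs_pow]
    have e1 : |-(1 + t) / t| ≤ 2 := by
      rw [abs_div, abs_neg, abs_of_pos (by linarith), abs_of_pos (by linarith), div_le_iff₀ (by linarith)]
      linarith
    have e2 : |1 + -(1 + t) / t| ≤ 1 := by
      have : 1 + -(1 + t) / t = -(1 / t) := by field_simp; ring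
      rw [this, abs_neg, abs_of_pos (by positivity), div_le_one (by linarith)]; linarith
    have e3 : |-(1 + t) / t| ^ pr j * |1 + -(1 + t) / t| ^ ps j ≤ 2 ^ (R + L) := by
      calc _ ≤ 2 ^ (R + L) * (1 : ℝ) := by
            refine mul_le_mul ?_ (pow_le_one₀ (abs_nonneg _) e2) (by positivity) (by positivity)
            exact (pow_le_pow_left₀ (abs_nonneg _) e1 _).trans (pow_le_pow_right₀ (by norm_num) (hpr j).le)
        _ = _ := mul_one _
    rw [pow_mul]
    exact (pow_le_pow_left₀ (by positivity) e3 _).trans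
      (pow_le_pow_right₀ (one_le_pow₀ (by norm_num)) (hl i))
  -- main bound
  have hΛ2 : ((R + L : ℕ) : ℝ) * |Λ| ≤ 1 := by
    have : 0 ≤ ((R + L : ℕ) : ℝ) * |Λ| := by positivity
    nlinarith
  have hexp : ∀ i j, (t ^ pr j * (1 + t) ^ ps j) ^ ll i = Real.exp (ll i * (pr j * a + ps j * c)) := by
    intro i j
    rw [Real.exp_nat_mul, Real.exp_add, Real.exp_nat_mul, Real.exp_nat_mul, ← hta, ← htc]
  have hlin : ∀ j, pr j * a + ps j * c = c / Xx * xx j + pr j * Λ / Xx := by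
    intro j
    rw [← hxj', hΛd]; push_cast; field_simp; ring
  have hprr : ∀ j, (pr j : ℝ) ≤ ((R + L : ℕ) : ℝ) := fun j => by exact_mod_cast (hpr j).le
  have hpsr : ∀ j, (ps j : ℝ) ≤ S := fun j => by exact_mod_cast (hps j).le
  have hllr : ∀ i, (ll i : ℝ) ≤ L := fun i => by exact_mod_cast (hl i)
  have hV1 : ∀ j, pr j * a + ps j * c ≤ V := by
    intro j; rw [hV]
    nlinarith [hprr j, hpsr j]
  have hV0 : 0 ≤ V := by rw [hV]; positivity
  have hW : c / Xx * Xm ≤ V := by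
    have : c / Xx * Xm = a * (R + L : ℕ) + c * S - ((R + L : ℕ) : ℝ) * Λ / Xx := by
      rw [hXm, hΛd]; push_cast; field_simp; ring
    rw [this, hV]
    have : |((R + L : ℕ) : ℝ) * Λ / Xx| ≤ 1 := by
      rw [abs_div, abs_mul, abs_of_nonneg hRpos, abs_of_pos (by linarith : (0:ℝ) < Xx), div_le_one (by linarith)]
      linarith
    have := (abs_le.mp this).1
    linarith
  have hW0 : 0 ≤ c / Xx * Xm := by positivity
  have hW1 : ∀ j, c / Xx * xx j ≤ V := fun j =>
    (mul_le_mul_of_nonneg_left (hxm j) (by positivity)).trans hW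
  have hΛ3 : ∀ i j, |(ll i : ℝ) * (pr j * Λ / Xx)| ≤ L * (R + L : ℕ) * |Λ| := by
    intro i j
    rw [abs_mul, abs_div, abs_mul, Nat.abs_cast, Nat.abs_cast, Nat.abs_cast]
    calc (ll i : ℝ) * (pr j * |Λ| / Xx) ≤ L * ((R + L : ℕ) * |Λ| / 1) := by
          gcongr
          · exact hl i
          · exact (hpr j).le
      _ = _ := by ring
  have hm := det_lip (Matrix.of fun i j => xx j ^ kk i * (t ^ pr j * (1 + t) ^ ps j) ^ ll i)
    (Matrix.of fun i j => xx j ^ kk i * Real.exp (ll i * (c / Xx * xx j))) G η ?_ ?_ ?_ ?_ ?_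
  rotate_left
  · rw [hG]
    exact one_le_mul_of_one_le_of_one_le hXK (Real.one_le_exp (by positivity))
  · intro i j
    rw [Matrix.of_apply, abs_mul, hexp, Real.abs_exp, hG]
    refine mul_le_mul (hxk i j) (Real.exp_le_exp.mpr ?_) (Real.exp_pos _).le (by positivity)
    exact mul_le_mul (hllr i) (hV1 j) (by positivity) (by positivity)
  · intro i j
    rw [Matrix.of_apply, abs_mul, Real.abs_exp, hG]
    refine mul_le_mul (hxk i j) (Real.exp_le_exp.mpr ?_) (Real.exp_pos _).le (by positivity)
    exact mul_le_mul (hllr i) (hW1 j) (mul_nonneg (by positivity) (hx0 j)) (by positivity)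
  · intro i j
    rw [Matrix.of_apply, Matrix.of_apply, hexp, hlin, ← mul_sub, abs_mul, mul_add, Real.exp_add, hη, hG]
    have e1 : Real.exp (ll i * (c / Xx * xx j)) * Real.exp (ll i * (pr j * Λ / Xx)) - Real.exp (ll i * (c / Xx * xx j))
      = Real.exp (ll i * (c / Xx * xx j)) * (Real.exp (ll i * (pr j * Λ / Xx)) - 1) := by ring
    rw [e1, abs_mul, Real.abs_exp, mul_assoc]
    refine mul_le_mul (hxk i j) ?_ (by positivity) (by positivity)
    refine mul_le_mul (Real.exp_le_exp.mpr ?_) ?_ (abs_nonneg _) (Real.exp_pos _).le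
    · exact mul_le_mul (hllr i) (hW1 j) (mul_nonneg (by positivity) (hx0 j)) (by positivity)
    · refine (Real.abs_exp_sub_one_le ((hΛ3 i j).trans hΛ)).trans ?_
      linarith [hΛ3 i j]
  · rw [hη, hG]; positivity
  have hρ0 : 0 < ρ := by rw [hρ]; exact Real.exp_pos _
  have hsum : ∀ i : Fin (K * L), ∀ u : ℝ, HasSum (fun n => (if n < kk i then 0 else Xm ^ kk i *
      (((ll i : ℝ) * (c / Xx * Xm)) ^ (n - kk i) / ((n - kk i).factorial : ℝ))) * u ^ n)
      (Xm ^ kk i * u ^ kk i * Real.exp ((ll i : ℝ) * (c / Xx * Xm) * u)) :=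
    fun i u => hasSum_phi _ _ _ _
  have hintg := interp_det (K * L) (fun j => xx j / Xm) (fun j => div_nonneg (hx0 j) hXm0.le)
    (fun j => (div_le_one hXm0).mpr (hxm j))
    (fun i n => if n < kk i then 0 else Xm ^ kk i * (((ll i : ℝ) * (c / Xx * Xm)) ^ (n - kk i) / ((n - kk i).factorial : ℝ)))
    (fun i n => by split_ifs; exacts [le_rfl, by positivity]) ρ B hρ0
    (fun i => (hsum i (1 + ρ)).summable)
    (fun i => by
      rw [(hsum i (1 + ρ)).tsum_eq, hB]
      have e1 : Xm ^ kk i ≤ Xm ^ K := pow_le_pow_right₀ hXm1 (hk i)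
      have e2 : (1 + ρ) ^ kk i ≤ (1 + ρ) ^ K := pow_le_pow_right₀ (by linarith) (hk i)
      have e3 : (ll i : ℝ) * (c / Xx * Xm) ≤ L * V := mul_le_mul (hllr i) hW hW0 (by positivity)
      gcongr)
    (Matrix.of fun i j => xx j ^ kk i * Real.exp (ll i * (c / Xx * xx j)))
    (fun i j => by
      have := hsum i (xx j / Xm)
      convert this using 1
      rw [Matrix.of_apply, ← mul_pow, mul_div_cancel₀ _ hXm0.ne']
      congr 2
      field_simp)
  have hfin := hm.trans (add_le_add_left hintg _)
  refine h1.trans ?_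
  have hp := (abs_nonneg _).trans hfin
  exact mul_le_mul (mul_le_mul hfin hd2 (abs_nonneg _) hp) hd3 (abs_nonneg _)
    (mul_nonneg hp (by positivity))
end SC


namespace SC

lemma prod_geo (N : ℕ) (B : ℝ) :
    ∏ h : Fin N, (B * ((Real.exp 1)⁻¹) ^ (h : ℕ)) = B ^ N * Real.exp (-((N : ℝ) * (N - 1) / 2)) := by
  rw [Finset.prod_mul_distrib, Finset.prod_const, Finset.card_univ, Fintype.card_fin,
    Finset.prod_pow_eq_pow_sum, Fin.sum_univ_eq_sum_range (fun i => i), ← Real.exp_neg, ← Real.exp_nat_mul]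
  congr 2
  have h := Finset.sum_range_id_mul_two N
  have h2 : ((∑ i ∈ Finset.range N, i : ℕ) : ℝ) * 2 = N * (N - 1) := by
    rcases Nat.eq_zero_or_pos N with h0 | h0
    · subst h0; simp
    · have h3 : ((N - 1 : ℕ) : ℝ) = N - 1 := by rw [Nat.cast_sub h0]; simp
      rw [← h3]; exact_mod_cast h
  linarith

set_option maxHeartbeats 1000000 in
theorem baker (t : ℝ) (ht : 1 < t) (ht7 : Real.log (1 + t) ≤ 7) (NH : NormHyp t) (Xx Z L : ℕ)
    (hco : Nat.Coprime Xx Z) (hZ : Z ≤ Xx) (hL : 1000 ≤ L) (hX1 : 401 * L ≤ Xx)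
    (hX2 : (Xx : ℝ) ≤ Real.exp (L / 24))
    (hΛ : |Xx * Real.log t - Z * Real.log (1 + t)| ≤ Real.exp (-(10 ^ 10 * (L : ℝ) ^ 4))) : False := by
  have hLr : (1000 : ℝ) ≤ L := by exact_mod_cast hL
  set l : ℝ := (L : ℝ) with hl
  have hl0 : 0 ≤ l := by linarith
  -- exponential bounds
  have hb1 : 801 * l ≤ Real.exp (l / 24) := by
    refine le_trans ?_ (Real.pow_div_factorial_le_exp (l / 24) (by positivity) 6)
    rw [le_div_iff₀ (by positivity), div_pow, le_div_iff₀ (by positivity)]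
    have : (1000 : ℝ) ^ 5 ≤ l ^ 5 := by gcongr
    norm_num [Nat.factorial]
    nlinarith
  have hb2 : 160000 * l ^ 2 ≤ Real.exp l := by
    refine le_trans ?_ (Real.pow_div_factorial_le_exp l (by positivity) 5)
    rw [le_div_iff₀ (by positivity)]
    have : (1000 : ℝ) ^ 3 ≤ l ^ 3 := by gcongr
    norm_num [Nat.factorial]
    nlinarith [sq_nonneg l]
  set N := 160000 * L * L with hN
  have hNr : (N : ℝ) = 160000 * l ^ 2 := by rw [hN]; push_cast; ring
  have hN1 : 1 ≤ N := by nlinarith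
  have hNe : (N : ℝ) ≤ Real.exp l := by rw [hNr]; exact hb2
  have hfac : (N.factorial : ℝ) ≤ Real.exp (N * l) := by
    calc (N.factorial : ℝ) ≤ (N : ℝ) ^ N := by exact_mod_cast Nat.factorial_le_pow N
      _ ≤ (Real.exp l) ^ N := by gcongr
      _ = _ := by rw [← Real.exp_nat_mul]
  set Λ := (Xx : ℝ) * Real.log t - Z * Real.log (1 + t) with hΛd
  have hl4 : 10 ^ 12 ≤ l ^ 4 := by
    calc (10:ℝ) ^ 12 = 1000 ^ 4 := by norm_num
      _ ≤ _ := by gcongr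
  have hΛ1 : (L : ℝ) * (400 * L + L : ℕ) * |Λ| ≤ 1 := by
    push_cast
    have h1 : l * (400 * l + l) ≤ Real.exp l := by linarith [hb2, sq_nonneg l]
    calc _ ≤ Real.exp l * Real.exp (-(10 ^ 10 * (L : ℝ) ^ 4)) := by gcongr
      _ = Real.exp (l - 10 ^ 10 * l ^ 4) := by rw [← Real.exp_add]; congr 1
      _ ≤ 1 := Real.exp_le_one_iff.mpr (by
          have : l ≤ l ^ 4 := le_self_pow₀ (by linarith) (by norm_num)
          linarith)
  have hcore := core_ineq t ht NH Xx Z (160000 * L) L (400 * L) (400 * L) hco (by omega) (by omega)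
    (by omega) (by omega) (by
      have h : 160000 * L - 1 < 160000 * L := by omega
      calc (160000 * L - 1) * L < 160000 * L * L := Nat.mul_lt_mul_of_pos_right h (by omega)
        _ = _ := by ring) (by omega) hΛ1 _ _ _ _ _ _ rfl rfl rfl rfl rfl rfl
  rw [← hN, prod_geo] at hcore
  set Xm : ℝ := ((Z * (400 * L + L) + Xx * (400 * L) : ℕ) : ℝ) with hXm
  set V := Real.log t * (400 * L + L : ℕ) + Real.log (1 + t) * (400 * L : ℕ) + 1 with hV
  have hXm0 : 0 ≤ Xm := by positivity
  have hXme : Xm ≤ Real.exp (l / 12) := by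
    have hZr : (Z : ℝ) ≤ Xx := by exact_mod_cast hZ
    calc Xm = Z * (401 * l) + Xx * (400 * l) := by rw [hXm]; push_cast; ring
      _ ≤ Xx * (401 * l) + Xx * (400 * l) := by gcongr
      _ = Xx * (801 * l) := by ring
      _ ≤ Real.exp (l / 24) * Real.exp (l / 24) := by gcongr
      _ = _ := by rw [← Real.exp_add]; congr 1; ring
  have hXK : Xm ^ (160000 * L) ≤ Real.exp (160000 / 12 * l ^ 2) := by
    calc _ ≤ (Real.exp (l / 12)) ^ (160000 * L) := by gcongr
      _ = _ := by rw [← Real.exp_nat_mul]; congr 1; push_cast; ring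
  have hlog : Real.log t ≤ 7 := (Real.log_le_log (by linarith) (by linarith)).trans ht7
  have hV1 : V ≤ 5608 * l := by
    rw [hV]; push_cast
    have h1 := mul_le_mul_of_nonneg_right hlog (by positivity : 0 ≤ 400 * l + l)
    have h2 := mul_le_mul_of_nonneg_right ht7 (by positivity : 0 ≤ 400 * l)
    linarith
  have hV0 : 0 ≤ V := by
    have := Real.log_pos ht
    have := Real.log_pos (by linarith : 1 < 1 + t)
    positivity
  have he := Real.exp_one_lt_d9
  have he' := Real.exp_one_gt_d9
  have he2 : 1 + Real.exp 1 ≤ Real.exp 2 := by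
    have : Real.exp 2 = Real.exp 1 * Real.exp 1 := by rw [← Real.exp_add]; norm_num
    have := mul_le_mul_of_nonneg_right (by linarith : 2 ≤ Real.exp 1) (Real.exp_pos 1).le
    linarith
  set B := Xm ^ (160000 * L) * (1 + Real.exp 1) ^ (160000 * L) * Real.exp (l * V * (1 + Real.exp 1)) with hB
  set G := Xm ^ (160000 * L) * Real.exp (l * V) with hG
  have hBe : B ≤ Real.exp (160000 / 12 * l ^ 2 + 320000 * l + 20862 * l ^ 2) := by
    rw [Real.exp_add, Real.exp_add, hB]
    have h1 : (1 + Real.exp 1) ^ (160000 * L) ≤ Real.exp (320000 * l) := by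
      calc _ ≤ (Real.exp 2) ^ (160000 * L) := by gcongr
        _ = _ := by rw [← Real.exp_nat_mul]; congr 1; push_cast; ring
    have h2 : l * V * (1 + Real.exp 1) ≤ 20862 * l ^ 2 := by
      calc _ ≤ l * (5608 * l) * 3.72 := by gcongr; linarith
        _ ≤ _ := by linarith [sq_nonneg l]
    gcongr
  have hGe : G ≤ Real.exp (160000 / 12 * l ^ 2 + 5608 * l ^ 2) := by
    rw [Real.exp_add, hG]
    have h2 : l * V ≤ 5608 * l ^ 2 := by
      have := mul_le_mul_of_nonneg_left hV1 hl0
      linarith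
    gcongr
  have h2e : (2 : ℝ) ^ ((400 * L + L) * L) ≤ Real.exp (401 * l ^ 2) := by
    calc (2 : ℝ) ^ ((400 * L + L) * L) ≤ (Real.exp 1) ^ ((400 * L + L) * L) := by gcongr; linarith
      _ = _ := by rw [← Real.exp_nat_mul]; congr 1; push_cast; ring
  have hB0 : 0 ≤ B := by positivity
  have hG0 : 0 ≤ G := by positivity
  have hE2 : (N.factorial : ℝ) * (Xm ^ (160000 * L)) ^ N ≤ Real.exp (N * l + N * (160000 / 12 * l ^ 2)) := by
    rw [Real.exp_add, Real.exp_nat_mul _ N, Real.exp_nat_mul _ N, ← Real.exp_nat_mul l N]; gcongr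
  have hE3 : (N.factorial : ℝ) * (Xm ^ (160000 * L) * 2 ^ ((400 * L + L) * L)) ^ N ≤
      Real.exp (N * l + N * (160000 / 12 * l ^ 2 + 401 * l ^ 2)) := by
    rw [Real.exp_add, Real.exp_nat_mul _ N, Real.exp_nat_mul _ N, ← Real.exp_nat_mul l N, Real.exp_add]; gcongr
  have hT1 : (N.factorial : ℝ) * (B ^ N * Real.exp (-((N : ℝ) * (N - 1) / 2))) ≤
      Real.exp (N * l + N * (160000 / 12 * l ^ 2 + 320000 * l + 20862 * l ^ 2) + -((N : ℝ) * (N - 1) / 2)) := by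
    rw [add_assoc, Real.exp_add, Real.exp_add _ (-((N : ℝ) * (N - 1) / 2)), Real.exp_nat_mul _ N, Real.exp_nat_mul _ N, ← Real.exp_nat_mul l N]; gcongr
  have hη : 2 * (l * (400 * L + L : ℕ) * |Λ|) ≤ Real.exp (l - 10 ^ 10 * l ^ 4) := by
    rw [sub_eq_add_neg, Real.exp_add]
    push_cast
    have h1 : 2 * (l * (400 * l + l)) ≤ Real.exp l := by linarith [hb2, sq_nonneg l]
    calc _ = 2 * (l * (400 * l + l)) * |Λ| := by ring
      _ ≤ _ := by gcongr
  have hT2 : (N.factorial : ℝ) * (N * G ^ N * (G * (2 * (l * (400 * L + L : ℕ) * |Λ|)))) ≤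
      Real.exp (N * l + (l + N * (160000 / 12 * l ^ 2 + 5608 * l ^ 2) +
        ((160000 / 12 * l ^ 2 + 5608 * l ^ 2) + (l - 10 ^ 10 * l ^ 4)))) := by
    rw [Real.exp_add, Real.exp_add (l + _), Real.exp_add l, Real.exp_add (_ + _) (l - _), Real.exp_nat_mul _ N, Real.exp_nat_mul _ N, ← Real.exp_nat_mul l N]
    gcongr
  have hq : Real.exp (-2) ≤ 1 / 4 := by
    rw [Real.exp_neg, inv_eq_one_div]
    apply one_div_le_one_div_of_le (by norm_num)
    have : Real.exp 2 = Real.exp 1 * Real.exp 1 := by rw [← Real.exp_add]; norm_num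
    have := mul_le_mul_of_nonneg_right (by linarith : 2 ≤ Real.exp 1) (Real.exp_pos 1).le
    linarith
  have hNr1 : (1 : ℝ) ≤ N := by exact_mod_cast hN1
  have hl2 : 1000 * l ≤ l ^ 2 := by
    have := mul_le_mul_of_nonneg_right hLr hl0
    linarith
  have hfin : (1 : ℝ) ≤ 1 / 4 + 1 / 4 := by
    refine hcore.trans ?_
    rw [add_mul, add_mul]
    refine add_le_add ?_ ?_
    · refine (mul_le_mul (mul_le_mul hT1 hE2 (by positivity) (by positivity)) hE3 (by positivity) (by positivity)).trans ?_
      rw [← Real.exp_add, ← Real.exp_add]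
      refine (Real.exp_le_exp.mpr ?_).trans hq
      have key : l + (160000 / 12 * l ^ 2 + 320000 * l + 20862 * l ^ 2) - (N - 1) / 2 + (l + 160000 / 12 * l ^ 2)
        + (l + (160000 / 12 * l ^ 2 + 401 * l ^ 2)) ≤ -2 := by
        rw [hNr]; linarith
      have h5 := mul_le_mul_of_nonneg_left key (by linarith : (0:ℝ) ≤ N)
      linarith
    · refine (mul_le_mul (mul_le_mul hT2 hE2 (by positivity) (by positivity)) hE3 (by positivity) (by positivity)).trans ?_
      rw [← Real.exp_add, ← Real.exp_add]
      refine (Real.exp_le_exp.mpr ?_).trans hq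
      rw [hNr]
      have h3 : l ^ 3 * 1000 ≤ l ^ 4 := by
        have := mul_le_mul_of_nonneg_left hl2 (sq_nonneg l)
        linarith
      have h2 : l ^ 2 * 1000 ≤ l ^ 3 := by
        have := mul_le_mul_of_nonneg_left hl2 hl0
        linarith
      linarith
  norm_num at hfin
end SC


namespace SC

def ch (x : ℚ) (j : ℕ) : ℚ := ∏ i ∈ Finset.range j, (x - i) / (i + 1)

lemma ch_succ (x : ℚ) (j : ℕ) : ((j : ℚ) + 1) * ch x (j+1) = ch x j * (x - j) := by
  unfold ch
  rw [Finset.prod_range_succ]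
  field_simp

lemma ch_zero (x : ℚ) : ch x 0 = 1 := by simp [ch]

lemma ch_succ_left (x : ℚ) (j : ℕ) : ((j : ℚ) + 1) * ch (x+1) (j+1) = (x + 1) * ch x j := by
  induction j with
  | zero => simp [ch]
  | succ k ih =>
    have h1 := ch_succ (x+1) (k+1)
    have h2 := ch_succ x k
    push_cast at *
    have hk : ((k:ℚ)+1) ≠ 0 := by positivity
    apply mul_left_cancel₀ hk
    linear_combination (↑k + 1) * h1 + (x - k) * ih - (x+1) * h2

/-- coefficients of (1-X)^ν -/
def bc (ν : ℚ) (k : ℕ) : ℚ := (-1)^k * ch ν k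

lemma bc_succ (ν : ℚ) (k : ℕ) : ((k:ℚ)+1) * bc ν (k+1) = (k - ν) * bc ν k := by
  unfold bc
  linear_combination (-1)^(k+1) * ch_succ ν k

def ac (ν : ℚ) (r j : ℕ) : ℚ := if j ≤ r then (-1)^j * ((2*r-j).choose r : ℚ) * ch (r - ν) j else 0

lemma ac_succ (ν : ℚ) (r j : ℕ) :
    ((j:ℚ)+1) * (2*r-j) * ac ν r (j+1) = -((r:ℚ)-j)*(r-ν-j) * ac ν r j := by
  unfold ac
  rcases lt_trichotomy j r with h | h | h
  · rw [if_pos (by omega : j + 1 ≤ r), if_pos h.le]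
    obtain ⟨d, rfl⟩ : ∃ d, r = j + 1 + d := ⟨r - (j+1), by omega⟩
    have e1 : 2 * (j+1+d) - (j+1) = j + 1 + 2*d := by omega
    have e2 : 2 * (j+1+d) - j = j + 1 + 2*d + 1 := by omega
    rw [e1, e2]
    have h1 := Nat.choose_mul_succ_eq (j+1+2*d) (j+1+d)
    rw [show j+1+2*d+1-(j+1+d) = d+1 by omega] at h1
    have h2 : (((j+1+2*d).choose (j+1+d) : ℕ):ℚ) * (j+1+2*d+1) = ((j+1+2*d+1).choose (j+1+d) : ℕ) * (d+1) := by
      exact_mod_cast h1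
    have h3 := ch_succ (((j+1+d : ℕ):ℚ) - ν) j
    push_cast at *
    generalize ((Nat.choose (j+1+2*d) (j+1+d) : ℕ) : ℚ) = c1 at *
    generalize ((Nat.choose (j+1+2*d+1) (j+1+d) : ℕ) : ℚ) = c2 at *
    linear_combination (-1)^(j+1) * (j+1+2*d+1) * c1 * h3 - (-1)^j * ch (j+1+d-ν) j * (j+1+d-ν-j) * h2
  · subst h
    simp
  · rw [if_neg (by omega), if_neg (by omega)]; simp

def uc (ν : ℚ) (r k : ℕ) : ℚ := ∑ ij ∈ Finset.HasAntidiagonal.antidiagonal k, ac ν r ij.1 * bc ν ij.2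

lemma uc_succ (ν : ℚ) (r k : ℕ) :
    ((k:ℚ)+1) * (k - 2*r) * uc ν r (k+1) = ((k:ℚ)-r)*(k-r-ν) * uc ν r k := by
  have h1 : ((k:ℚ)+1) * (k - 2*r) * uc ν r (k+1) =
      ∑ ij ∈ Finset.HasAntidiagonal.antidiagonal (k+1), (-(ij.1:ℚ) * (2*r+1-ij.1) * ac ν r ij.1) * bc ν ij.2
      + ∑ ij ∈ Finset.HasAntidiagonal.antidiagonal (k+1), (2*ij.1+ij.2-1-2*r) * ac ν r ij.1 * (ij.2 * bc ν ij.2) := by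
    rw [← Finset.sum_add_distrib, uc, Finset.mul_sum]
    apply Finset.sum_congr rfl
    rintro ⟨i, j⟩ hij
    have : i + j = k + 1 := by simpa using hij
    have hk : (k:ℚ) = i + j - 1 := by
      have : ((i+j:ℕ):ℚ) = ((k+1:ℕ):ℚ) := by rw [this]
      push_cast at this; linarith
    simp only [hk]; ring
  rw [h1, Finset.Nat.sum_antidiagonal_succ, Finset.Nat.sum_antidiagonal_succ', uc, Finset.mul_sum]
  simp only [Nat.cast_zero, neg_zero, zero_mul, mul_zero, zero_add, add_zero]
  rw [← Finset.sum_add_distrib]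
  apply Finset.sum_congr rfl
  rintro ⟨i, j⟩ hij
  have : i + j = k := by simpa using hij
  subst this
  have ha := ac_succ ν r i
  have hb := bc_succ ν j
  push_cast
  linear_combination (-bc ν j) * ha + (2*i+(j+1)-1-2*r) * ac ν r i * hb

lemma uc_zero (ν : ℚ) (r : ℕ) : uc ν r 0 = ((2*r).choose r : ℚ) := by
  simp [uc, ac, bc, ch_zero]

lemma uc_le (ν : ℚ) (r k : ℕ) (hk : k ≤ r) : uc ν r k = ac (-ν) r k := by
  induction k with
  | zero => simp [uc_zero, ac, ch_zero]
  | succ k ih =>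
    have h1 := uc_succ ν r k
    have h2 := ac_succ (-ν) r k
    rw [ih (by omega)] at h1
    have hk' : ((k:ℚ)+1 ≤ r) := by exact_mod_cast hk
    have h0 : (0:ℚ) ≤ k := by positivity
    have hne : ((k:ℚ)+1) * (k - 2*r) ≠ 0 := by
      apply mul_ne_zero
      · positivity
      · linarith
    apply mul_left_cancel₀ hne
    linear_combination h1 + h2

lemma uc_mid (ν : ℚ) (r k : ℕ) (hk : r < k) (hk2 : k ≤ 2*r) : uc ν r k = 0 := by
  induction k with
  | zero => omega
  | succ k ih =>
    have h1 := uc_succ ν r k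
    have hk' : ((k:ℚ)+1 ≤ 2*r) := by exact_mod_cast hk2
    have h0 : (0:ℚ) ≤ k := by positivity
    have hne : ((k:ℚ)+1) * (k - 2*r) ≠ 0 := by
      apply mul_ne_zero
      · positivity
      · linarith
    apply mul_left_cancel₀ hne
    rw [h1]
    rcases Nat.lt_or_ge r k with h | h
    · rw [ih h (by omega)]; ring
    · have : k = r := by omega
      subst this; ring

lemma uc_tail (ν : ℚ) (h0 : 0 ≤ ν) (h1 : ν ≤ 1) (r j : ℕ) :
    |uc ν r (2*r+1+j)| ≤ |uc ν r (2*r+1)| * ((r+j).choose j : ℚ) := by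
  induction j with
  | zero => simp
  | succ j ih =>
    have h := uc_succ ν r (2*r+1+j)
    push_cast at h
    have hc : (((r+(j+1)).choose (j+1) : ℕ):ℚ) * (j+1) = ((r+j).choose j : ℕ) * (r+j+1) := by
      have := Nat.add_one_mul_choose_eq (r+j) j
      have h2 : (((r+j+1 : ℕ) * (r+j).choose j : ℕ) : ℚ) = (((r+j+1).choose (j+1) * (j+1) : ℕ):ℚ) := by
        exact_mod_cast this
      push_cast at h2
      rw [← add_assoc]
      linear_combination -h2
    have e : |uc ν r (2*r+1+(j+1))| * ((2*r+2+j)*(j+1)) = |uc ν r (2*r+1+j)| * ((r+1+j) * (r+1+j-ν)) := by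
      have hr : (0:ℚ) ≤ r := by positivity
      have hj : (0:ℚ) ≤ j := by positivity
      have a1 : |((2*(r:ℚ)+2+j)*(j+1))| = ((2*r+2+j)*(j+1)) := abs_of_nonneg (by positivity)
      have a2 : |((r:ℚ)+1+j) * (r+1+j-ν)| = ((r+1+j) * (r+1+j-ν)) := abs_of_nonneg (mul_nonneg (by positivity) (by linarith))
      rw [← a1, ← a2, ← abs_mul, ← abs_mul]
      congr 1
      rw [← add_assoc]
      linear_combination h
    have hr : (0:ℚ) ≤ r := by positivity
    have hj : (0:ℚ) ≤ j := by positivity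
    have hpos : (0:ℚ) < (2*r+2+j)*(j+1) := by positivity
    refine le_of_mul_le_mul_right ?_ hpos
    rw [e]
    clear e h
    generalize (((r+(j+1)).choose (j+1) : ℕ):ℚ) = c1 at *
    have hc0 : (0:ℚ) ≤ (((r+j).choose j : ℕ):ℚ) := by positivity
    generalize (((r+j).choose j : ℕ):ℚ) = c2 at *
    have hv : 0 ≤ |uc ν r (2*r+1)| := abs_nonneg _
    generalize |uc ν r (2*r+1)| = v at *
    generalize |uc ν r (2*r+1+j)| = w at *
    calc w * ((r+1+j) * (r+1+j-ν)) ≤ (v * c2) * ((r+1+j) * (2*r+2+j)) := by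
          apply mul_le_mul ih _ _ (by positivity)
          · apply mul_le_mul_of_nonneg_left _ (by positivity); linarith
          · exact mul_nonneg (by positivity) (by linarith)
      _ = _ := by linear_combination -(v * (2*r+2+j)) * hc

noncomputable def Qp (ν : ℚ) (r : ℕ) : ℚ[X] := ∑ j ∈ Finset.range (r+1), C (ac ν r j) * X^j

lemma Qp_coeff (ν : ℚ) (r k : ℕ) : (Qp ν r).coeff k = ac ν r k := by
  unfold Qp
  rw [finsetSum_coeff]
  simp only [coeff_C_mul, coeff_X_pow, mul_ite, mul_one, mul_zero]
  rw [Finset.sum_ite_eq]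
  split_ifs with h
  · rfl
  · unfold ac; rw [if_neg]; simpa using h

lemma Qp_deg (ν : ℚ) (r : ℕ) : (Qp ν r).natDegree ≤ r := by
  rw [natDegree_le_iff_coeff_eq_zero]
  intro k hk
  rw [Qp_coeff, ac, if_neg (by omega)]

lemma series_id (ν : ℚ) (r : ℕ) : ∃ S : PowerSeries ℚ, PowerSeries.constantCoeff S = uc ν r (2*r+1) ∧
    (Qp ν r : PowerSeries ℚ) * PowerSeries.mk (bc ν) = (Qp (-ν) r : PowerSeries ℚ) + PowerSeries.X^(2*r+1) * S := by
  refine ⟨PowerSeries.mk (fun j => uc ν r (2*r+1+j)), by simp, ?_⟩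
  ext k
  rw [PowerSeries.coeff_mul, map_add, PowerSeries.coeff_X_pow_mul']
  simp only [Polynomial.coeff_coe, Qp_coeff, PowerSeries.coeff_mk]
  have : ∑ x ∈ Finset.HasAntidiagonal.antidiagonal k, ac ν r x.1 * bc ν x.2 = uc ν r k := rfl
  rw [this]
  split_ifs with h
  · rw [show ac (-ν) r k = 0 by rw [ac, if_neg (by omega)], show 2*r+1+(k-(2*r+1)) = k by omega]; ring
  · rcases Nat.lt_or_ge r k with h2 | h2
    · rw [uc_mid ν r k h2 (by omega), show ac (-ν) r k = 0 by rw [ac, if_neg (by omega)]]; ring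
    · rw [uc_le ν r k h2]; ring

noncomputable def kap (ν : ℚ) (r : ℕ) : ℚ := ch (r+ν) r * ch (r-ν) r * (2*ν/(r+1))

lemma D_main (ν : ℚ) (r : ℕ) :
    Qp (-ν) r * Qp ν (r+1) - Qp (-ν) (r+1) * Qp ν r = C (kap ν r) * X^(2*r+1) ∧
    uc ν r (2*r+1) * ((2*(r+1)).choose (r+1) : ℚ) = - kap ν r := by
  obtain ⟨S, hS0, hS⟩ := series_id ν r
  obtain ⟨S', -, hS'⟩ := series_id ν (r+1)
  set D := Qp (-ν) r * Qp ν (r+1) - Qp (-ν) (r+1) * Qp ν r with hD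
  have hps : (D : PowerSeries ℚ) = PowerSeries.X^(2*r+1) * (PowerSeries.X^2 * S' * (Qp ν r : PowerSeries ℚ) - S * (Qp ν (r+1) : PowerSeries ℚ)) := by
    rw [hD]; push_cast
    linear_combination (Qp ν r : PowerSeries ℚ) * hS' - (Qp ν (r+1) : PowerSeries ℚ) * hS
  have hlow : ∀ k < 2*r+1, D.coeff k = 0 := by
    intro k hk
    rw [← Polynomial.coeff_coe, hps, PowerSeries.coeff_X_pow_mul', if_neg (by omega)]
  have hmid : D.coeff (2*r+1) = - (uc ν r (2*r+1) * ((2*(r+1)).choose (r+1) : ℚ)) := by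
    rw [← Polynomial.coeff_coe, hps, PowerSeries.coeff_X_pow_mul', if_pos le_rfl]
    simp only [Nat.sub_self, PowerSeries.coeff_zero_eq_constantCoeff, map_sub, map_mul, map_pow, hS0, PowerSeries.constantCoeff_X]
    have e1 : PowerSeries.constantCoeff (Qp ν (r+1) : PowerSeries ℚ) = ((2*(r+1)).choose (r+1) : ℚ) := by
      rw [← PowerSeries.coeff_zero_eq_constantCoeff_apply, Polynomial.coeff_coe, Qp_coeff]
      simp [ac, ch_zero]
    rw [e1]; ring
  have hhigh : ∀ k, 2*r+1 < k → D.coeff k = 0 := by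
    intro k hk
    apply coeff_eq_zero_of_natDegree_lt
    refine lt_of_le_of_lt ?_ hk
    rw [hD]
    refine (natDegree_sub_le _ _).trans (max_le ?_ ?_)
    · exact (natDegree_mul_le_of_le (Qp_deg _ _) (Qp_deg _ _)).trans (by omega)
    · exact (natDegree_mul_le_of_le (Qp_deg _ _) (Qp_deg _ _)).trans (by omega)
  have hlead : D.coeff (2*r+1) = kap ν r := by
    rw [hD, coeff_sub]
    have e1 := coeff_mul_add_eq_of_natDegree_le (Qp_deg (-ν) r) (Qp_deg ν (r+1))
    have e2 := coeff_mul_add_eq_of_natDegree_le (Qp_deg (-ν) (r+1)) (Qp_deg ν r)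
    rw [show r + (r+1) = 2*r+1 by ring] at e1
    rw [show (r+1) + r = 2*r+1 by ring] at e2
    rw [e1, e2]
    simp only [Qp_coeff, ac, le_refl, if_true]
    rw [show 2*r-r = r by omega, show 2*(r+1)-(r+1) = r+1 by omega]
    have c1 := ch_succ_left (r-ν) r
    have c2 := ch_succ_left (r+ν) r
    have hr : ((r:ℚ)+1) ≠ 0 := by positivity
    have s : (-1:ℚ)^r * (-1)^r = 1 := by rw [← mul_pow]; simp
    simp only [Nat.choose_self, kap]
    push_cast
    rw [show (r:ℚ)+1-ν = r-ν+1 by ring, show (r:ℚ)+1- -ν = r+ν+1 by ring, show (r:ℚ) - -ν = r+ν by ring]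
    apply mul_left_cancel₀ hr
    field_simp
    rw [pow_succ]
    linear_combination ((-1:ℚ)^r * (-1)^r) * ch (r-ν) r * c2 - ((-1:ℚ)^r * (-1)^r)* ch (r+ν) r * c1 + 2*ν*ch (r-ν) r * ch (r+ν) r* s
  refine ⟨?_, ?_⟩
  · ext k
    rw [coeff_C_mul, coeff_X_pow]
    rcases lt_trichotomy k (2*r+1) with h | h | h
    · rw [hlow k h, if_neg (by omega)]; simp
    · rw [h, hlead]; simp
    · rw [hhigh k h, if_neg (by omega)]; simp
  · rw [← hlead, hmid]; ring

lemma ch_pm (ν : ℚ) (h0 : 0 < ν) (h1 : ν < 1) (r : ℕ) :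
    0 < ch (r+ν) r ∧ 0 < ch (r-ν) r ∧ ch (r+ν) r * ch (r-ν) r ≤ 1 := by
  induction r with
  | zero => simp [ch_zero]
  | succ r ih =>
    obtain ⟨i1, i2, i3⟩ := ih
    have c1 := ch_succ_left (r-ν) r
    have c2 := ch_succ_left (r+ν) r
    have hr : (0:ℚ) ≤ r := by positivity
    have hr1 : (0:ℚ) < r+1 := by positivity
    push_cast
    rw [show (r:ℚ)+1-ν = r-ν+1 by ring, show (r:ℚ)+1+ν = r+ν+1 by ring]
    have p1 : ch (r-ν+1) (r+1) = (r-ν+1) * ch (r-ν) r / (r+1) := by field_simp; linear_combination c1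
    have p2 : ch (r+ν+1) (r+1) = (r+ν+1) * ch (r+ν) r / (r+1) := by field_simp; linear_combination c2
    rw [p1, p2]
    have q1 : 0 < r-ν+1 := by linarith
    have q2 : 0 < r+ν+1 := by linarith
    refine ⟨by positivity, by positivity, ?_⟩
    rw [div_mul_div_comm, div_le_one (by positivity)]
    calc _ = ((r-ν+1)*(r+ν+1)) * (ch (r+ν) r * ch (r-ν) r) := by ring
      _ ≤ ((r+1)*(r+1)) * 1 := by
        apply mul_le_mul _ i3 (by positivity) (by positivity)
        nlinarith
      _ = _ := by ring

lemma kap_pos (r : ℕ) : 0 < kap (1/3) r := by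
  obtain ⟨i1, i2, i3⟩ := ch_pm (1/3) (by norm_num) (by norm_num) r
  unfold kap; positivity

lemma uc_bound (r : ℕ) : |uc (1/3) r (2*r+1)| ≤ 1/3 / 4^r := by
  obtain ⟨i1, i2, i3⟩ := ch_pm (1/3) (by norm_num) (by norm_num) r
  have h := (D_main (1/3) r).2
  have h4 : (4:ℚ)^(r+1) ≤ 2*(r+1) * ((2*(r+1)).choose (r+1) : ℚ) := by
    have := Nat.four_pow_le_two_mul_self_mul_centralBinom (r+1) (by omega)
    rw [Nat.centralBinom] at this
    exact_mod_cast this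
  have hc : (0:ℚ) < ((2*(r+1)).choose (r+1) : ℕ) := by
    exact_mod_cast Nat.choose_pos (by omega)
  have h' : |uc (1/3) r (2*r+1)| * (((2*(r+1)).choose (r+1) : ℕ):ℚ) = kap (1/3) r := by
    rw [← abs_of_pos hc, ← abs_mul, h, abs_neg, abs_of_pos (kap_pos r)]
  have hk : kap (1/3) r * (r+1) ≤ 2/3 := by
    unfold kap
    have : ((r:ℚ)+1) ≠ 0 := by positivity
    rw [mul_assoc, div_mul_cancel₀ _ this]
    linarith
  rw [le_div_iff₀ (by positivity)]
  rw [pow_succ] at h4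
  have hu : 0 ≤ |uc (1/3) r (2*r+1)| := abs_nonneg _
  have := mul_le_mul_of_nonneg_left h4 hu
  have e : |uc (1/3) r (2*r+1)| * (2 * (↑r + 1) * (((2*(r+1)).choose (r+1) : ℕ):ℚ)) = 2 * (kap (1/3) r * (r+1)) := by
    rw [← h']; ring
  linarith

end SC


namespace SC

lemma dvd_ch (c : ℤ) (j : ℕ) : ((j.factorial : ℕ) : ℤ) ∣ 3^(j/2) * ∏ i ∈ Finset.range j, (c - 3*i) := by
  obtain ⟨v, s, hs, hj⟩ : ∃ v s : ℕ, ¬ 3 ∣ s ∧ j.factorial = 3^v * s :=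
    Nat.exists_eq_pow_mul_and_not_dvd (Nat.factorial_ne_zero j) 3 (by norm_num)
  have hv : v ≤ j/2 := by
    have h1 : padicValNat 3 j.factorial = v := by
      have : Fact (Nat.Prime 3) := ⟨Nat.prime_three⟩
      rw [hj, padicValNat.mul (by positivity) (by rintro rfl; simp at hs), padicValNat.prime_pow,
        padicValNat.eq_zero_of_not_dvd hs, add_zero]
    have h2 : (3-1) * padicValNat 3 j.factorial = j - (Nat.digits 3 j).sum := by
      have : Fact (Nat.Prime 3) := ⟨Nat.prime_three⟩
      exact sub_one_mul_padicValNat_factorial j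
    rw [h1] at h2
    omega
  rw [hj]; push_cast
  apply mul_dvd_mul (pow_dvd_pow _ hv)
  have hcop : IsCoprime (3:ℤ) (s:ℤ) := by
    have : Nat.Coprime 3 s := (Nat.Prime.coprime_iff_not_dvd Nat.prime_three).2 hs
    exact_mod_cast Nat.isCoprime_iff_coprime.2 this
  obtain ⟨e, g, heg⟩ := hcop
  have hes : IsCoprime (s:ℤ) (e^j) := (IsCoprime.pow_left (m := j) ⟨3, g, by linarith⟩ : IsCoprime (e^j) (s:ℤ)).symm
  apply hes.dvd_of_dvd_mul_left
  have hd : ((s:ℕ):ℤ) ∣ ∏ i ∈ Finset.range j, (e*c - i) := by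
    have h1 : ((j.factorial : ℕ) : ℤ) ∣ ∏ i ∈ Finset.range j, (-(e*c) + i) := Nat.factorial_coe_dvd_prod j _
    have h2 : ∏ i ∈ Finset.range j, (e*c - i) = (-1)^j * ∏ i ∈ Finset.range j, (-(e*c) + (i:ℤ)) := by
      rw [← Finset.card_range j, ← Finset.prod_const, Finset.card_range, ← Finset.prod_mul_distrib]
      apply Finset.prod_congr rfl; intros; ring
    rw [h2]
    apply Dvd.dvd.mul_left
    refine dvd_trans ?_ h1
    rw [hj]; push_cast
    exact Dvd.intro_left _ rfl
  have hm : (e^j * ∏ i ∈ Finset.range j, (c - 3*(i:ℤ))) ≡ ∏ i ∈ Finset.range j, (e*c - i) [ZMOD s] := by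
    have h2 : e^j * ∏ i ∈ Finset.range j, (c - 3*(i:ℤ)) = ∏ i ∈ Finset.range j, (e*c - (e*3)*i) := by
      conv_lhs => rw [← Finset.card_range j, ← Finset.prod_const, Finset.card_range, ← Finset.prod_mul_distrib]
      apply Finset.prod_congr rfl; intros; ring
    rw [h2]
    apply Int.ModEq.prod
    intro i _
    apply Int.ModEq.symm
    rw [Int.modEq_iff_dvd]
    refine ⟨g*i, ?_⟩
    linear_combination (-(i:ℤ)) * heg
  exact (Int.ModEq.dvd_iff hm).2 hd

lemma ch_int (c : ℤ) (j : ℕ) : ∃ z : ℤ, (3:ℚ)^(3*j/2) * ch (c/3) j = z := by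
  obtain ⟨z, hz⟩ := dvd_ch c j
  refine ⟨z, ?_⟩
  have h1 : ch (c/3) j * (3^j * (j.factorial:ℚ)) = ∏ i ∈ Finset.range j, ((c:ℚ) - 3*i) := by
    rw [ch, ← Finset.prod_range_add_one_eq_factorial]
    push_cast
    nth_rewrite 2 [← Finset.card_range j]
    rw [← Finset.prod_const, ← Finset.prod_mul_distrib, ← Finset.prod_mul_distrib]
    apply Finset.prod_congr rfl
    intro i _
    have : (i:ℚ)+1 ≠ 0 := by positivity
    field_simp
  have h2 : (3:ℚ)^(j/2) * ∏ i ∈ Finset.range j, ((c:ℚ) - 3*i) = j.factorial * z := by exact_mod_cast hz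
  have hf : (j.factorial:ℚ) ≠ 0 := by positivity
  apply mul_left_cancel₀ hf
  rw [← h2, ← h1, show 3*j/2 = j + j/2 by omega, pow_add]
  ring

noncomputable def w : ℂ := ⟨-1/2, √3/2⟩
lemma w_sq : w^2 + w + 1 = 0 := by
  have h : √3 * √3 = 3 := Real.mul_self_sqrt (by norm_num)
  apply Complex.ext <;> simp [w, pow_two]
  · nlinarith
  · ring
lemma w_conj : (starRingEnd ℂ) w = -1 - w := by
  apply Complex.ext <;> simp [w]
  norm_num

def Eis : Subring ℂ where
  carrier := {z | ∃ a b : ℤ, z = a + b * w}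
  mul_mem' := by
    rintro _ _ ⟨a, b, rfl⟩ ⟨c, d, rfl⟩
    refine ⟨a*c-b*d, a*d+b*c-b*d, ?_⟩
    push_cast
    linear_combination (b:ℂ)*d * w_sq
  one_mem' := ⟨1, 0, by simp⟩
  add_mem' := by
    rintro _ _ ⟨a, b, rfl⟩ ⟨c, d, rfl⟩
    exact ⟨a+c, b+d, by push_cast; ring⟩
  zero_mem' := ⟨0, 0, by simp⟩
  neg_mem' := by
    rintro _ ⟨a, b, rfl⟩
    exact ⟨-a, -b, by push_cast; ring⟩

lemma eis_mem (a b : ℤ) : (a + b * w : ℂ) ∈ Eis := ⟨a, b, rfl⟩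
lemma eis_normSq (a b : ℝ) : ‖(a + b * w : ℂ)‖^2 = a^2 - a*b + b^2 := by
  have h : √3 * √3 = 3 := Real.mul_self_sqrt (by norm_num)
  rw [← Complex.normSq_eq_norm_sq, Complex.normSq_apply]
  simp [w]
  linear_combination b^2/4 * h
lemma eis_norm (z : ℂ) (hz : z ∈ Eis) (h0 : z ≠ 0) : 1 ≤ ‖z‖ := by
  obtain ⟨a, b, rfl⟩ := hz
  have h := eis_normSq a b
  push_cast at h
  have hp : 0 < ‖(a + b * w : ℂ)‖ := norm_pos_iff.2 h0
  have h1 : 0 < ‖(a + b * w : ℂ)‖^2 := by positivity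
  rw [h] at h1
  have h2 : (0:ℤ) < a^2 - a*b+b^2 := by exact_mod_cast h1
  have h3 : (1:ℝ) ≤ a^2 - a*b+b^2 := by exact_mod_cast h2
  rw [← h] at h3
  nlinarith

noncomputable def sg : ℂ := -1 - 2*w
lemma sg_sq : sg^2 = -3 := by unfold sg; linear_combination 4 * w_sq
lemma sg_mem : sg ∈ Eis := ⟨-1, -2, by unfold sg; push_cast; ring⟩
lemma sg_norm : ‖sg‖ = √3 := by
  have h := eis_normSq (-1) (-2)
  have e : ((-1:ℝ) + (-2:ℝ) * w : ℂ) = sg := by unfold sg; push_cast; ring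
  rw [e] at h
  rw [← Real.sqrt_sq (norm_nonneg sg), h]; norm_num

lemma ch_eis (c : ℤ) (j : ℕ) : ((ch (c/3) j : ℚ) : ℂ) * sg^(3*j) ∈ Eis := by
  obtain ⟨z, hz⟩ := ch_int c j
  have h1 : sg^(3*j) = (-1)^(3*j/2) * (((3:ℚ)^(3*j/2) : ℚ) : ℂ) * sg^(3*j%2) := by
    conv_lhs => rw [← Nat.div_add_mod (3*j) 2, pow_add, pow_mul, sg_sq]
    push_cast
    rw [← mul_pow]; norm_num
  have h2 : ((ch (c/3) j : ℚ) : ℂ) * sg^(3*j) = (-1)^(3*j/2) * (((3:ℚ)^(3*j/2) * ch (c/3) j : ℚ) : ℂ) * sg^(3*j%2) := by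
    rw [h1]; push_cast; ring
  rw [h2, hz]
  apply Subring.mul_mem _ (Subring.mul_mem _ (Subring.pow_mem _ (Subring.neg_mem _ (Subring.one_mem _)) _) _) (Subring.pow_mem _ sg_mem _)
  simp

lemma Qp_aeval (ν : ℚ) (r : ℕ) (x : ℂ) : aeval x (Qp ν r) = ∑ j ∈ Finset.range (r+1), ((ac ν r j : ℚ):ℂ) * x^j := by
  simp [Qp]

lemma Qp_mul (ν : ℚ) (r : ℕ) (β : ℂ) (h0 : β ≠ 0) :
    β^r * aeval (sg^3/β) (Qp ν r) = ∑ j ∈ Finset.range (r+1), ((ac ν r j : ℚ):ℂ) * sg^(3*j) * β^(r-j) := by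
  rw [Qp_aeval, Finset.mul_sum]
  apply Finset.sum_congr rfl
  intro j hj
  have hj' : j ≤ r := by simpa [Nat.lt_succ_iff] using hj
  conv_lhs => rw [← Nat.sub_add_cancel hj', pow_add]
  rw [div_pow, ← pow_mul]
  have : β^j ≠ 0 := pow_ne_zero _ h0
  rw [Nat.sub_add_cancel hj']
  field_simp

lemma Qp_eis (ν : ℚ) (hν : ∃ e : ℤ, ν = e/3) (r : ℕ) (β : ℂ) (h0 : β ≠ 0) (hβ : β ∈ Eis) :
    β^r * aeval (sg^3/β) (Qp ν r) ∈ Eis := by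
  rw [Qp_mul ν r β h0]
  apply Subring.sum_mem
  intro j hj
  obtain ⟨e, rfl⟩ := hν
  apply Subring.mul_mem _ _ (Subring.pow_mem _ hβ _)
  unfold ac
  split_ifs
  · have h := ch_eis (3*r - e) j
    rw [show (((3*r-e : ℤ):ℚ)/3) = r - (e:ℚ)/3 by push_cast; ring] at h
    push_cast at h ⊢
    rw [mul_assoc]
    apply Subring.mul_mem _ _ h
    apply Subring.mul_mem _ (Subring.pow_mem _ (Subring.neg_mem _ (Subring.one_mem _)) _)
    simp
  · simp
end SC


namespace SC

lemma rchoose_eq (x : ℚ) (k : ℕ) : Ring.choose ((x:ℚ):ℂ) k = ((ch x k : ℚ):ℂ) := by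
  rw [Ring.choose_eq_smul]
  induction k with
  | zero => simp [ch_zero]
  | succ k ih =>
    have h := ch_succ x k
    have h' : ((k:ℂ)+1) * ((ch x (k+1) : ℚ):ℂ) = ((ch x k : ℚ):ℂ) * (x - k) := by exact_mod_cast congrArg (fun q : ℚ => (q:ℂ)) h
    have hk : ((k:ℂ)+1) ≠ 0 := by exact_mod_cast Nat.succ_ne_zero k
    apply mul_left_cancel₀ hk
    rw [h', ← ih]
    have hf : (k.factorial:ℂ) ≠ 0 := by exact_mod_cast Nat.factorial_ne_zero k
    simp only [descPochhammer_succ_right, smeval_mul, smeval_sub, smeval_X, smeval_natCast, Nat.factorial_succ, smul_eq_mul]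
    push_cast
    field_simp
    simp

lemma bin_hasSum (τ : ℂ) (hτ : ‖τ‖ < 1) :
    HasSum (fun k => ((bc (1/3) k : ℚ):ℂ) * τ^k) ((1-τ)^(((1/3:ℚ):ℚ):ℂ)) := by
  have h := (Complex.one_add_cpow_hasFPowerSeriesOnBall_zero (a := (((1/3:ℚ):ℚ):ℂ))).hasSum (y := -τ) (by
    rw [← ENNReal.ofReal_one, Metric.eball_ofReal]; simpa using hτ)
  simp only [binomialSeries_apply, rchoose_eq, zero_add, smul_eq_mul] at h
  rw [← sub_eq_add_neg] at h
  refine h.congr_fun ?_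
  intro k
  simp only [bc, List.ofFn_const, List.prod_replicate]
  push_cast
  rw [neg_pow τ]; ring

lemma bc_le (k : ℕ) : |bc (1/3) k| ≤ 1 := by
  induction k with
  | zero => simp [bc, ch_zero]
  | succ k ih =>
    have h := bc_succ (1/3) k
    have h2 : ((k:ℚ)+1) * |bc (1/3) (k+1)| = |(k:ℚ) - 1/3| * |bc (1/3) k| := by
      rw [← abs_mul, ← h, abs_mul, abs_of_nonneg (by positivity : (0:ℚ) ≤ k+1)]
    have h3 : |(k:ℚ) - 1/3| ≤ k+1 := by
      have : (0:ℚ) ≤ k := by positivity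
      rw [abs_le]; constructor <;> linarith
    have hk : (0:ℚ) < k+1 := by positivity
    have h4 : |(k:ℚ) - 1/3| * |bc (1/3) k| ≤ (k+1)*1 := mul_le_mul h3 ih (abs_nonneg _) hk.le
    rw [← h2] at h4
    exact le_of_mul_le_mul_left h4 hk

lemma norm_ratC (q : ℚ) : ‖(q:ℂ)‖ = ((|q| : ℚ):ℝ) := by
  rw [Complex.norm_ratCast]; push_cast; rfl

lemma bc_norm_le (k : ℕ) : ‖((bc (1/3) k : ℚ):ℂ)‖ ≤ 1 := by
  rw [norm_ratC]; exact_mod_cast bc_le k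

lemma bin_near (τ : ℂ) (hτ : ‖τ‖ < 1) :
    ‖(1-τ)^(((1/3:ℚ):ℚ):ℂ) - 1‖ ≤ ‖τ‖ / (1-‖τ‖) := by
  have h := bin_hasSum τ hτ
  have h1 := (hasSum_nat_add_iff' 1).2 h
  simp only [Finset.range_one, Finset.sum_singleton, pow_zero, mul_one] at h1
  rw [show ((bc (1/3) 0 : ℚ):ℂ) = 1 by simp [bc, ch_zero]] at h1
  have h2 : HasSum (fun k => ‖τ‖ * ‖τ‖^k) (‖τ‖ * (1-‖τ‖)⁻¹) :=
    (hasSum_geometric_of_lt_one (norm_nonneg _) hτ).mul_left _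
  rw [← h1.tsum_eq, div_eq_mul_inv]
  apply tsum_of_norm_bounded h2
  intro k
  rw [norm_mul, norm_pow, pow_succ']
  calc _ ≤ 1 * (‖τ‖ * ‖τ‖^k) := mul_le_mul_of_nonneg_right (bc_norm_le _) (by positivity)
    _ = _ := one_mul _

lemma Qp_tsum (ν : ℚ) (r : ℕ) (x : ℂ) : HasSum (fun j => ((ac ν r j : ℚ):ℂ) * x^j) (aeval x (Qp ν r)) := by
  rw [Qp_aeval]
  apply hasSum_sum_of_ne_finset_zero
  intro j hj
  have : ¬ j ≤ r := by simpa [Nat.lt_succ_iff] using hj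
  simp [ac, this]

lemma rem_bound (r : ℕ) (τ : ℂ) (hτ : ‖τ‖ < 1) :
    ‖aeval τ (Qp (1/3) r) * (1-τ)^(((1/3:ℚ):ℚ):ℂ) - aeval τ (Qp (-(1/3)) r)‖ ≤
      1/3/4^r * ‖τ‖^(2*r+1) / (1-‖τ‖)^(r+1) := by
  have ha := Qp_tsum (1/3) r τ
  have hb := bin_hasSum τ hτ
  have hsa : Summable (fun j => ‖((ac (1/3) r j : ℚ):ℂ) * τ^j‖) := by
    apply summable_of_ne_finset_zero (s := Finset.range (r+1))
    intro j hj
    have : ¬ j ≤ r := by simpa [Nat.lt_succ_iff] using hj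
    simp [ac, this]
  have hsb : Summable (fun k => ‖((bc (1/3) k : ℚ):ℂ) * τ^k‖) := by
    apply Summable.of_nonneg_of_le (fun _ => norm_nonneg _) _ (summable_geometric_of_lt_one (norm_nonneg _) hτ)
    intro k
    rw [norm_mul, norm_pow]
    calc _ ≤ 1 * ‖τ‖^k := mul_le_mul_of_nonneg_right (bc_norm_le _) (by positivity)
      _ = _ := one_mul _
  have hprod := tsum_mul_tsum_eq_tsum_sum_antidiagonal_of_summable_norm hsa hsb
  have hps := (summable_norm_sum_mul_antidiagonal_of_summable_norm hsa hsb).of_norm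
  have hu : ∀ k, (∑ kl ∈ Finset.HasAntidiagonal.antidiagonal k, (((ac (1/3) r kl.1 : ℚ):ℂ) * τ^kl.1) * (((bc (1/3) kl.2 : ℚ):ℂ) * τ^kl.2)) =
      ((uc (1/3) r k : ℚ):ℂ) * τ^k := by
    intro k
    rw [uc]; push_cast; rw [Finset.sum_mul]
    apply Finset.sum_congr rfl
    rintro ⟨i, j⟩ hij
    have : i + j = k := by simpa using hij
    subst this
    simp only [pow_add]; ring
  simp only [hu] at hprod hps
  rw [ha.tsum_eq, hb.tsum_eq] at hprod
  have hsplit := hps.sum_add_tsum_nat_add (2*r+1)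
  have hfirst : ∑ k ∈ Finset.range (2*r+1), ((uc (1/3) r k : ℚ):ℂ) * τ^k = aeval τ (Qp (-(1/3)) r) := by
    rw [Qp_aeval]
    symm
    have hsub : Finset.range (r+1) ⊆ Finset.range (2*r+1) := by
      intro x hx; simp at hx ⊢; omega
    rw [← Finset.sum_subset hsub (f := fun k => ((uc (1/3) r k : ℚ):ℂ) * τ^k)]
    · apply Finset.sum_congr rfl
      intro k hk
      rw [uc_le _ _ _ (by simpa [Nat.lt_succ_iff] using hk)]
    · intro k hk hk2
      simp at hk hk2
      rw [uc_mid _ _ _ (by omega) (by omega)]; simp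
  rw [hprod, ← hsplit, hfirst, add_sub_cancel_left]
  have hg := (hasSum_choose_mul_geometric_of_norm_lt_one r (r := ‖τ‖) (by simpa using hτ)).mul_left (1/3/4^r * ‖τ‖^(2*r+1))
  rw [mul_one_div] at hg
  apply tsum_of_norm_bounded hg
  intro j
  rw [norm_mul, norm_pow, norm_ratC, add_comm j (2*r+1), pow_add]
  have h1 := uc_tail (1/3) (by norm_num) (by norm_num) r j
  have h2 := uc_bound r
  have h3 : |uc (1/3) r (2*r+1+j)| ≤ 1/3/4^r * ((r+j).choose j : ℚ) :=
    h1.trans (mul_le_mul_of_nonneg_right h2 (by positivity))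
  have h4 : ((|uc (1/3) r (2*r+1+j)| : ℚ) : ℝ) ≤ 1/3/4^r * ((r+j).choose j : ℝ) := by
    have := (Rat.cast_le (K := ℝ)).2 h3
    push_cast at this ⊢
    exact this
  have h5 : (j+r).choose r = (r+j).choose j := by rw [add_comm j r, Nat.choose_symm_add]
  rw [h5]
  calc _ ≤ (1/3/4^r * ((r+j).choose j : ℝ)) * (‖τ‖^(2*r+1) * ‖τ‖^j) := mul_le_mul_of_nonneg_right h4 (by positivity)
    _ = _ := by ring

lemma ac_bound (r j : ℕ) (hj : j ≤ r) : |ac (1/3) r j| ≤ 2^(2*r-j) * (r.choose j : ℚ) := by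
  have hch : ∀ i, i ≤ r → 0 ≤ ch ((r:ℚ)-1/3) i ∧ ch ((r:ℚ)-1/3) i ≤ (r.choose i : ℚ) := by
    intro i
    induction i with
    | zero => simp [ch_zero]
    | succ i ih =>
      intro hi
      obtain ⟨i1, i2⟩ := ih (by omega)
      have h := ch_succ ((r:ℚ)-1/3) i
      have hc : ((r.choose (i+1) : ℕ):ℚ) * (i+1) = (r.choose i : ℕ) * (r - i) := by
        have := Nat.choose_succ_right_eq r i
        have h2 : ((r.choose (i+1) * (i+1) : ℕ):ℚ) = ((r.choose i * (r-i) : ℕ):ℚ) := by rw [this]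
        push_cast [Nat.cast_sub (by omega : i ≤ r)] at h2
        linarith
      have hi' : (i:ℚ)+1 ≤ r := by exact_mod_cast hi
      have hp : (0:ℚ) < i+1 := by positivity
      constructor
      · have : 0 ≤ ((i:ℚ)+1) * ch ((r:ℚ)-1/3) (i+1) := by
          rw [h]; exact mul_nonneg i1 (by linarith)
        exact nonneg_of_mul_nonneg_right this hp
      · apply le_of_mul_le_mul_left _ hp
        rw [h, mul_comm _ ((r.choose (i+1) : ℕ):ℚ), hc]
        apply mul_le_mul i2 (by linarith) (by linarith) (by positivity)
  obtain ⟨h1, h2⟩ := hch j hj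
  rw [ac, if_pos hj, abs_mul, abs_mul, abs_pow, abs_neg, abs_one, one_pow, one_mul, Nat.abs_cast, abs_of_nonneg h1]
  apply mul_le_mul _ h2 h1 (by positivity)
  exact_mod_cast Nat.choose_le_two_pow _ _

lemma sqrt3_cube : ‖sg‖^3 ≤ 5.2 := by
  rw [sg_norm]
  have h : √3 * √3 = 3 := Real.mul_self_sqrt (by norm_num)
  have h2 : √3 ≤ 1.733 := by rw [Real.sqrt_le_left (by norm_num)]; norm_num
  nlinarith

lemma Q_bound (r : ℕ) (β : ℂ) (h0 : β ≠ 0) :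
    ‖β^r * aeval (sg^3/β) (Qp (1/3) r)‖ ≤ (4*(‖β‖+2.6))^r := by
  rw [Qp_mul _ _ _ h0, mul_pow, add_comm ‖β‖, add_pow, Finset.mul_sum]
  refine (norm_sum_le _ _).trans (Finset.sum_le_sum ?_)
  intro j hj
  have hj' : j ≤ r := by simpa [Nat.lt_succ_iff] using hj
  rw [norm_mul, norm_mul, norm_pow, norm_pow, norm_ratC, pow_mul]
  have h1 : ((|ac (1/3) r j| : ℚ):ℝ) ≤ 2^(2*r-j) * (r.choose j : ℝ) := by exact_mod_cast ac_bound r j hj'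
  calc _ ≤ (2^(2*r-j) * (r.choose j : ℝ)) * 5.2^j * ‖β‖^(r-j) := by
        apply mul_le_mul_of_nonneg_right _ (by positivity)
        apply mul_le_mul h1 _ (by positivity) (by positivity)
        exact pow_le_pow_left₀ (by positivity) sqrt3_cube j
    _ = _ := by
        have : (4:ℝ)^r = 2^(2*r-j) * 2^j := by
          rw [← pow_add, Nat.sub_add_cancel (by omega), pow_mul]; norm_num
        rw [this, show (5.2:ℝ) = 2*2.6 by norm_num, mul_pow]; ring
end SC


namespace SC

lemma unit_close (x α : ℂ) (hx : ‖x‖ = 1) (hα : ‖α‖ = 1) (hx1 : ‖x-1‖ ≤ 1/50) (hα1 : ‖α-1‖ ≤ 1/50) :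
    ‖x - α‖ ≤ ‖x^3-α^3‖/2 := by
  have h1 : x^3-α^3 = (x-α)*(x^2+x*α+α^2) := by ring
  have h2 : (2:ℝ) ≤ ‖x^2+x*α+α^2‖ := by
    have e : x^2+x*α+α^2 = 3 - (-((x-1)*(x+1) + (x-1)*α + (α-1) + (α-1)*(α+1))) := by ring
    have a1 : ‖x+1‖ ≤ 2 := (norm_add_le _ _).trans (by rw [hx]; norm_num)
    have a2 : ‖α+1‖ ≤ 2 := (norm_add_le _ _).trans (by rw [hα]; norm_num)
    have a3 : ‖-((x-1)*(x+1) + (x-1)*α + (α-1) + (α-1)*(α+1))‖ ≤ 1/50*2+1/50*1+1/50+1/50*2 := by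
      rw [norm_neg]
      refine (norm_add_le _ _).trans (add_le_add ((norm_add_le _ _).trans (add_le_add ((norm_add_le _ _).trans (add_le_add ?_ ?_)) hα1)) ?_)
      · rw [norm_mul]; exact mul_le_mul hx1 a1 (norm_nonneg _) (by norm_num)
      · rw [norm_mul, hα]; exact mul_le_mul_of_nonneg_right hx1 (by norm_num)
      · rw [norm_mul]; exact mul_le_mul hα1 a2 (norm_nonneg _) (by norm_num)
    have a4 := norm_sub_norm_le (3:ℂ) (-((x-1)*(x+1) + (x-1)*α + (α-1) + (α-1)*(α+1)))
    rw [e]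
    have : ‖(3:ℂ)‖ = 3 := by simp
    rw [this] at a4
    linarith
  rw [h1, norm_mul]
  nlinarith [norm_nonneg (x-α)]

/-- choice of r -/
lemma choose_r (b g : ℝ) (hb : 1000 ≤ b) (hg : b^10 ≤ 9*10^7*g) :
    ∃ r : ℕ, 3.4667 * g < (b-5.2) * ((b-5.2)/6.76)^r ∧ 5.2*b*(4*(b+2.6))^(r+1) < g^2 := by
  set c := b - 5.2 with hc
  have hc1 : 0.9948*b ≤ c := by rw [hc]; linarith
  have hb0 : 0 < b := by linarith
  have hc0 : 0 < c := by linarith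
  set lam := c/6.76 with hlam
  have hlam1 : 1 < lam := by rw [hlam, lt_div_iff₀ (by norm_num)]; linarith
  have hg0 : 0 < g := by
    have : 0 < b^10 := by positivity
    linarith
  have hex : ∃ r : ℕ, 3.4667 * g < c * lam^r := by
    obtain ⟨r, hr⟩ := pow_unbounded_of_one_lt (3.4667*g/c) hlam1
    refine ⟨r, ?_⟩
    rw [div_lt_iff₀ hc0] at hr; linarith
  classical
  obtain ⟨r, hr, hmin⟩ : ∃ r : ℕ, 3.4667 * g < c * lam^r ∧ ∀ s < r, ¬ 3.4667 * g < c * lam^s :=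
    ⟨Nat.find hex, Nat.find_spec hex, fun s hs => Nat.find_min hex hs⟩
  refine ⟨r, hr, ?_⟩
  have h9 : ∀ s : ℕ, s ≤ 9 → ¬ 3.4667 * g < c * lam^s := by
    intro s hs
    rw [not_lt]
    have e1 : lam^s ≤ lam^9 := pow_le_pow_right₀ hlam1.le hs
    have e2 : c * lam^9 ≤ b * (b/6.76)^9 := by
      have : lam ≤ b/6.76 := by rw [hlam]; gcongr; linarith
      apply mul_le_mul (by linarith) (pow_le_pow_left₀ (by linarith) this 9) (by positivity) (by linarith)
    have e3 : b * (b/6.76)^9 = b^10 / 6.76^9 := by rw [div_pow]; ring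
    have e4 : b^10/6.76^9 ≤ 3.4667*g := by
      rw [div_le_iff₀ (by norm_num)]
      norm_num at hg ⊢; linarith
    calc c * lam^s ≤ c * lam^9 := mul_le_mul_of_nonneg_left e1 hc0.le
      _ ≤ _ := by rw [e3] at e2; linarith
  have hr10 : 10 ≤ r := by
    by_contra h
    exact h9 r (by omega) hr
  obtain ⟨k, rfl⟩ : ∃ k, r = k + 10 := ⟨r - 10, by omega⟩
  have hm := hmin (k+9) (by omega)
  rw [not_lt] at hm
  set E := 4*(b+2.6) with hE
  have hE1 : E ≤ 4.0104*b := by rw [hE]; linarith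
  have hE0 : 0 < E := by rw [hE]; linarith
  clear_value E
  have hk1 : (b/186) * E ≤ lam^2 := by
    have : (0.9948*b)^2 ≤ c^2 := pow_le_pow_left₀ (by linarith) hc1 2
    have h2 : lam^2 = c^2/45.6976 := by rw [hlam, div_pow]; norm_num
    rw [h2]
    have h3 : (b/186)*E ≤ (b/186)*(4.0104*b) := mul_le_mul_of_nonneg_left hE1 (by positivity)
    have h4 : 0 < b^2 := by positivity
    norm_num at h3 this ⊢
    linarith
  have hk2 : 5.37 * E ≤ lam^2 := by
    refine le_trans ?_ hk1
    apply mul_le_mul_of_nonneg_right _ hE0.le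
    norm_num; linarith
  have hpow : (5.37^(k+8) * ((b/186))) * E^(k+9) ≤ (lam^(k+9))^2 := by
    have h1 : (5.37*E)^(k+8) ≤ (lam^2)^(k+8) := pow_le_pow_left₀ (by positivity) hk2 _
    have h2 := mul_le_mul h1 hk1 (by positivity) (by positivity)
    calc _ = (5.37*E)^(k+8) * ((b/186)*E) := by rw [mul_pow, pow_succ E (k+8)]; ring
      _ ≤ (lam^2)^(k+8) * lam^2 := h2
      _ = _ := by ring
  have hpow2 : (5.37^8 * ((b/186))) * E^(k+9) ≤ (lam^(k+9))^2 := by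
    refine le_trans ?_ hpow
    apply mul_le_mul_of_nonneg_right _ (by positivity)
    apply mul_le_mul_of_nonneg_right _ (by positivity)
    exact pow_le_pow_right₀ (by norm_num) (by omega)
  have hsq : (c * lam^(k+9))^2 ≤ (3.4667*g)^2 := pow_le_pow_left₀ (by positivity) hm 2
  have hsq2 : c^2 * ((5.37^8 * ((b/186))) * E^(k+9)) ≤ (3.4667*g)^2 := by
    refine le_trans (mul_le_mul_of_nonneg_left hpow2 (by positivity)) ?_
    rw [← mul_pow]; exact hsq
  have hc2 : (0.9948*b)^2 ≤ c^2 := pow_le_pow_left₀ (by linarith) hc1 2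
  have hE2 : E^2 ≤ (4.0104*b)^2 := pow_le_pow_left₀ hE0.le hE1 2
  set Y := E^(k+9) with hY
  have hY0 : 0 < Y := by positivity
  have e1 : E^(k+10+1) = Y * E^2 := by rw [hY]; ring
  rw [e1]
  have hbY : 0 < b * Y := by positivity
  have f1 : 5.2*b*(Y*E^2) ≤ 5.2*b*(Y*(4.0104*b)^2) := by gcongr
  have f2 : (0.9948*b)^2 * ((5.37^8 * ((b/186))) * Y) ≤ (3.4667*g)^2 := by
    refine le_trans ?_ hsq2
    apply mul_le_mul_of_nonneg_right hc2 (by positivity)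
  have hb3 : 0 < b^3*Y := by positivity
  have f3 : 5.2*b*(Y*(4.0104*b)^2) = 5.2*4.0104^2*(b^3*Y) := by ring
  have f4 : (0.9948*b)^2 * ((5.37^8 * ((b/186))) * Y) = (0.9948^2*5.37^8/186) * (b^3*Y) := by ring
  have f5 : (3.4667*g)^2 = 3.4667^2*g^2 := by ring
  rw [f3] at f1; rw [f4, f5] at f2
  norm_num at f1 f2 ⊢
  linarith

theorem hyp (m p q F : ℤ) (hm : 1000 ≤ m) (hq : 0 < q) (hp : 100*q ≤ p)
    (hF : F = p^3 - m*p^2*q - (m+3)*p*q^2 - q^3) (hFN : |F| ≤ m^2+3*m+9)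
    (hbig : (m^2+3*m+9)^5 ≤ 90000000*p) : False := by
  set β : ℂ := ((m+3:ℤ):ℂ) + ((3:ℤ):ℂ)*w with hβ
  set γ : ℂ := ((p:ℤ):ℂ) + ((-q:ℤ):ℂ)*w with hγ
  set βb : ℂ := (m:ℂ) - 3*w with hβb
  set γb : ℂ := ((p+q:ℤ):ℂ) + ((q:ℤ):ℂ)*w with hγb
  have hβE : β ∈ Eis := eis_mem _ _
  have hγE : γ ∈ Eis := eis_mem _ _
  have hγbE : γb ∈ Eis := eis_mem _ _
  have cβ : (starRingEnd ℂ) β = βb := by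
    have : (starRingEnd ℂ) (3:ℂ) = 3 := Complex.conj_ofNat 3
    simp [hβ, hβb, w_conj, this]; ring
  have cγ : (starRingEnd ℂ) γ = γb := by simp [hγ, hγb, w_conj]; ring
  have nβ : ‖βb‖ = ‖β‖ := by rw [← cβ, RCLike.norm_conj]
  have nγ : ‖γb‖ = ‖γ‖ := by rw [← cγ, RCLike.norm_conj]
  have hb2 : ‖β‖^2 = (m:ℝ)^2+3*m+9 := by
    have := eis_normSq (m+3) 3
    rw [hβ]; push_cast at this ⊢; rw [this]; ring
  have hg2 : ‖γ‖^2 = (p:ℝ)^2+p*q+q^2 := by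
    have := eis_normSq p (-q)
    rw [hγ]; push_cast at this ⊢; rw [this]; ring
  have hmR : (1000:ℝ) ≤ m := by exact_mod_cast hm
  have hqR : (0:ℝ) < q := by exact_mod_cast hq
  have hpR : (100:ℝ)*q ≤ p := by exact_mod_cast hp
  have hb : 1000 ≤ ‖β‖ := by
    apply le_of_sq_le_sq _ (norm_nonneg _)
    rw [hb2]; nlinarith
  have hgp : (p:ℝ) ≤ ‖γ‖ := by
    apply le_of_sq_le_sq _ (norm_nonneg _)
    rw [hg2]; nlinarith
  have hg0 : 0 < ‖γ‖ := by linarith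
  have hβ0 : β ≠ 0 := by rw [← norm_pos_iff]; linarith
  have hγ0 : γ ≠ 0 := by rw [← norm_pos_iff]; linarith
  have hγb0 : γb ≠ 0 := by rw [← norm_pos_iff]; linarith
  have hβb0 : βb ≠ 0 := by rw [← norm_pos_iff]; linarith
  have hbig' : ‖β‖^10 ≤ 9*10^7*‖γ‖ := by
    have h1 : (((m:ℝ)^2+3*m+9)^5) ≤ 90000000*p := by exact_mod_cast hbig
    rw [show ‖β‖^10 = (‖β‖^2)^5 by ring, hb2]
    linarith
  obtain ⟨r, hr1, hr2⟩ := choose_r ‖β‖ ‖γ‖ hb hbig'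
  set τ : ℂ := sg^3/β with hτ
  have hτn : ‖τ‖ ≤ 5.2/‖β‖ := by
    rw [hτ, norm_div, norm_pow]
    exact div_le_div_of_nonneg_right sqrt3_cube (by linarith)
  have hτ52 : (5.2:ℝ)/‖β‖ ≤ 0.0052 := by
    rw [div_le_iff₀ (by linarith)]; linarith
  have hτ1 : ‖τ‖ < 1 := by linarith
  have h1τ : 1 - τ = βb/β := by
    rw [hτ, eq_div_iff hβ0, sub_mul, div_mul_cancel₀ _ hβ0, pow_succ, sg_sq, hβ, hβb, sg]
    push_cast; ring
  set α : ℂ := (1-τ)^(((1/3:ℚ):ℚ):ℂ) with hα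
  have hα3 : α^3 = βb/β := by
    rw [hα, ← h1τ]
    have := Complex.cpow_nat_inv_pow (1-τ) (n := 3) (by norm_num)
    have e : (((1/3:ℚ):ℚ):ℂ) = ((3:ℕ):ℂ)⁻¹ := by push_cast; norm_num
    rw [e]; exact this
  have hαn : ‖α‖ = 1 := by
    have : ‖α‖^3 = 1 := by
      rw [← norm_pow, hα3, norm_div, nβ, div_self (by linarith)]
    exact (pow_eq_one_iff_of_nonneg (norm_nonneg _) (by norm_num)).1 this
  have hα1 : ‖α - 1‖ ≤ 1/50 := by
    refine (bin_near τ hτ1).trans ?_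
    rw [div_le_iff₀ (by linarith)]
    linarith
  set x : ℂ := γ/γb with hx
  have hxn : ‖x‖ = 1 := by rw [hx, norm_div, nγ, div_self hg0.ne']
  have hx1 : ‖x - 1‖ ≤ 1/50 := by
    have e : x - 1 = q * sg / γb := by
      rw [hx, div_sub_one hγb0, hγ, hγb, sg]; push_cast; congr 1; ring
    rw [e, norm_div, norm_mul, sg_norm, nγ, div_le_iff₀ hg0]
    have h2 : √3 ≤ 2 := by rw [Real.sqrt_le_left (by norm_num)]; norm_num
    have h3 : ‖(q:ℂ)‖ = q := by rw [Complex.norm_intCast, abs_of_pos hqR]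
    rw [h3]
    nlinarith
  have hxα := unit_close x α hxn hαn hx1 hα1
  have hx3 : x^3 - α^3 = -3*F*sg/(β*γb^3) := by
    rw [hα3, hx, div_pow, div_sub_div _ _ (pow_ne_zero 3 hγb0) hβ0, div_eq_div_iff (mul_ne_zero (pow_ne_zero 3 hγb0) hβ0) (mul_ne_zero hβ0 (pow_ne_zero 3 hγb0))]
    have key : γ^3*β - γb^3*βb = -3*F*sg := by
      rw [hγ, hβ, hγb, hβb, hF, sg]; push_cast
      linear_combination ((18*(p:ℂ)*q^2+(6-2*m)*q^3)*w + ((-9*(p:ℂ)^2*q+3*(m+3)*p*q^2-3*m*(p+q)*q^2+9*(p+q)^2*q)-(18*(p:ℂ)*q^2+(6-2*m)*q^3))) * w_sq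
    linear_combination β * γb^3 * key
  have hFR : |(F:ℝ)| ≤ ‖β‖^2 := by rw [hb2]; exact_mod_cast hFN
  have hxα2 : ‖x - α‖ ≤ 2.6*‖β‖/‖γ‖^3 := by
    refine hxα.trans ?_
    rw [hx3, norm_div, norm_mul, norm_mul, norm_mul, norm_pow, nγ, norm_neg, Complex.norm_intCast]
    have e3 : ‖(3:ℂ)‖ = ‖sg‖^2 := by rw [← norm_pow, sg_sq, norm_neg]
    rw [e3, div_div, div_le_div_iff₀ (by positivity) (by positivity)]
    have h1 := mul_le_mul sqrt3_cube hFR (abs_nonneg _) (by norm_num)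
    have h2 := mul_le_mul_of_nonneg_right h1 (by positivity : 0 ≤ ‖γ‖^3)
    linarith
  -- the two linear forms vanish
  have main : ∀ s : ℕ, s ≤ r + 1 → r ≤ s → aeval τ (Qp (1/3) s) * γ = aeval τ (Qp (-(1/3)) s) * γb := by
    intro s hs hs'
    by_contra hne
    set Q := aeval τ (Qp (1/3) s) with hQ
    set P := aeval τ (Qp (-(1/3)) s) with hP
    have hQE : β^s * Q ∈ Eis := Qp_eis (1/3) ⟨1, by norm_num⟩ s β hβ0 hβE
    have hPE : β^s * P ∈ Eis := Qp_eis (-(1/3)) ⟨-1, by norm_num⟩ s β hβ0 hβE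
    have hlE : (β^s*Q)*γ - (β^s*P)*γb ∈ Eis := Subring.sub_mem _ (Subring.mul_mem _ hQE hγE) (Subring.mul_mem _ hPE hγbE)
    have hl0 : (β^s*Q)*γ - (β^s*P)*γb ≠ 0 := by
      have : (β^s*Q)*γ - (β^s*P)*γb = β^s*(Q*γ-P*γb) := by ring
      rw [this]
      exact mul_ne_zero (pow_ne_zero _ hβ0) (sub_ne_zero.2 hne)
    have hl1 := eis_norm _ hlE hl0
    have e : (β^s*Q)*γ - (β^s*P)*γb = γb * ((β^s*Q) * (x-α) + β^s * (Q*α-P)) := by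
      rw [hx]; field_simp; ring
    have hQn : ‖β^s*Q‖ ≤ (4*(‖β‖+2.6))^s := Q_bound s β hβ0
    have hR := rem_bound s τ hτ1
    set c := ‖β‖ - 5.2 with hc
    have hc0 : 0 < c := by rw [hc]; linarith
    have hR2 : ‖β^s * (Q*α-P)‖ ≤ 1/3 * (6.76/c)^s * (5.2/c) := by
      have hR3 : ‖Q*α-P‖ ≤ 1/3/4^s * (5.2/‖β‖)^(2*s+1) / (1-5.2/‖β‖)^(s+1) := by
        refine hR.trans ?_
        have : 0 < 1 - 5.2/‖β‖ := by linarith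
        gcongr
      rw [norm_mul, norm_pow]
      refine (mul_le_mul_of_nonneg_left hR3 (by positivity)).trans (le_of_eq ?_)
      have hb0 : ‖β‖ ≠ 0 := by linarith
      have h1 : 1 - 5.2/‖β‖ = c/‖β‖ := by rw [hc]; field_simp
      rw [h1, div_pow, div_pow, div_pow, show (6.76:ℝ) = 5.2^2/4 by norm_num, div_pow, ← pow_mul]
      field_simp
      ring
    have hlam : 1 ≤ c/6.76 := by rw [le_div_iff₀ (by norm_num), hc]; linarith
    have t2 : ‖γ‖ * (1/3 * (6.76/c)^s * (5.2/c)) < 1/2 := by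
      have h1 : (c/6.76)^r ≤ (c/6.76)^s := pow_le_pow_right₀ hlam hs'
      have h2 : 3.4667 * ‖γ‖ < c * (c/6.76)^s := lt_of_lt_of_le hr1 (mul_le_mul_of_nonneg_left h1 hc0.le)
      have h3 : (6.76/c)^s = 1/(c/6.76)^s := by rw [← one_div_pow, one_div_div]
      rw [h3]
      have h4 : 0 < c * (c/6.76)^s := by positivity
      have h5 : ‖γ‖ * (1/3 * (1/(c/6.76)^s) * (5.2/c)) = (5.2/3*‖γ‖) / (c * (c/6.76)^s) := by
        field_simp
      rw [h5, div_lt_iff₀ h4]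
      linarith
    have t1 : ‖γ‖ * ((4*(‖β‖+2.6))^s * (2.6*‖β‖/‖γ‖^3)) < 1/2 := by
      have h1 : (4*(‖β‖+2.6))^s ≤ (4*(‖β‖+2.6))^(r+1) := pow_le_pow_right₀ (by linarith) hs
      have h5 : ‖γ‖ * ((4*(‖β‖+2.6))^s * (2.6*‖β‖/‖γ‖^3)) = (2.6*‖β‖*(4*(‖β‖+2.6))^s)/‖γ‖^2 := by
        field_simp
      rw [h5, div_lt_iff₀ (by positivity)]
      have := mul_le_mul_of_nonneg_left h1 (by linarith : 0 ≤ 5.2*‖β‖)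
      linarith
    rw [e, norm_mul, nγ] at hl1
    have h6 : ‖(β^s*Q) * (x-α) + β^s * (Q*α-P)‖ ≤ (4*(‖β‖+2.6))^s * (2.6*‖β‖/‖γ‖^3) + 1/3 * (6.76/c)^s * (5.2/c) := by
      refine (norm_add_le _ _).trans (add_le_add ?_ hR2)
      rw [norm_mul]
      exact mul_le_mul hQn hxα2 (norm_nonneg _) (by positivity)
    have h7 := mul_le_mul_of_nonneg_left h6 hg0.le
    rw [mul_add] at h7
    linarith
  have m1 := main r (by omega) le_rfl
  have m2 := main (r+1) le_rfl (by omega)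
  have hD := congrArg (aeval τ) (D_main (1/3) r).1
  simp only [map_sub, map_mul, map_pow, aeval_C, aeval_X] at hD
  have hτ0 : τ ≠ 0 := by
    rw [hτ]
    apply div_ne_zero _ hβ0
    apply pow_ne_zero
    intro h
    have := sg_sq
    rw [h] at this; norm_num at this
  have hk : (algebraMap ℚ ℂ) (kap (1/3) r) * τ^(2*r+1) ≠ 0 := by
    apply mul_ne_zero _ (pow_ne_zero _ hτ0)
    simpa using (kap_pos r).ne'
  apply hk
  rw [← hD]
  apply (mul_eq_zero.1 (?_ : _ * γb = 0)).resolve_right hγb0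
  linear_combination aeval τ (Qp (1/3) r) * m2 - aeval τ (Qp (1/3) (r+1)) * m1
end SC


namespace SC

/-- `f_m(w)` as a real function -/
def fR (m w : ℝ) : ℝ := w^3 - m*w^2 - (m+3)*w - 1

theorem fR_m {m t : ℝ} (ht : 0 < t) (h : fR m t = 0) : m = (t^3-3*t-1)/(t^2+t) := by
  unfold fR at h
  have : t^2+t ≠ 0 := by positivity
  field_simp
  linarith

theorem fR_fac {m t : ℝ} (ht : 0 < t) (h : fR m t = 0) (w : ℝ) :
    fR m w = (w-t)*(w+1/(1+t))*(w+(1+t)/t) := by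
  have := fR_m ht h
  unfold fR; rw [this]
  have h1 : t ≠ 0 := by positivity
  have h2 : 1+t ≠ 0 := by positivity
  have h3 : t+1 ≠ 0 := by positivity
  have h4 : t^2+t = t*(1+t) := by ring
  rw [h4]
  field_simp
  ring

theorem N_eq {m t : ℝ} (ht : 0 < t) (h : fR m t = 0) :
    m^2+3*m+9 = (t^2+t+1)^3/(t^2+t)^2 := by
  have := fR_m ht h
  rw [this]
  have h1 : t ≠ 0 := by positivity
  have h2 : 1+t ≠ 0 := by positivity
  have h4 : t^2+t = t*(1+t) := by ring
  rw [h4]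
  field_simp
  ring

theorem m_le {m t : ℝ} (ht : 0 < t) (h : fR m t = 0) : m ≤ t - 1 := by
  have := fR_m ht h
  rw [this, div_le_iff₀ (by positivity)]
  nlinarith

/-- concavity principle -/
theorem loc_aux {m t w0 w d : ℝ} (ht : 0 < t) (h : fR m t = 0) (hw0 : 0 ≤ w0) (hw : w0 ≤ w)
    (hwd : d ≤ 1 ∨ 2*w0 ≥ d - 1) (K : ℝ) (h0 : K < -fR m w0) (h1 : K < -fR m (t-d)) (h2 : -fR m w ≤ K) :
    t - d < w := by
  by_contra hc
  push Not at hc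
  have hm := m_le ht h
  rcases eq_or_lt_of_le hw with he | hlt
  · rw [he] at h0; linarith
  have hid : (-fR m w) * ((t-d)-w0) = (-fR m w0)*((t-d)-w) + (-fR m (t-d))*(w-w0)
     + ((t-d)-w0)*(w-w0)*((t-d)-w)*(w+w0+(t-d)-m) := by unfold fR; ring
  have h3 : 0 ≤ ((t-d)-w0)*(w-w0)*((t-d)-w)*(w+w0+(t-d)-m) := by
    apply mul_nonneg
    · apply mul_nonneg
      · apply mul_nonneg <;> linarith
      · linarith
    · rcases hwd with h | h <;> linarith
  have h4 : K*((t-d)-w) ≤ (-fR m w0)*((t-d)-w) := mul_le_mul_of_nonneg_right h0.le (by linarith)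
  have h5 : K*(w-w0) < (-fR m (t-d))*(w-w0) := mul_lt_mul_of_pos_right h1 (by linarith)
  have h6 : (-fR m w) * ((t-d)-w0) ≤ K*((t-d)-w0) := mul_le_mul_of_nonneg_right h2 (by linarith)
  nlinarith

theorem g_w0 {m t : ℝ} (ht : 0 < t) (h : fR m t = 0) :
    -fR m ((t^2-1)/(2*t+1)) = (t^2+t+1)^3/(2*t+1)^3 := by
  rw [fR_fac ht h]
  have h1 : t ≠ 0 := by positivity
  have h2 : 1+t ≠ 0 := by positivity
  have h3 : 2*t+1 ≠ 0 := by positivity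
  field_simp
  ring

theorem g_td {m t d : ℝ} (ht : 0 < t) (h : fR m t = 0) :
    -fR m (t-d) = d*(((t-d)*(1+t)+1)*((t-d)*t+1+t)/(t^2+t)) := by
  rw [fR_fac ht h]
  have h1 : t ≠ 0 := by positivity
  have h2 : 1+t ≠ 0 := by positivity
  have h4 : t^2+t = t*(1+t) := by ring
  rw [h4]
  field_simp
  ring

/-- generic: from the bound K = N*k -/
theorem loc_low {m t w d k : ℝ} (ht : 6/5 ≤ t) (h : fR m t = 0)
    (hw : (t^2-1)/(2*t+1) ≤ w) (hd : d ≤ 1)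
    (hk : k*(2*t+1)^3 < (t^2+t)^2)
    (hk2 : k*(t^2+t+1)^3 < d*(((t-d)*(1+t)+1)*((t-d)*t+1+t)*(t^2+t)))
    (h2 : -fR m w ≤ k*(m^2+3*m+9)) : t - d < w := by
  have ht0 : 0 < t := by linarith
  refine loc_aux ht0 h (w0 := (t^2-1)/(2*t+1)) (div_nonneg (by nlinarith) (by linarith)) hw
    (Or.inl hd) (k*(m^2+3*m+9)) ?_ ?_ h2
  · rw [g_w0 ht0 h, N_eq ht0 h, ← mul_div_assoc, div_lt_div_iff₀ (by positivity) (by positivity)]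
    have : 0 < (t^2+t+1)^3 := by positivity
    nlinarith
  · rw [g_td ht0 h, N_eq ht0 h, ← mul_div_assoc, ← mul_div_assoc,
      div_lt_div_iff₀ (by positivity) (by positivity)]
    have : 0 < (t^2+t) := by positivity
    nlinarith

theorem loc_q2 {m t w k : ℝ} (ht : 6/5 ≤ t) (h : fR m t = 0)
    (hw : (t^2-1)/(2*t+1) ≤ w) (hk : k ≤ 1/8) (h2 : -fR m w ≤ k*(m^2+3*m+9)) : t - 1/2 < w := by
  obtain ⟨s, rfl⟩ : ∃ s, t = 6/5+s := ⟨t-6/5, by ring⟩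
  have hs : 0 ≤ s := by linarith
  have hN : 0 ≤ m^2+3*m+9 := by nlinarith [sq_nonneg (m+1)]
  refine loc_low ht h hw (by norm_num) (k := 1/8) ?_ ?_ (h2.trans (mul_le_mul_of_nonneg_right hk hN))
  · have : 0 < ((6/5+s)^2+(6/5+s))^2 - 1/8*(2*(6/5+s)+1)^3 := by ring_nf; positivity
    linarith
  · rw [← sub_pos]; ring_nf; positivity

theorem loc_q4 {m t w k : ℝ} (ht : 6/5 ≤ t) (h : fR m t = 0)
    (hw : (t^2-1)/(2*t+1) ≤ w) (hwt : w < t) (hk0 : 0 < k) (hk : k ≤ 1/64) (h2 : -fR m w ≤ k*(m^2+3*m+9)) :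
    t - w ≤ 37/20*k := by
  have hN : 0 ≤ m^2+3*m+9 := by nlinarith [sq_nonneg (m+1)]
  have h3 : t - 1/4 < w := by
    obtain ⟨s, rfl⟩ : ∃ s, t = 6/5+s := ⟨t-6/5, by ring⟩
    have hs : 0 ≤ s := by linarith
    refine loc_low ht h hw (by norm_num) (k := 1/64) ?_ ?_ (h2.trans (mul_le_mul_of_nonneg_right hk hN))
    · rw [← sub_pos]; ring_nf; positivity
    · rw [← sub_pos]; ring_nf; positivity
  obtain ⟨d, rfl⟩ : ∃ d, w = t - d := ⟨t-w, by ring⟩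
  have hd : 0 < d := by linarith
  have hd4 : d < 1/4 := by linarith
  have ht0 : 0 < t := by linarith
  rw [g_td ht0 h, N_eq ht0 h] at h2
  have h4 : ((t-1/4)*(1+t)+1)*((t-1/4)*t+1+t) ≤ ((t-d)*(1+t)+1)*((t-d)*t+1+t) := by
    have e1 : 0 ≤ (t-1/4)*t := mul_nonneg (by linarith) (by linarith)
    have e2 : 0 ≤ (t-d)*(1+t) := mul_nonneg (by linarith) (by linarith)
    gcongr
  have h5 : (t^2+t+1)^3 ≤ 37/20*(((t-1/4)*(1+t)+1)*((t-1/4)*t+1+t)*(t^2+t)) := by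
    obtain ⟨s, rfl⟩ : ∃ s, t = 6/5+s := ⟨t-6/5, by ring⟩
    have hs : 0 ≤ s := by linarith
    rw [← sub_nonneg]; ring_nf; positivity
  have h6 : (t^2+t+1)^3/(t^2+t)^2 ≤ 37/20*(((t-1/4)*(1+t)+1)*((t-1/4)*t+1+t)/(t^2+t)) := by
    rw [← mul_div_assoc, div_le_div_iff₀ (by positivity) (by positivity)]
    have : 0 < (t^2+t) := by positivity
    nlinarith
  have h7 : 0 < ((t-1/4)*(1+t)+1)*((t-1/4)*t+1+t)/(t^2+t) := by
    apply div_pos _ (by positivity)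
    apply mul_pos <;> nlinarith
  set G := ((t-1/4)*(1+t)+1)*((t-1/4)*t+1+t)/(t^2+t)
  have h8 : G ≤ ((t-d)*(1+t)+1)*((t-d)*t+1+t)/(t^2+t) := by
    apply div_le_div_of_nonneg_right h4 (by positivity)
  have h9 : d*G ≤ k*(37/20*G) := by
    calc d*G ≤ _ := mul_le_mul_of_nonneg_left h8 hd.le
      _ ≤ _ := h2
      _ ≤ _ := mul_le_mul_of_nonneg_left h6 hk0.le
  have : d*G ≤ (37/20*k)*G := by linarith
  have := le_of_mul_le_mul_right this h7
  linarith

theorem loc_q1 {m t w : ℝ} (ht : 6/5 ≤ t) (h : fR m t = 0)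
    (hw : (t^2-1)/(2*t+1) ≤ w) (h2 : -fR m w ≤ (m^2+3*m+9)) : t - 5 < w := by
  have ht0 : 0 < t := by linarith
  rcases lt_or_ge t 9 with h9 | h9
  · have : t - 5 < (t^2-1)/(2*t+1) := by
      rw [lt_div_iff₀ (by linarith)]
      nlinarith
    linarith
  · refine loc_aux ht0 h (w0 := (t^2-1)/(2*t+1)) (div_nonneg (by nlinarith) (by linarith)) hw
      (Or.inr ?_) ((m^2+3*m+9)) ?_ ?_ h2
    · have : 2 ≤ (t^2-1)/(2*t+1) := by
        rw [le_div_iff₀ (by linarith)]; nlinarith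
      linarith
    · rw [g_w0 ht0 h, N_eq ht0 h]
      apply div_lt_div_of_pos_left (by positivity) (by positivity)
      obtain ⟨s, rfl⟩ : ∃ s, t = 9+s := ⟨t-9, by ring⟩
      have hs : 0 ≤ s := by linarith
      rw [← sub_pos]; ring_nf; positivity
    · rw [g_td ht0 h, N_eq ht0 h, ← mul_div_assoc,
        div_lt_div_iff₀ (by positivity) (by positivity)]
      obtain ⟨s, rfl⟩ : ∃ s, t = 9+s := ⟨t-9, by ring⟩
      have hs : 0 ≤ s := by linarith
      rw [← sub_pos]; ring_nf; positivity

theorem loc_up {m t w k : ℝ} (ht : 6/5 ≤ t) (h : fR m t = 0) (hk : 0 < k)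
    (hw : t < w) (h2 : fR m w ≤ k*(m^2+3*m+9)) : w - t ≤ 37/20*k := by
  have ht0 : 0 < t := by linarith
  rw [fR_fac ht0 h, N_eq ht0 h] at h2
  have h1 : (t+1/(1+t))*(t+(1+t)/t) ≤ (w+1/(1+t))*(w+(1+t)/t) := by
    have hw0 : 0 < w := by linarith
    gcongr
  have h3 : (t+1/(1+t))*(t+(1+t)/t) = (t^2+t+1)^2/(t^2+t) := by
    have h1 : t ≠ 0 := by positivity
    have h2 : 1+t ≠ 0 := by positivity
    have h4 : t^2+t = t*(1+t) := by ring
    rw [h4]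
    field_simp
    ring
  have h4 : (t^2+t+1)^3/(t^2+t)^2 ≤ 37/20*((t^2+t+1)^2/(t^2+t)) := by
    rw [← mul_div_assoc, div_le_div_iff₀ (by positivity) (by positivity)]
    have : 0 < (t^2+t) := by positivity
    have h6 : t^2+t+1 ≤ 37/20*(t^2+t) := by nlinarith
    have : (t^2+t+1)*((t^2+t+1)^2*(t^2+t)) ≤ 37/20*(t^2+t)*((t^2+t+1)^2*(t^2+t)) :=
      mul_le_mul_of_nonneg_right h6 (by positivity)
    nlinarith
  have h7 : 0 < (t^2+t+1)^2/(t^2+t) := by positivity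
  rw [h3] at h1
  set G := (t^2+t+1)^2/(t^2+t)
  have : (w-t)*G ≤ (37/20*k)*G := by
    calc (w-t)*G ≤ (w-t)*((w+1/(1+t))*(w+(1+t)/t)) := mul_le_mul_of_nonneg_left h1 (by linarith)
      _ = (w-t)*(w+1/(1+t))*(w+(1+t)/t) := by ring
      _ ≤ _ := h2
      _ ≤ k*(37/20*G) := mul_le_mul_of_nonneg_left h4 hk.le
      _ = _ := by ring
  exact le_of_mul_le_mul_right this h7
end SC


namespace SC

/-- evaluate `x` first (call by value), then continue -/
def force {α : Type} (x : ℕ) (k : ℕ → α) : α := Nat.rec (k 0) (fun n _ => k (n+1)) x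

/-- allowed pairs, shifted: M = m+1 -/
def okPair (M n : ℕ) : Bool :=
  Nat.ble (n+1) M || (Nat.beq M 0 && (Nat.beq n 5 || Nat.beq n 12 || Nat.beq n 1259)) ||
  (Nat.beq M 6 && (Nat.beq n 12 || Nat.beq n 1259)) || (Nat.beq M 13 && Nat.beq n 1259) ||
  (Nat.beq M 1 && (Nat.beq n 3 || Nat.beq n 54)) || (Nat.beq M 4 && Nat.beq n 54) ||
  (Nat.beq M 2 && Nat.beq n 66) || (Nat.beq M 3 && Nat.beq n 2389)

def goodPQ (M N p q : ℕ) : Bool :=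
  force (p*p*(p+q)) fun U => force (q*(M*p*p+(M+2)*p*q+q*q)) fun V =>
  bif Nat.ble U V then
    force (V-U) fun F =>
      bif Nat.beq (N % F) 0 then
        force ((M+2)*p*p*p+9*p*q*(p+q)) fun P => force ((M+2)*q*q*(3*p+q)) fun Q =>
        Nat.ble (P+1) Q || okPair M ((P-Q)/F)
      else true
  else
    force (U-V) fun F =>
      bif Nat.beq (N % F) 0 then
        force ((M+2)*p*p*p+9*p*q*(p+q)) fun P => force ((M+2)*q*q*(3*p+q)) fun Q =>
        Nat.ble (P+1) (Q+3*F) || okPair M ((P-Q)/F-3)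
      else true

def cfLoop (M N b B : ℕ) (fuel : ℕ) : ℕ → ℕ → ℕ → ℕ → ℕ → ℕ → Bool :=
  Nat.rec (fun _ _ _ _ _ _ => false)
    (fun _ ih r0 r1 p0 q0 p1 q1 =>
      (bif Nat.ble (10*(r0*q0*q0)) (19*b) then goodPQ M N p0 q0 else true) &&
      (bif Nat.ble (B+1) q1 then true else
        force (r0/r1) fun A => force (r0 - A*r1) fun r2 => force (p0+A*p1) fun p2 =>
        force (q0 + A*q1) fun q2 => ih r1 r2 p1 q1 p2 q2)) fuel

def newton (M S : ℕ) (fuel : ℕ) : ℕ → ℕ :=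
  Nat.rec (fun x => x)
    (fun _ ih x =>
      force (x*x) fun x2 =>
      force ((x2*x+x2*S - (M*x2*S + (M+2)*x*(S*S)+S*S*S)) / (3*x2+2*x*S-(2*M*x*S+(M+2)*(S*S)))) fun d =>
      force (x - d) ih) fuel

def cubLo (M S x : ℕ) : Bool := Nat.ble (x*x*(x+S)) (S*(M*x*x+(M+2)*x*S+S*S))
def cubHi (M S x : ℕ) : Bool := Nat.ble (S*(M*x*x+(M+2)*x*S+S*S)) (x*x*(x+S))

def brute (M N q : ℕ) (cnt : ℕ) : ℕ → Bool :=
  Nat.rec (fun _ => true) (fun _ ih p => goodPQ M N p q && force (p+1) ih) cnt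

def cfM (S B : ℕ) (M : ℕ) : Bool :=
  force (M*M+M+7) fun N =>
  force (newton M S 12 ((M+2)*S) - 2) fun a =>
  cubLo M S a && (cubHi M S (a+4) &&
  (brute M N 1 9 (a/S-5) && (brute M N 2 5 (2*a/S-2) && (brute M N 3 5 (3*a/S-2) &&
  cfLoop M N S B 150 S (a%S) 1 0 (a/S) 1))))

def cfRange (S B M0 : ℕ) (cnt : ℕ) : Bool :=
  Nat.rec true (fun i ih => cfM S B (M0+i) && ih) cnt
end SC


namespace SC

theorem force_eq {α : Type} (x : ℕ) (k : ℕ → α) : force x k = k x := by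
  cases x <;> rfl

theorem cfLoop_succ (M N b B fuel r0 r1 p0 q0 p1 q1 : ℕ) :
    cfLoop M N b B (fuel+1) r0 r1 p0 q0 p1 q1 =
      ((bif Nat.ble (10*(r0*q0*q0)) (19*b) then goodPQ M N p0 q0 else true) &&
      (bif Nat.ble (B+1) q1 then true else
        cfLoop M N b B fuel r1 (r0 - r0/r1*r1) p1 q1 (p0+r0/r1*p1) (q0 + r0/r1*q1))) := by
  have e : cfLoop M N b B (fuel+1) r0 r1 p0 q0 p1 q1 =
      ((bif Nat.ble (10*(r0*q0*q0)) (19*b) then goodPQ M N p0 q0 else true) &&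
      (bif Nat.ble (B+1) q1 then true else
        force (r0/r1) fun A => force (r0 - A*r1) fun r2 => force (p0+A*p1) fun p2 =>
        force (q0 + A*q1) fun q2 => cfLoop M N b B fuel r1 r2 p1 q1 p2 q2)) := rfl
  rw [e]
  simp only [force_eq]

theorem best_approx (p q a b r0 r1 p0 q0 p1 q1 s : ℤ) (hss : s*s = 1) (h0 : p0*b-q0*a = s*r0)
    (h1 : p1*b-q1*a = -s*r1) (hdet : p0*q1-p1*q0 = s) (hr0 : 0 ≤ r0) (hr1 : 0 ≤ r1) (hq00 : 0 ≤ q0)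
    (hq : 0 < q) (hlt : q < q1) :
    r0 ≤ |p*b-q*a| ∧ ∃ x y : ℤ, y = s*(q*p0-p*q0) ∧ p = x*p0+y*p1 ∧ q = x*q0+y*q1 := by
  obtain ⟨x, hx⟩ : ∃ x : ℤ, x = s*(p*q1-q*p1) := ⟨_, rfl⟩
  obtain ⟨y, hy⟩ : ∃ y : ℤ, y = s*(q*p0-p*q0) := ⟨_, rfl⟩
  have hp : p = x*p0+y*p1 := by
    rw [hx, hy]; linear_combination (p:ℤ)*(-hss) - s*p*hdet
  have hqe : q = x*q0+y*q1 := by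
    rw [hx, hy]; linear_combination (q:ℤ)*(-hss) - s*q*hdet
  have hD : p*b-q*a = s*(x*r0-y*r1) := by
    rw [hp, hqe]; linear_combination x*h0 + y*h1
  refine ⟨?_, x, y, hy, hp, hqe⟩
  clear hx hy hp hdet h0 h1
  have hx0 : x ≠ 0 := by
    intro h00
    rw [h00] at hqe
    have h5 : (0:ℤ) < y := by
      by_contra hc
      have : y*q1 ≤ 0 := mul_nonpos_of_nonpos_of_nonneg (by linarith) (by linarith)
      linarith
    have : 1*q1 ≤ y*q1 := mul_le_mul_of_nonneg_right h5 (by linarith)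
    linarith
  have hsab : |s| = 1 := by
    rcases mul_self_eq_one_iff.mp hss with rfl | rfl <;> rfl
  rw [hD, abs_mul, hsab, one_mul]
  clear hD hss hsab
  rcases lt_or_gt_of_ne hx0 with hxn | hxp
  · have hy1 : 0 ≤ y := by
      by_contra hc
      have : y*q1 ≤ 0 := mul_nonpos_of_nonpos_of_nonneg (by linarith) (by linarith)
      have : x*q0 ≤ 0 := mul_nonpos_of_nonpos_of_nonneg (by linarith) (by linarith)
      linarith
    have : x*r0 ≤ (-1)*r0 := mul_le_mul_of_nonneg_right (by omega) hr0
    have : 0 ≤ y*r1 := by positivity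
    rw [abs_of_nonpos (by linarith)]; linarith
  · have hy1 : y ≤ 0 := by
      by_contra hc
      have : 1*q1 ≤ y*q1 := mul_le_mul_of_nonneg_right (by omega) (by linarith)
      have : 0 ≤ x*q0 := by positivity
      linarith
    have : 1*r0 ≤ x*r0 := mul_le_mul_of_nonneg_right (by omega) hr0
    have : y*r1 ≤ 0 := mul_nonpos_of_nonpos_of_nonneg hy1 hr1
    rw [abs_of_nonneg (by linarith)]; linarith

theorem best_approx_eq (p q a b r0 r1 p0 q0 p1 q1 s : ℤ) (hss : s*s = 1) (h0 : p0*b-q0*a = s*r0)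
    (h1 : p1*b-q1*a = -s*r1) (hdet : p0*q1-p1*q0 = s) (hr0 : 0 ≤ r0) (hr1 : 0 ≤ r1) (hq00 : 0 ≤ q0)
    (hq : 4 ≤ q) (hlt : q < q1) (hq0 : q0 ≤ q) (hb : 0 < b) (hco : IsCoprime p q)
    (happ : 10*q^2*|p*b-q*a| ≤ 19*b) : p = p0 ∧ q = q0 := by
  obtain ⟨hr, x, y, hy, hp, hqe⟩ := best_approx p q a b r0 r1 p0 q0 p1 q1 s hss h0 h1 hdet hr0 hr1
    hq00 (by linarith) hlt
  have hsab : |s| = 1 := by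
    rcases mul_self_eq_one_iff.mp hss with rfl | rfl <;> rfl
  have hy0 : y = 0 := by
    have e1 : b*y = q*r0 - s*q0*(p*b-q*a) := by
      rw [hy]; linear_combination s*q*h0 + (q:ℤ)*r0*hss
    have e2 : |b*y| ≤ q*r0 + q0*|p*b-q*a| := by
      rw [e1]
      refine (abs_sub _ _).trans ?_
      rw [abs_of_nonneg (by positivity : (0:ℤ) ≤ q*r0), abs_mul, abs_mul, hsab, one_mul,
        abs_of_nonneg hq00]
    obtain ⟨D, hDd⟩ : ∃ D, D = |p*b-q*a| := ⟨_, rfl⟩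
    rw [← hDd] at e2 happ hr
    have hDn : 0 ≤ D := hDd ▸ abs_nonneg _
    have e31 : q*r0 ≤ q*D := mul_le_mul_of_nonneg_left hr (by linarith)
    have e32 : q0*D ≤ q*D := mul_le_mul_of_nonneg_right hq0 (by linarith)
    have e4 : 10*q*(q*D) ≤ 19*b := by linarith [happ]
    have e6 : 0 ≤ q*D := by positivity
    have e5 : 40*(q*D) ≤ 10*q*(q*D) := mul_le_mul_of_nonneg_right (by linarith) e6
    rw [abs_mul, abs_of_pos hb] at e2
    by_contra hne
    have : 1 ≤ |y| := Int.one_le_abs hne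
    have : b*1 ≤ b*|y| := mul_le_mul_of_nonneg_left this hb.le
    linarith
  rw [hy0] at hp hqe
  simp only [zero_mul, add_zero] at hp hqe
  have hxu : IsUnit x := hco.isUnit_of_dvd' ⟨p0, hp⟩ ⟨q0, hqe⟩
  have hx1 : x = 1 := by
    rcases Int.isUnit_iff.mp hxu with h | h
    · exact h
    · exfalso; rw [h] at hqe
      linarith
  rw [hx1, one_mul] at hp hqe
  exact ⟨hp, hqe⟩

theorem cfLoop_sound (M N b B a p q : ℕ) (hco : Nat.Coprime p q) (hqB : q ≤ B) (hq : 4 ≤ q)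
    (hb : 0 < b) (happ : 10*(q:ℤ)^2*|(p:ℤ)*b-q*a| ≤ 19*b) : ∀ (fuel r0 r1 p0 q0 p1 q1 : ℕ) (s : ℤ),
    (s*s = 1) → ((p0:ℤ)*b-q0*a = s*r0) → ((p1:ℤ)*b-q1*a = -s*r1) →
    ((p0:ℤ)*q1-p1*q0 = s) → q0 ≤ q → cfLoop M N b B fuel r0 r1 p0 q0 p1 q1 = true →
    goodPQ M N p q = true := by
  intro fuel
  induction fuel with
  | zero => intro r0 r1 p0 q0 p1 q1 s _ _ _ _ _ h; exact absurd h (by simp [cfLoop])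
  | succ k ih =>
    intro r0 r1 p0 q0 p1 q1 s hss h0 h1 hdet hq0 h
    rw [cfLoop_succ, Bool.and_eq_true] at h
    obtain ⟨hA, hB⟩ := h
    by_cases hlt : q < q1
    · obtain ⟨hp, hqe⟩ := best_approx_eq p q a b r0 r1 p0 q0 p1 q1 s hss h0 h1 hdet (by positivity)
        (by positivity) (by positivity) (by exact_mod_cast hq) (by exact_mod_cast hlt)
        (by exact_mod_cast hq0) (by exact_mod_cast hb) (Nat.isCoprime_iff_coprime.mpr hco) happ
      have hle : 10*(r0*q0*q0) ≤ 19*b := by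
        have h6 : ((10*(r0*q0*q0) : ℕ):ℤ) ≤ ((19*b : ℕ):ℤ) := by
          push_cast
          rw [hp, hqe, h0, abs_mul] at happ
          have hsab : |s| = 1 := by
            rcases mul_self_eq_one_iff.mp hss with h | h <;> rw [h] <;> rfl
          rw [hsab, one_mul, Nat.abs_cast] at happ
          linarith
        exact_mod_cast h6
      have hp' : p = p0 := by exact_mod_cast hp
      have hq' : q = q0 := by exact_mod_cast hqe
      rw [Nat.ble_eq_true_of_le hle, cond_true] at hA
      rw [hp', hq']; exact hA
    · push Not at hlt
      have hnb : Nat.ble (B+1) q1 = false := by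
        rw [Bool.eq_false_iff]; intro hc
        have := Nat.le_of_ble_eq_true hc
        omega
      rw [hnb, cond_false] at hB
      have hle : r0/r1*r1 ≤ r0 := Nat.div_mul_le_self r0 r1
      refine ih _ _ _ _ _ _ (-s) ?_ ?_ ?_ ?_ hlt hB
      · linarith
      · exact h1
      · push_cast [Nat.cast_sub hle]
        linear_combination h0 + (r0/r1 : ℤ)*h1
      · push_cast
        linear_combination -hdet

theorem brute_sound (M N q : ℕ) : ∀ (cnt p0 p : ℕ), brute M N q cnt p0 = true → p0 ≤ p → p < p0+cnt →
    goodPQ M N p q = true := by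
  intro cnt
  induction cnt with
  | zero => intro p0 p _ h1 h2; omega
  | succ k ih =>
    intro p0 p h h1 h2
    have e : brute M N q (k+1) p0 = (goodPQ M N p0 q && brute M N q k (p0+1)) := by
      have e' : brute M N q (k+1) p0 = (goodPQ M N p0 q && force (p0+1) (brute M N q k)) := rfl
      rw [e', force_eq]
    rw [e, Bool.and_eq_true] at h
    rcases eq_or_lt_of_le h1 with rfl | h3
    · exact h.1
    · exact ih (p0+1) p h.2 h3 (by omega)

theorem cfRange_sound (S B M0 : ℕ) : ∀ cnt, cfRange S B M0 cnt = true → ∀ i < cnt, cfM S B (M0+i) = true := by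
  intro cnt
  induction cnt with
  | zero => intro _ i hi; omega
  | succ k ih =>
    intro h i hi
    have e : cfRange S B M0 (k+1) = (cfM S B (M0+k) && cfRange S B M0 k) := rfl
    rw [e, Bool.and_eq_true] at h
    rcases Nat.lt_succ_iff_lt_or_eq.mp hi with h1 | rfl
    · exact ih h.2 i h1
    · exact h.1
end SC


namespace SC

def FF (m p q : ℤ) : ℤ := p^3 - m*p^2*q - (m+3)*p*q^2 - q^3
def HH (m p q : ℤ) : ℤ := (m+3)*(p^3-3*p*q^2-q^3) + 9*(p*q*(p+q))

def okSet : Set (ℤ × ℤ) := {(-1, 5), (-1, 12), (-1, 1259), (5, 12), (5, 1259), (12, 1259),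
        (0, 3), (0, 54), (3, 54), (1, 66), (2, 2389)}

theorem okPair_sound (M n : ℕ) (m : ℤ) (hm : m + 1 = M) (hmn : m < n) (h : okPair M n = true) :
    (m, (n:ℤ)) ∈ okSet := by
  unfold okPair at h
  simp only [Bool.or_eq_true, Bool.and_eq_true, Nat.beq_eq, Nat.ble_eq] at h
  have hmm : m = (M:ℤ) - 1 := by omega
  subst hmm
  have key : ∀ x y : ℕ, M = x → n = y → (((x:ℤ)-1, (y:ℤ)) ∈ okSet) → (((M:ℤ)-1, (n:ℤ)) ∈ okSet) := by
    intro x y h1 h2 h3; rw [h1, h2]; exact h3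
  rcases h with (((((((h | h) | h) | h) | h) | h) | h) | h)
  · omega
  · obtain ⟨h1, (h2 | h2) | h2⟩ := h <;> exact key _ _ h1 h2 (by norm_num [okSet])
  · obtain ⟨h1, h2 | h2⟩ := h <;> exact key _ _ h1 h2 (by norm_num [okSet])
  · obtain ⟨h1, h2⟩ := h; exact key _ _ h1 h2 (by norm_num [okSet])
  · obtain ⟨h1, h2 | h2⟩ := h <;> exact key _ _ h1 h2 (by norm_num [okSet])
  · obtain ⟨h1, h2⟩ := h; exact key _ _ h1 h2 (by norm_num [okSet])
  · obtain ⟨h1, h2⟩ := h; exact key _ _ h1 h2 (by norm_num [okSet])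
  · obtain ⟨h1, h2⟩ := h; exact key _ _ h1 h2 (by norm_num [okSet])

theorem goodPQ_sound (M N p q : ℕ) (m n : ℤ) (hm : m + 1 = M) (hmn : m < n)
    (hN : (N:ℤ) = m^2+3*m+9) (hdvd : FF m p q ∣ m^2+3*m+9)
    (hc : (0 < FF m p q ∧ (n+3)*FF m p q = HH m p q) ∨ (FF m p q < 0 ∧ -n*FF m p q = HH m p q))
    (h : goodPQ M N p q = true) : (m, n) ∈ okSet := by
  obtain ⟨n', rfl⟩ : ∃ n' : ℕ, n = n' := ⟨n.toNat, by omega⟩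
  apply okPair_sound M n' m hm hmn
  have hmm : m = M - 1 := by omega
  subst hmm
  unfold goodPQ at h
  simp only [force_eq] at h
  set P := (M+2)*p*p*p+9*p*q*(p+q) with hP
  set Q := (M+2)*q*q*(3*p+q) with hQ
  have hHH : HH (M-1) p q = (P:ℤ) - Q := by
    rw [hP, hQ]; push_cast; unfold HH; ring
  set U := p*p*(p+q) with hU
  set V := q*(M*p*p+(M+2)*p*q+q*q) with hV
  have hFF : FF (M-1) p q = (U:ℤ) - V := by
    rw [hU, hV]; push_cast; unfold FF; ring
  rw [hHH, hFF] at hc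
  rw [hFF, ← hN] at hdvd
  rcases hc with ⟨h1, h2⟩ | ⟨h1, h2⟩
  · have hVU : V < U := by omega
    have hble : Nat.ble U V = false := by
      rw [Bool.eq_false_iff]; intro hc
      have := Nat.le_of_ble_eq_true hc
      omega
    rw [hble, cond_false] at h
    obtain ⟨F, hF⟩ : ∃ F : ℕ, F = U - V := ⟨_, rfl⟩
    have hFz : (F:ℤ) = (U:ℤ) - V := by omega
    rw [← hFz] at hdvd h1 h2
    have hd : F ∣ N := by exact_mod_cast hdvd
    have hF0 : 0 < F := by exact_mod_cast h1
    rw [← hF] at h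
    have : Nat.beq (N % F) 0 = true := by rw [Nat.mod_eq_zero_of_dvd hd]; rfl
    rw [this, cond_true, Bool.or_eq_true] at h
    have h3 : (n'+3)*F + Q = P := by
      have : (((n'+3)*F + Q : ℕ):ℤ) = P := by push_cast; linarith
      exact_mod_cast this
    rcases h with h | h
    · exfalso
      have := Nat.le_of_ble_eq_true h
      have : 0 ≤ n'*F := by positivity
      have : n'*F + 3*F + Q = P := by rw [← h3]; ring
      omega
    · have : (P - Q)/F = n'+3 := by
        rw [← h3, Nat.add_sub_cancel]; exact Nat.mul_div_cancel _ hF0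
      rw [this, Nat.add_sub_cancel] at h
      exact h
  · have hVU : U ≤ V := by omega
    rw [Nat.ble_eq_true_of_le hVU, cond_true] at h
    obtain ⟨F, hF⟩ : ∃ F : ℕ, F = V - U := ⟨_, rfl⟩
    have hFz : (U:ℤ) - V = -F := by omega
    rw [hFz] at hdvd h1 h2
    rw [neg_dvd] at hdvd
    have hd : F ∣ N := by exact_mod_cast hdvd
    have hF0 : 0 < F := by omega
    rw [← hF] at h
    have : Nat.beq (N % F) 0 = true := by rw [Nat.mod_eq_zero_of_dvd hd]; rfl
    rw [this, cond_true, Bool.or_eq_true] at h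
    have h3 : n'*F + Q = P := by
      have : ((n'*F + Q : ℕ):ℤ) = P := by push_cast; linarith
      exact_mod_cast this
    rcases h with h | h
    · exfalso
      have := Nat.le_of_ble_eq_true h
      omega
    · have : (P - Q)/F = n' := by
        rw [← h3, Nat.add_sub_cancel]; exact Nat.mul_div_cancel _ hF0
      rw [this] at h
      exact h

theorem FF_real (m p q : ℤ) (hq : 0 < q) : (FF m p q : ℝ) = q^3 * fR m ((p:ℝ)/q) := by
  have : (q:ℝ) ≠ 0 := by exact_mod_cast hq.ne'
  unfold FF fR; push_cast; field_simp

theorem fR_pos_iff {m t w : ℝ} (ht : 0 < t) (h : fR m t = 0) (hw : 0 ≤ w) : 0 ≤ fR m w ↔ t ≤ w := by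
  rw [fR_fac ht h]
  have h1 : 0 < (w+1/(1+t))*(w+(1+t)/t) := by positivity
  rw [mul_assoc]
  constructor
  · intro h2
    have := nonneg_of_mul_nonneg_left h2 h1
    linarith
  · intro h2
    exact mul_nonneg (by linarith) h1.le

/-- localisation in terms of p,q -/
theorem loc_main (m : ℤ) (t : ℝ) (p q : ℕ) (ht : 6/5 ≤ t) (hf : fR m t = 0) (hq : 0 < q)
    (hdvd : FF m p q ∣ m^2+3*m+9)
    (hc : 0 < FF m p q ∨ (FF m p q < 0 ∧ (t^2-1)*q ≤ (2*t+1)*p)) :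
    (t - 5) * q < p ∧ p ≤ (t+2)*q ∧ (2 ≤ q → |(p:ℝ) - q*t| ≤ q/2) ∧
    (4 ≤ q → (q:ℝ)^2 * |(p:ℝ) - q*t| ≤ 37/20) := by
  have hNp : 0 < m^2+3*m+9 := by nlinarith [sq_nonneg (m+1)]
  have habs := Int.le_of_dvd hNp (abs_dvd _ _ |>.mpr hdvd)
  have ht0 : 0 < t := by linarith
  have hqr : (0:ℝ) < q := by exact_mod_cast hq
  have hN : (0:ℝ) < (m:ℝ)^2+3*m+9 := by exact_mod_cast hNp
  have habsR : |(FF m p q : ℝ)| ≤ (m:ℝ)^2+3*m+9 := by exact_mod_cast habs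
  have hFF := FF_real m p q (by exact_mod_cast hq)
  push_cast at hFF
  set w : ℝ := (p:ℝ)/q with hw
  have hpw : (p:ℝ) = q*w := by rw [hw]; field_simp
  have hw0 : 0 ≤ w := by positivity
  set k : ℝ := 1/(q:ℝ)^3 with hk
  have hk0 : 0 < k := by positivity
  have hkq : k*q^3 = 1 := by rw [hk]; field_simp
  have hk1 : k ≤ 1 := by
    rw [hk, div_le_one (by positivity)]
    have : (1:ℝ) ≤ q := by exact_mod_cast hq
    exact one_le_pow₀ this
  have hfw : |fR m w| ≤ k*((m:ℝ)^2+3*m+9) := by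
    have : |(FF m p q : ℝ)| * k ≤ ((m:ℝ)^2+3*m+9)*k := mul_le_mul_of_nonneg_right habsR hk0.le
    rw [hFF, abs_mul, abs_of_pos (by positivity : (0:ℝ) < (q:ℝ)^3)] at this
    calc |fR m w| = (q^3 * |fR m w|) * k := by rw [mul_comm _ k, ← mul_assoc, hkq, one_mul]
      _ ≤ _ := this
      _ = _ := by ring
  have hpq : (p:ℝ) - q*t = q*(w-t) := by rw [hpw]; ring
  rw [hpq, abs_mul, abs_of_pos hqr]
  have hk2 : 2 ≤ q → k ≤ 1/8 := by
    intro h2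
    rw [hk]
    apply div_le_div_of_nonneg_left (by norm_num) (by norm_num)
    have : (2:ℝ) ≤ q := by exact_mod_cast h2
    calc (8:ℝ) = 2^3 := by norm_num
      _ ≤ _ := by gcongr
  have hk4 : 4 ≤ q → k ≤ 1/64 := by
    intro h2
    rw [hk]
    apply div_le_div_of_nonneg_left (by norm_num) (by norm_num)
    have : (4:ℝ) ≤ q := by exact_mod_cast h2
    calc (64:ℝ) = 4^3 := by norm_num
      _ ≤ _ := by gcongr
  have fin4 : |w-t| ≤ 37/20*k → (q:ℝ)^2*(q*|w-t|) ≤ 37/20 := by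
    intro h
    calc (q:ℝ)^2*(q*|w-t|) = q^3*|w-t| := by ring
      _ ≤ q^3*(37/20*k) := by gcongr
      _ = 37/20*(k*q^3) := by ring
      _ = 37/20 := by rw [hkq, mul_one]
  rw [hpw]
  rcases hc with hc | ⟨hc, hcw⟩
  · have hfpos : 0 < fR m w := by
      have : (0:ℝ) < FF m p q := by exact_mod_cast hc
      rw [hFF] at this
      exact (mul_pos_iff_of_pos_left (by positivity)).mp this
    have htw : t < w := by
      rcases lt_or_eq_of_le ((fR_pos_iff ht0 hf hw0).mp hfpos.le) with h | h
      · exact h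
      · rw [← h, hf] at hfpos; exact absurd hfpos (lt_irrefl _)
    have hup := loc_up ht hf hk0 htw ((le_abs_self _).trans hfw)
    have hab : |w - t| = w - t := abs_of_pos (by linarith)
    rw [hab] at fin4 ⊢
    refine ⟨?_, ?_, ?_, ?_⟩
    · rw [mul_comm]; apply mul_lt_mul_of_pos_left _ hqr; linarith
    · rw [mul_comm]; apply mul_le_mul_of_nonneg_right _ hqr.le; linarith
    · intro h2
      have := hk2 h2
      have : q*(w-t) ≤ q*(1/2) := mul_le_mul_of_nonneg_left (by linarith) hqr.le
      linarith
    · intro h4; exact fin4 hup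
  · have hfneg : fR m w < 0 := by
      have : (FF m p q : ℝ) < 0 := by exact_mod_cast hc
      rw [hFF] at this
      by_contra h
      push Not at h
      have : 0 ≤ q^3*fR m w := by positivity
      linarith
    have htw : w < t := by
      by_contra h
      push Not at h
      have := (fR_pos_iff ht0 hf hw0).mpr h
      linarith
    have hw1 : (t^2-1)/(2*t+1) ≤ w := by
      rw [div_le_iff₀ (by linarith)]
      rw [hpw] at hcw
      have : (t^2-1)*q ≤ (w*(2*t+1))*q := by linarith
      exact le_of_mul_le_mul_right this hqr
    have hg : -fR m w ≤ k*((m:ℝ)^2+3*m+9) := (neg_le_abs _).trans hfw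
    have hab : |w - t| = t - w := by rw [abs_of_neg (by linarith)]; ring
    rw [hab] at fin4 ⊢
    refine ⟨?_, ?_, ?_, ?_⟩
    · have := loc_q1 ht hf hw1 (hg.trans (by nlinarith))
      rw [mul_comm]; apply mul_lt_mul_of_pos_left _ hqr; linarith
    · rw [mul_comm]; apply mul_le_mul_of_nonneg_right _ hqr.le; linarith
    · intro h2
      have := loc_q2 ht hf hw1 (hk2 h2) hg
      have : q*(t-w) ≤ q*(1/2) := mul_le_mul_of_nonneg_left (by linarith) hqr.le
      linarith
    · intro h4; exact fin4 (loc_q4 ht hf hw1 htw hk0 (hk4 h4) hg)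

theorem cf_main (S B M : ℕ) (hB : 1 ≤ B) (hS : 400*B^3 ≤ S) (hcf : cfM S B M = true)
    (m n : ℤ) (hm : m + 1 = M) (hmn : m < n) (t : ℝ) (ht : 6/5 ≤ t) (hf : fR m t = 0)
    (p q : ℕ) (hq : 0 < q) (hqB : q ≤ B) (hco : Nat.Coprime p q)
    (hdvd : FF m p q ∣ m^2+3*m+9)
    (hc : (0 < FF m p q ∧ (n+3)*FF m p q = HH m p q) ∨
      (FF m p q < 0 ∧ -n*FF m p q = HH m p q ∧ (t^2-1)*q ≤ (2*t+1)*p)) : (m, n) ∈ okSet := by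
  have ht0 : 0 < t := by linarith
  obtain ⟨l1, l2, l3, l4⟩ := loc_main m t p q ht hf hq hdvd (by tauto)
  refine goodPQ_sound M (M*M+M+7) p q m n hm hmn ?_ hdvd (by tauto) ?_
  · push_cast; rw [← hm]; ring
  have hqr : (0:ℝ) < q := by exact_mod_cast hq
  unfold cfM at hcf
  simp only [force_eq] at hcf
  set a := newton M S 12 ((M+2)*S) - 2 with ha
  clear_value a
  set N := M*M+M+7
  simp only [Bool.and_eq_true] at hcf
  obtain ⟨c1, c2, c3, c4, c5, c6⟩ := hcf
  have hS0 : 0 < S := by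
    have : 0 < B^3 := by positivity
    omega
  have hSr : (0:ℝ) < S := by exact_mod_cast hS0
  have hmr : (m:ℝ) = M - 1 := by
    have : ((m+1 : ℤ):ℝ) = ((M:ℤ):ℝ) := by rw [hm]
    push_cast at this; linarith
  have fRx : ∀ x : ℕ, (S:ℝ)^3 * fR m ((x:ℝ)/S) = (x*x*(x+S) : ℕ) - (S*(M*x*x+(M+2)*x*S+S*S) : ℕ) := by
    intro x
    unfold fR; rw [hmr]; push_cast
    field_simp; ring
  have hta : (a:ℝ) ≤ S*t := by
    have h1 := Nat.le_of_ble_eq_true c1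
    have h1' : ((a*a*(a+S) : ℕ):ℝ) ≤ ((S*(M*a*a+(M+2)*a*S+S*S) : ℕ):ℝ) := by exact_mod_cast h1
    by_contra hcon
    push Not at hcon
    have h2 : t < (a:ℝ)/S := by rw [lt_div_iff₀ hSr]; linarith
    have h3 : fR m ((a:ℝ)/S) ≤ 0 := by
      by_contra h; push Not at h
      have : 0 < (S:ℝ)^3 * fR m ((a:ℝ)/S) := by positivity
      rw [fRx] at this; linarith
    have h4 : 0 < fR m ((a:ℝ)/S) := by
      rw [fR_fac ht0 hf]
      have : 0 < (a:ℝ)/S - t := by linarith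
      positivity
    linarith
  have hta4 : S*t ≤ (a:ℝ)+4 := by
    have h1 := Nat.le_of_ble_eq_true c2
    have h2 : ((S*(M*(a+4)*(a+4)+(M+2)*(a+4)*S+S*S) : ℕ):ℝ) ≤ (((a+4)*(a+4)*(a+4+S) : ℕ):ℝ) := by
      exact_mod_cast h1
    have h3 : 0 ≤ fR m (((a+4:ℕ):ℝ)/S) := by
      by_contra h; push Not at h
      have : (S:ℝ)^3 * fR m (((a+4:ℕ):ℝ)/S) < 0 := mul_neg_of_pos_of_neg (by positivity) h
      rw [fRx] at this; linarith
    have := (fR_pos_iff ht0 hf (by positivity)).mp h3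
    rw [le_div_iff₀ hSr] at this
    push_cast at this; linarith
  have hS4 : (400:ℝ) ≤ S := by
    have : 1 ≤ B^3 := Nat.one_le_pow _ _ hB
    exact_mod_cast (by omega : 400 ≤ S)
  -- floor facts
  have hfl : ∀ j : ℕ, (((j*a/S : ℕ):ℝ)) ≤ j*t ∧ (j:ℝ) * t < ((j*a/S : ℕ):ℝ) + 1 + j/100 := by
    intro j
    have e1 : (j*a/S)*S ≤ j*a := Nat.div_mul_le_self _ _
    have e2 : j*a < (j*a/S+1)*S := by
      have := Nat.lt_div_mul_add (a := j*a) hS0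
      linarith
    have e1' : (((j*a/S : ℕ):ℝ))*S ≤ j*a := by exact_mod_cast e1
    have e2' : (j:ℝ)*a < (((j*a/S : ℕ):ℝ)+1)*S := by exact_mod_cast e2
    have hj : (0:ℝ) ≤ j := by positivity
    constructor
    · have : (((j*a/S : ℕ):ℝ))*S ≤ (j*t)*S := by nlinarith
      exact le_of_mul_le_mul_right this hSr
    · have : (j:ℝ)*t*S < (((j*a/S : ℕ):ℝ) + 1 + j/100)*S := by nlinarith
      exact lt_of_mul_lt_mul_right this hSr.le
  rcases Nat.lt_or_ge q 4 with h4 | h4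
  · obtain rfl | rfl | rfl : q = 1 ∨ q = 2 ∨ q = 3 := by omega
    · obtain ⟨g1, g2⟩ := hfl 1
      simp only [one_mul, Nat.cast_one, mul_one] at g1 g2 l1 l2
      refine brute_sound M N 1 9 _ p c3 ?_ ?_
      · have : ((a/S : ℕ):ℝ) < (p:ℝ)+5 := by linarith
        have : (a/S) < p+5 := by exact_mod_cast this
        omega
      · have : (p:ℝ) < ((a/S : ℕ):ℝ)+4 := by linarith
        have : p < a/S+4 := by exact_mod_cast this
        omega
    · obtain ⟨g1, g2⟩ := hfl 2
      have := l3 (by norm_num)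
      push_cast at g1 g2 this
      rw [abs_le] at this
      refine brute_sound M N 2 5 _ p c4 ?_ ?_
      · have : ((2*a/S : ℕ):ℝ) < (p:ℝ)+3 := by linarith
        have : (2*a/S) < p+3 := by exact_mod_cast this
        omega
      · have : (p:ℝ) < ((2*a/S : ℕ):ℝ)+3 := by linarith
        have : p < 2*a/S+3 := by exact_mod_cast this
        omega
    · obtain ⟨g1, g2⟩ := hfl 3
      have := l3 (by norm_num)
      push_cast at g1 g2 this
      rw [abs_le] at this
      refine brute_sound M N 3 5 _ p c5 ?_ ?_
      · have : ((3*a/S : ℕ):ℝ) < (p:ℝ)+3 := by linarith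
        have : (3*a/S) < p+3 := by exact_mod_cast this
        omega
      · have : (p:ℝ) < ((3*a/S : ℕ):ℝ)+3 := by linarith
        have : p < 3*a/S+3 := by exact_mod_cast this
        omega
  · refine cfLoop_sound M N S B a p q hco hqB h4 hS0 ?_ 150 S (a%S) 1 0 (a/S) 1 1 (by norm_num)
      (by push_cast; ring) ?_ (by push_cast; ring) (by omega) c6
    · have h5 := l4 h4
      have h6 : (10*(q:ℝ)^2*|(p:ℝ)*S-q*a|) ≤ 19*S := by
        have e1 : (p:ℝ)*S-q*a = S*(p-q*t) + q*(S*t-a) := by ring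
        have e2 : |(p:ℝ)*S-q*a| ≤ S*|(p:ℝ)-q*t| + q*4 := by
          rw [e1]
          refine (abs_add_le _ _).trans ?_
          rw [abs_mul, abs_mul, abs_of_pos hSr, abs_of_pos hqr]
          have : |(S:ℝ)*t-a| ≤ 4 := by rw [abs_le]; constructor <;> linarith
          gcongr
        have e3 : 400*(q:ℝ)^3 ≤ S := by
          have : 400*q^3 ≤ S := le_trans (by gcongr) hS
          exact_mod_cast this
        calc 10*(q:ℝ)^2*|(p:ℝ)*S-q*a| ≤ 10*(q:ℝ)^2*(S*|(p:ℝ)-q*t| + q*4) := by gcongr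
          _ = 10*S*(q^2*|(p:ℝ)-q*t|) + 40*q^3 := by ring
          _ ≤ 10*S*(37/20) + 40*q^3 := by gcongr
          _ ≤ _ := by linarith
      exact_mod_cast h6
    · have := Nat.div_add_mod a S
      have h7 : ((S*(a/S)+a%S : ℕ):ℤ) = a := by exact_mod_cast this
      push_cast at h7 ⊢
      linarith
end SC


namespace SC
set_option maxRecDepth 100000
theorem cfr_small : ((List.range 4).all fun j => cfRange (2^168) (2^52) (250*j) 250) = true := by decide +kernel
theorem cfr_4 : cfRange (2^276) (2^88) (250*4) 250 = true := by decide +kernel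
theorem cfr_5 : cfRange (2^276) (2^88) (250*5) 250 = true := by decide +kernel
theorem cfr_6 : cfRange (2^276) (2^88) (250*6) 250 = true := by decide +kernel
theorem cfr_7 : cfRange (2^276) (2^88) (250*7) 250 = true := by decide +kernel
theorem cfr_8 : cfRange (2^276) (2^88) (250*8) 250 = true := by decide +kernel
theorem cfr_9 : cfRange (2^276) (2^88) (250*9) 250 = true := by decide +kernel
theorem cfr_10 : cfRange (2^276) (2^88) (250*10) 250 = true := by decide +kernel
theorem cfr_11 : cfRange (2^276) (2^88) (250*11) 250 = true := by decide +kernel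
theorem cfr_12 : cfRange (2^276) (2^88) (250*12) 250 = true := by decide +kernel
theorem cfr_13 : cfRange (2^276) (2^88) (250*13) 250 = true := by decide +kernel
theorem cfr_14 : cfRange (2^276) (2^88) (250*14) 250 = true := by decide +kernel
theorem cfr_15 : cfRange (2^276) (2^88) (250*15) 250 = true := by decide +kernel
theorem cfr_16 : cfRange (2^276) (2^88) (250*16) 250 = true := by decide +kernel
theorem cfr_17 : cfRange (2^276) (2^88) (250*17) 250 = true := by decide +kernel
theorem cfr_18 : cfRange (2^276) (2^88) (250*18) 250 = true := by decide +kernel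
theorem cfr_19 : cfRange (2^276) (2^88) (250*19) 250 = true := by decide +kernel
theorem cfr_20 : cfRange (2^276) (2^88) (250*20) 250 = true := by decide +kernel
theorem cfr_21 : cfRange (2^276) (2^88) (250*21) 250 = true := by decide +kernel
theorem cfr_22 : cfRange (2^276) (2^88) (250*22) 250 = true := by decide +kernel
theorem cfr_23 : cfRange (2^276) (2^88) (250*23) 250 = true := by decide +kernel
theorem cfr_24 : cfRange (2^276) (2^88) (250*24) 250 = true := by decide +kernel
theorem cfr_25 : cfRange (2^276) (2^88) (250*25) 250 = true := by decide +kernel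
end SC


namespace SC

def ser (W S : ℕ) (fuel : ℕ) : ℕ → ℕ → ℕ → ℕ :=
  Nat.rec (fun _ _ acc => acc)
    (fun _ ih k p acc => force (acc + p/k) fun acc' => force (p*W/S) fun p' => force (k+2) fun k' =>
      ih k' p' acc') fuel

/-- lower approximation of `S * log (x / (2^k S))`, times 1/2 -/
def lnz (S n x v : ℕ) : ℕ :=
  force ((x-v)*S/(x+v)) fun z => force (z*z/S) fun W => ser W S n 1 z 0

theorem ser_succ (W S fuel k p acc : ℕ) : ser W S (fuel+1) k p acc = ser W S fuel (k+2) (p*W/S) (acc+p/k) := by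
  have e : ser W S (fuel+1) k p acc = force (acc + p/k) fun acc' => force (p*W/S) fun p' => force (k+2) fun k' =>
      ser W S fuel k' p' acc' := rfl
  rw [e]; simp only [force_eq]

theorem ser_bound (W S : ℕ) (y : ℝ) (hS : 0 < S) (hy0 : 0 ≤ y) (hy : y ≤ 1/3) (hW1 : (W:ℝ) ≤ S*y^2)
    (hW2 : (S:ℝ)*y^2 - 1 ≤ W) : ∀ (fuel i p acc : ℕ), (p:ℝ) ≤ S*y^(2*i+1) → (S:ℝ)*y^(2*i+1) - 2 ≤ p →
    ((ser W S fuel (2*i+1) p acc : ℕ):ℝ) ≤ acc + ∑ j ∈ Finset.range fuel, S*(y^(2*(i+j)+1)/(2*(i+j)+1)) ∧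
    (acc:ℝ) + ∑ j ∈ Finset.range fuel, S*(y^(2*(i+j)+1)/(2*(i+j)+1)) - 3*fuel ≤ (ser W S fuel (2*i+1) p acc : ℕ) := by
  intro fuel
  have hSr : (0:ℝ) < S := by exact_mod_cast hS
  induction fuel with
  | zero => intro i p acc h1 h2; simp [ser]
  | succ n ih =>
    intro i p acc h1 h2
    rw [ser_succ]
    have hy1 : y ≤ 1 := by linarith
    have hyp : y^(2*i+1) ≤ 1/3 := by
      calc y^(2*i+1) ≤ y^1 := pow_le_pow_of_le_one hy0 hy1 (by omega)
        _ ≤ _ := by linarith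
    have hypn : 0 ≤ y^(2*i+1) := by positivity
    have hy2 : y^2 ≤ 1/9 := by nlinarith
    have hfl : ((p*W/S : ℕ):ℝ)*S ≤ p*W ∧ (p:ℝ)*W ≤ (((p*W/S : ℕ):ℝ)+1)*S := by
      constructor
      · exact_mod_cast Nat.div_mul_le_self _ _
      · have := Nat.lt_div_mul_add (a := p*W) hS
        have : p*W ≤ (p*W/S+1)*S := by linarith
        exact_mod_cast this
    have hp0 : (0:ℝ) ≤ p := by positivity
    have hW0 : (0:ℝ) ≤ W := by positivity
    have e0 : (S:ℝ)*y^(2*(i+1)+1) = (S*y^(2*i+1))*y^2 := by ring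
    obtain ⟨Y, hY⟩ : ∃ Y, Y = y^(2*i+1) := ⟨_, rfl⟩
    rw [← hY] at h1 h2 e0 hyp hypn
    have g1 : ((p*W/S : ℕ):ℝ) ≤ S*y^(2*(i+1)+1) := by
      rw [e0]
      have : (p:ℝ)*W ≤ (S*Y)*(S*y^2) := mul_le_mul h1 hW1 hW0 (by positivity)
      have : ((p*W/S : ℕ):ℝ)*S ≤ (S*Y*y^2)*S := by linarith [hfl.1]
      exact le_of_mul_le_mul_right this hSr
    have g2 : (S:ℝ)*y^(2*(i+1)+1) - 2 ≤ ((p*W/S : ℕ):ℝ) := by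
      rw [e0]
      have a1 : (S*Y-2)*W ≤ p*(W:ℝ) := mul_le_mul_of_nonneg_right h2 hW0
      have a2 : (S*Y)*(S*y^2-1) ≤ (S*Y)*W := mul_le_mul_of_nonneg_left hW2 (by positivity)
      have a3 : (W:ℝ) ≤ S*(1/9) := hW1.trans (mul_le_mul_of_nonneg_left hy2 hSr.le)
      have a4 : (S:ℝ)*Y ≤ S*(1/3) := mul_le_mul_of_nonneg_left hyp hSr.le
      have : (S*Y*y^2-2)*S ≤ ((p*W/S : ℕ):ℝ)*S := by linarith [hfl.2]
      exact le_of_mul_le_mul_right this hSr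
    have hfk : ((p/(2*i+1) : ℕ):ℝ) ≤ S*(y^(2*i+1)/(2*i+1)) ∧ S*(y^(2*i+1)/(2*i+1)) - 3 ≤ ((p/(2*i+1) : ℕ):ℝ) := by
      have hk : (0:ℝ) < 2*i+1 := by positivity
      have hk1 : (1:ℝ) ≤ 2*i+1 := by
        have : (0:ℝ) ≤ i := by positivity
        linarith
      rw [← hY, ← mul_div_assoc]
      constructor
      · rw [le_div_iff₀ hk]
        have : ((p/(2*i+1) : ℕ):ℝ)*(2*i+1) ≤ p := by exact_mod_cast Nat.div_mul_le_self _ _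
        linarith
      · have : p < (p/(2*i+1)+1)*(2*i+1) := by
          have := Nat.lt_div_mul_add (a := p) (b := 2*i+1) (by omega)
          linarith
        have h5 : (p:ℝ) ≤ (((p/(2*i+1) : ℕ):ℝ)+1)*(2*i+1) := by exact_mod_cast this.le
        have : S*Y/(2*i+1) ≤ ((p/(2*i+1) : ℕ):ℝ)+3 := by
          rw [div_le_iff₀ hk]
          nlinarith
        linarith
    obtain ⟨b1, b2⟩ := ih (i+1) (p*W/S) (acc + p/(2*i+1)) g1 g2
    rw [show 2*(i+1)+1 = 2*i+1+2 from by ring] at b1 b2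
    have hsum : ∑ j ∈ Finset.range (n+1), (S:ℝ)*(y^(2*(i+j)+1)/(2*(i+j)+1)) =
        S*(y^(2*i+1)/(2*i+1)) + ∑ j ∈ Finset.range n, (S:ℝ)*(y^(2*(i+1+j)+1)/(2*((i+1:ℕ)+j)+1)) := by
      rw [Finset.sum_range_succ', add_comm]
      congr 1
      · simp
      · apply Finset.sum_congr rfl
        intro j _
        rw [show i+(j+1) = i+1+j from by ring]
        congr 2
        push_cast; ring
    rw [hsum]
    push_cast at b1 b2 ⊢
    constructor <;> linarith [hfk.1, hfk.2]

theorem lnz_bound (S n x v : ℕ) (hS : 6 ≤ S) (hv : 0 < v) (hvx : v ≤ x) (hz : 3*((x-v)*S/(x+v)) ≤ S)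
    (hn : S ≤ 3^(2*n)) :
    2*(lnz S n x v : ℝ) ≤ S*Real.log ((x:ℝ)/v) ∧ S*Real.log ((x:ℝ)/v) ≤ 2*(lnz S n x v : ℝ) + (6*n+6) := by
  have hS0 : 0 < S := by omega
  have hSr : (0:ℝ) < S := by exact_mod_cast hS0
  have hS6 : (6:ℝ) ≤ S := by exact_mod_cast hS
  unfold lnz
  simp only [force_eq]
  set Z := (x-v)*S/(x+v) with hZ
  set W := Z*Z/S with hW
  set y : ℝ := (Z:ℝ)/S with hy
  have hyS : S*y = Z := by rw [hy]; field_simp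
  have hy0 : 0 ≤ y := by positivity
  have hy3 : y ≤ 1/3 := by
    rw [hy, div_le_iff₀ hSr]
    have : (3:ℝ)*Z ≤ S := by exact_mod_cast hz
    linarith
  have hWa : (W:ℝ) ≤ S*y^2 := by
    have : (W:ℝ)*S ≤ Z*Z := by exact_mod_cast Nat.div_mul_le_self _ _
    have : (W:ℝ)*S ≤ (S*y^2)*S := by rw [← hyS] at this; linarith
    exact le_of_mul_le_mul_right this hSr
  have hWb : (S:ℝ)*y^2 - 1 ≤ W := by
    have := Nat.lt_div_mul_add (a := Z*Z) hS0
    rw [← hW] at this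
    have h5 : Z*Z ≤ (W+1)*S := by linarith
    have h6 : (Z:ℝ)*Z ≤ (W+1)*S := by exact_mod_cast h5
    have : (S*y^2)*S ≤ (W+1)*S := by rw [← hyS] at h6; linarith
    have := le_of_mul_le_mul_right this hSr
    linarith
  obtain ⟨s1, s2⟩ := ser_bound W S y hS0 hy0 hy3 hWa hWb n 0 Z 0 (by simp [hyS]) (by simp [hyS])
  simp only [mul_zero, zero_add, Nat.cast_zero] at s1 s2
  set R := ser W S n 1 Z 0
  -- series
  have hser := Real.hasSum_log_sub_log_of_abs_lt_one (x := y) (by rw [abs_of_nonneg hy0]; linarith)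
  have hpart : ∑ j ∈ Finset.range n, (S:ℝ)*(y^(2*j+1)/(2*j+1)) =
      S/2*(∑ j ∈ Finset.range n, (2:ℝ)*(1/(2*j+1))*y^(2*j+1)) := by
    rw [Finset.mul_sum]
    apply Finset.sum_congr rfl
    intro j _; ring
  rw [hpart] at s1 s2
  have t1 : (∑ j ∈ Finset.range n, (2:ℝ)*(1/(2*j+1))*y^(2*j+1)) ≤ Real.log (1+y) - Real.log (1-y) :=
    sum_le_hasSum _ (fun i _ => by positivity) hser
  have t2 : Real.log (1+y) - Real.log (1-y) - (∑ j ∈ Finset.range n, (2:ℝ)*(1/(2*j+1))*y^(2*j+1)) ≤ 1/S := by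
    have hd := (hasSum_nat_add_iff' n).mpr hser
    have hg := (hasSum_geometric_of_lt_one (r := (1/9:ℝ)) (by norm_num) (by norm_num)).mul_left (2*(1/3:ℝ)^(2*n+1))
    have hle := hasSum_le (fun j => ?_) hd hg
    · refine hle.trans ?_
      have : (3:ℝ)^(2*n) ≥ S := by exact_mod_cast hn
      rw [pow_succ, one_div, inv_pow]
      have h3 : ((3:ℝ)^(2*n))⁻¹ ≤ (S:ℝ)⁻¹ := inv_anti₀ hSr this
      have : (0:ℝ) < (S:ℝ)⁻¹ := by positivity
      rw [one_div]
      norm_num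
      linarith
    · have e1 : y^(2*(j+n)+1) ≤ (1/3)^(2*(j+n)+1) := by gcongr
      have e2 : (1/3:ℝ)^(2*(j+n)+1) = (1/3)^(2*n+1)*(1/9)^j := by
        rw [show (1/9:ℝ) = (1/3)^2 by norm_num, ← pow_mul, ← pow_add]; congr 1; ring
      have e3 : (1:ℝ)/(2*((j+n:ℕ):ℝ)+1) ≤ 1 := by
        rw [div_le_one (by positivity)]
        have : (0:ℝ) ≤ ((j+n:ℕ):ℝ) := by positivity
        linarith
      have e4 : (0:ℝ) ≤ y^(2*(j+n)+1) := by positivity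
      calc (2:ℝ)*(1/(2*((j+n:ℕ):ℝ)+1))*y^(2*(j+n)+1) ≤ 2*1*y^(2*(j+n)+1) := by gcongr
        _ ≤ 2*1*(1/3)^(2*(j+n)+1) := by gcongr
        _ = _ := by rw [e2]; ring
  -- compare with true log
  have hvr : (0:ℝ) < v := by exact_mod_cast hv
  have hvxr : (v:ℝ) ≤ x := by exact_mod_cast hvx
  have hxr : (0:ℝ) < x := by linarith
  set z : ℝ := ((x:ℝ)-v)/(x+v) with hzdef
  have hxv : (0:ℝ) < (x:ℝ)+v := by linarith
  have hzx : z*(x+v) = x - v := by rw [hzdef]; field_simp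
  have hc1 : (Z:ℝ)*(x+v) ≤ (x-v)*S := by
    have := Nat.div_mul_le_self ((x-v)*S) (x+v)
    have h7 : (((Z*(x+v) : ℕ)):ℝ) ≤ (((x-v)*S : ℕ):ℝ) := by exact_mod_cast this
    push_cast [Nat.cast_sub hvx] at h7
    exact h7
  have hc2 : (x-v)*S ≤ ((Z:ℝ)+1)*(x+v) := by
    have := Nat.lt_div_mul_add (a := (x-v)*S) (b := x+v) (by omega)
    rw [← hZ] at this
    have h6 : (x-v)*S ≤ (Z+1)*(x+v) := by linarith
    have h7 : (((x-v)*S : ℕ):ℝ) ≤ (((Z+1)*(x+v) : ℕ):ℝ) := by exact_mod_cast h6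
    push_cast [Nat.cast_sub hvx] at h7
    exact h7
  have hyz : y ≤ z := by
    rw [hy, hzdef, div_le_div_iff₀ hSr hxv]; exact hc1
  have hzy : z ≤ y + 1/S := by
    have : y + 1/S = ((Z:ℝ)+1)/S := by rw [hy]; field_simp
    rw [this, hzdef, div_le_div_iff₀ hxv hSr]; exact hc2
  have hS6' : 1/(S:ℝ) ≤ 1/6 := by
    apply div_le_div_of_nonneg_left (by norm_num) (by norm_num) hS6
  have hz2 : z ≤ 1/2 := by linarith
  have hlog : Real.log ((x:ℝ)/v) = Real.log (1+z) - Real.log (1-z) := by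
    rw [← Real.log_div (by linarith) (by linarith)]
    congr 1
    have h1 : (1:ℝ) - z ≠ 0 := by linarith
    rw [div_eq_div_iff hvr.ne' h1]
    linear_combination -hzx
  have u1 : Real.log (1+y) ≤ Real.log (1+z) := Real.log_le_log (by linarith) (by linarith)
  have u2 : Real.log (1-z) ≤ Real.log (1-y) := Real.log_le_log (by linarith) (by linarith)
  have u3 : Real.log (1+z) - Real.log (1+y) ≤ 1/S := by
    rw [← Real.log_div (by linarith) (by linarith)]
    refine (Real.log_le_sub_one_of_pos (by apply div_pos <;> linarith)).trans ?_
    have : (1+z)/(1+y) - 1 = (z-y)/(1+y) := by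
      have : (1:ℝ)+y ≠ 0 := by linarith
      field_simp; ring
    rw [this]
    calc (z-y)/(1+y) ≤ (z-y)/1 := by
          apply div_le_div_of_nonneg_left <;> linarith
      _ ≤ _ := by linarith
  have u4 : Real.log (1-y) - Real.log (1-z) ≤ 2*(1/S) := by
    rw [← Real.log_div (by linarith) (by linarith)]
    refine (Real.log_le_sub_one_of_pos (by apply div_pos <;> linarith)).trans ?_
    have : (1-y)/(1-z) - 1 = (z-y)/(1-z) := by
      have : (1:ℝ)-z ≠ 0 := by linarith
      field_simp; ring
    rw [this]
    calc (z-y)/(1-z) ≤ (z-y)/(1/2) := by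
          apply div_le_div_of_nonneg_left <;> linarith
      _ ≤ _ := by linarith
  rw [hlog]
  set P := (∑ j ∈ Finset.range n, (2:ℝ)*(1/(2*j+1))*y^(2*j+1))
  have hSi : (S:ℝ)*(1/S) = 1 := by field_simp
  obtain ⟨Q, hQ⟩ : ∃ Q, Q = Real.log (1+z) - Real.log (1-z) := ⟨_, rfl⟩
  rw [← hQ]
  have v1 : P ≤ Q := by linarith
  have v2 : Q ≤ P + 4*(1/S) := by linarith
  have w1 : S*P ≤ S*Q := by gcongr
  have w2 : S*Q ≤ S*(P+4*(1/S)) := by gcongr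
  constructor
  · linarith
  · have : S*(P+4*(1/(S:ℝ))) = S*P + 4 := by rw [mul_add]; linarith
    linarith
end SC


namespace SC

def redLoop (Q R : ℕ) (fuel : ℕ) : ℕ → ℕ → ℕ → ℕ → Bool :=
  Nat.rec (fun _ _ _ _ => false)
    (fun _ ih r0 r1 q0 q1 =>
      bif Nat.ble (Q+1) q1 then Nat.ble R r0 else
        force (r0/r1) fun A => force (r0 - A*r1) fun r2 =>
        force (q0 + A*q1) fun q2 => ih r1 r2 q1 q2) fuel

def lnx (S n l2 x k : ℕ) : ℕ := force (2^k*S) fun v => k*l2 + 2*lnz S n x v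
def lnchk (S x k : ℕ) : Bool :=
  force (2^k*S) fun v => Nat.ble v x && (Nat.ble (3*((x-v)*S/(x+v))) S && Nat.ble k 10)

def redM (S n Q R l2 M : ℕ) : Bool :=
  force (newton M S 12 ((M+2)*S) - 2) fun a =>
  force (Nat.log2 (a/S)) fun k => force (Nat.log2 (a/S+1)) fun k' => force (a+S) fun a' =>
  cubLo M S a && (cubHi M S (a+4) && (lnchk S a k && (lnchk S a' k' && (
    force (lnx S n l2 a k) fun x => force (lnx S n l2 a' k') fun y => redLoop Q R 150 y x 0 1))))

def redRange (S n Q R M0 : ℕ) (cnt : ℕ) : Bool :=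
  force (2*lnz S n (2*S) S) fun l2 =>
  Nat.rec true (fun i ih => redM S n Q R l2 (M0+i) && ih) cnt
end SC


namespace SC
set_option maxRecDepth 100000
theorem redr_0 : redRange (2^256) 82 (10^32) (2^131) 0 250 = true := by decide +kernel
theorem redr_1 : redRange (2^256) 82 (10^32) (2^131) 250 250 = true := by decide +kernel
theorem redr_2 : redRange (2^256) 82 (10^32) (2^131) 500 250 = true := by decide +kernel
theorem redr_3 : redRange (2^256) 82 (10^32) (2^131) 750 251 = true := by decide +kernel
end SC


namespace SC

theorem redLoop_succ (Q R fuel r0 r1 q0 q1 : ℕ) : redLoop Q R (fuel+1) r0 r1 q0 q1 =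
    (bif Nat.ble (Q+1) q1 then Nat.ble R r0 else
      redLoop Q R fuel r1 (r0 - r0/r1*r1) q1 (q0 + r0/r1*q1)) := by
  have e : redLoop Q R (fuel+1) r0 r1 q0 q1 = (bif Nat.ble (Q+1) q1 then Nat.ble R r0 else
        force (r0/r1) fun A => force (r0 - A*r1) fun r2 =>
        force (q0 + A*q1) fun q2 => redLoop Q R fuel r1 r2 q1 q2) := rfl
  rw [e]; simp only [force_eq]

theorem redLoop_sound (Q R a b : ℕ) (X Z : ℤ) (hX : 0 < X) (hXQ : X ≤ Q) :
    ∀ (fuel r0 r1 q0 q1 : ℕ) (p0 p1 s : ℤ),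
    (s*s = 1) → (p0*b-q0*a = s*r0) → (p1*b-q1*a = -s*r1) →
    (p0*q1-p1*q0 = s) → redLoop Q R fuel r0 r1 q0 q1 = true → (R:ℤ) ≤ |Z*b-X*a| := by
  intro fuel
  induction fuel with
  | zero => intro r0 r1 q0 q1 p0 p1 s _ _ _ _ h; exact absurd h (by simp [redLoop])
  | succ k ih =>
    intro r0 r1 q0 q1 p0 p1 s hss h0 h1 hdet h
    rw [redLoop_succ] at h
    by_cases hlt : Q + 1 ≤ q1
    · rw [Nat.ble_eq_true_of_le hlt, cond_true] at h
      have hR := Nat.le_of_ble_eq_true h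
      have := (best_approx Z X a b r0 r1 p0 q0 p1 q1 s hss h0 h1 hdet (by positivity)
        (by positivity) (by positivity) hX (by omega)).1
      have : (R:ℤ) ≤ r0 := by exact_mod_cast hR
      linarith
    · have hnb : Nat.ble (Q+1) q1 = false := by
        rw [Bool.eq_false_iff]; intro hc
        exact hlt (Nat.le_of_ble_eq_true hc)
      rw [hnb, cond_false] at h
      have hle : r0/r1*r1 ≤ r0 := Nat.div_mul_le_self r0 r1
      refine ih r1 (r0 - r0/r1*r1) q1 (q0 + r0/r1*q1) p1 (p0+(r0/r1:ℕ)*p1) (-s) ?_ ?_ ?_ ?_ h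
      · linarith
      · exact h1
      · push_cast [Nat.cast_sub hle]
        linear_combination h0 + (r0/r1 : ℤ)*h1
      · push_cast
        linear_combination -hdet

theorem lnx_bound (S n l2 x k : ℕ) (hS : 6 ≤ S) (hn : S ≤ 3^(2*n))
    (hl1 : (l2:ℝ) ≤ S*Real.log 2) (hl2 : S*Real.log 2 ≤ l2 + (6*n+6)) (hc : lnchk S x k = true) :
    (lnx S n l2 x k : ℝ) ≤ S*Real.log ((x:ℝ)/S) ∧
      S*Real.log ((x:ℝ)/S) ≤ (lnx S n l2 x k : ℝ) + 11*(6*n+6) := by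
  unfold lnchk at hc
  simp only [force_eq, Bool.and_eq_true] at hc
  obtain ⟨c1, c2, c3⟩ := hc
  have c1 := Nat.le_of_ble_eq_true c1
  have c2 := Nat.le_of_ble_eq_true c2
  have c3 := Nat.le_of_ble_eq_true c3
  have hv : 0 < 2^k*S := by positivity
  obtain ⟨b1, b2⟩ := lnz_bound S n x (2^k*S) hS hv c1 c2 hn
  unfold lnx
  simp only [force_eq]
  have hSr : (0:ℝ) < S := by exact_mod_cast (by omega : 0 < S)
  have hx : (0:ℝ) < x := by exact_mod_cast (by omega : 0 < x)
  have e : Real.log ((x:ℝ)/S) = k*Real.log 2 + Real.log ((x:ℝ)/((2^k*S : ℕ):ℝ)) := by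
    rw [← Real.log_pow, ← Real.log_mul (by positivity) (by positivity)]
    congr 1; push_cast; field_simp
  rw [e]
  push_cast at b1 b2 ⊢
  have hk0 : (0:ℝ) ≤ k := by positivity
  have hk : (k:ℝ) ≤ 10 := by exact_mod_cast c3
  have e1 : (k:ℝ)*l2 ≤ k*(S*Real.log 2) := by gcongr
  have e2 : (k:ℝ)*(S*Real.log 2) ≤ k*(l2 + (6*n+6)) := by gcongr
  have e3 : (k:ℝ)*(6*n+6) ≤ 10*(6*n+6) := by gcongr
  constructor <;> linarith

theorem newton_sandwich (S M : ℕ) (a : ℕ) (hS0 : 0 < S) (m : ℤ) (hm : m + 1 = M) (t : ℝ) (ht0 : 0 < t)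
    (hf : fR m t = 0) (c1 : cubLo M S a = true) (c2 : cubHi M S (a+4) = true) :
    (a:ℝ) ≤ S*t ∧ S*t ≤ (a:ℝ)+4 := by
  have hSr : (0:ℝ) < S := by exact_mod_cast hS0
  have hmr : (m:ℝ) = M - 1 := by
    have : ((m+1 : ℤ):ℝ) = ((M:ℤ):ℝ) := by rw [hm]
    push_cast at this; linarith
  have fRx : ∀ x : ℕ, (S:ℝ)^3 * fR m ((x:ℝ)/S) = (x*x*(x+S) : ℕ) - (S*(M*x*x+(M+2)*x*S+S*S) : ℕ) := by
    intro x
    unfold fR; rw [hmr]; push_cast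
    field_simp; ring
  constructor
  · have h1 := Nat.le_of_ble_eq_true c1
    have h1' : ((a*a*(a+S) : ℕ):ℝ) ≤ ((S*(M*a*a+(M+2)*a*S+S*S) : ℕ):ℝ) := by exact_mod_cast h1
    by_contra hcon
    push Not at hcon
    have h2 : t < (a:ℝ)/S := by rw [lt_div_iff₀ hSr]; linarith
    have h3 : fR m ((a:ℝ)/S) ≤ 0 := by
      by_contra h; push Not at h
      have : 0 < (S:ℝ)^3 * fR m ((a:ℝ)/S) := by positivity
      rw [fRx] at this; linarith
    have h4 : 0 < fR m ((a:ℝ)/S) := by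
      rw [fR_fac ht0 hf]
      have : 0 < (a:ℝ)/S - t := by linarith
      positivity
    linarith
  · have h1 := Nat.le_of_ble_eq_true c2
    have h2 : ((S*(M*(a+4)*(a+4)+(M+2)*(a+4)*S+S*S) : ℕ):ℝ) ≤ (((a+4)*(a+4)*(a+4+S) : ℕ):ℝ) := by
      exact_mod_cast h1
    have h3 : 0 ≤ fR m (((a+4:ℕ):ℝ)/S) := by
      by_contra h; push Not at h
      have : (S:ℝ)^3 * fR m (((a+4:ℕ):ℝ)/S) < 0 := mul_neg_of_pos_of_neg (by positivity) h
      rw [fRx] at this; linarith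
    have := (fR_pos_iff ht0 hf (by positivity)).mp h3
    rw [le_div_iff₀ hSr] at this
    push_cast at this; linarith

theorem log_close (S a : ℕ) (t : ℝ) (hS : 0 < S) (haS : S ≤ a) (h1 : (a:ℝ) ≤ S*t) (h2 : S*t ≤ a+4) :
    S*Real.log ((a:ℝ)/S) ≤ S*Real.log t ∧ S*Real.log t ≤ S*Real.log ((a:ℝ)/S) + 4 := by
  have hSr : (0:ℝ) < S := by exact_mod_cast hS
  have haSr : (S:ℝ) ≤ a := by exact_mod_cast haS
  have ha : (0:ℝ) < a := by linarith
  have h3 : (a:ℝ)/S ≤ t := by rw [div_le_iff₀ hSr]; linarith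
  have hp : (0:ℝ) < (a:ℝ)/S := by positivity
  have ht : 0 < t := by linarith
  constructor
  · gcongr
  · have : Real.log t - Real.log ((a:ℝ)/S) ≤ 4/S := by
      rw [← Real.log_div ht.ne' hp.ne']
      refine (Real.log_le_sub_one_of_pos (by positivity)).trans ?_
      have e : t/((a:ℝ)/S) - 1 = (S*t - a)/a := by field_simp
      rw [e]
      calc (S*t-a)/a ≤ 4/a := by gcongr; linarith
        _ ≤ 4/S := by gcongr
    have h5 : S*(Real.log t - Real.log ((a:ℝ)/S)) ≤ S*(4/S) := by gcongr
    have h6 : (S:ℝ)*(4/S) = 4 := by field_simp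
    linarith

theorem red_main (S n Q R l2 M : ℕ) (hS : 6 ≤ S) (hn : S ≤ 3^(2*n))
    (hl1 : (l2:ℝ) ≤ S*Real.log 2) (hl2 : S*Real.log 2 ≤ l2 + (6*n+6))
    (hr : redM S n Q R l2 M = true) (m : ℤ) (hm : m + 1 = M) (t : ℝ) (ht0 : 0 < t)
    (hf : fR m t = 0) (X Z : ℕ) (hX : 0 < X) (hXQ : X ≤ Q) (hZX : Z ≤ X) :
    (R:ℝ) - Q*(11*(6*n+6)+4) ≤ S*|X*Real.log t - Z*Real.log (1+t)| := by
  have hS0 : 0 < S := by omega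
  have hSr : (0:ℝ) < S := by exact_mod_cast hS0
  unfold redM at hr
  simp only [force_eq] at hr
  set a := newton M S 12 ((M+2)*S) - 2 with ha
  clear_value a
  simp only [Bool.and_eq_true] at hr
  set k := Nat.log2 (a/S)
  set k' := Nat.log2 (a/S+1)
  clear_value k k'
  obtain ⟨c1, c2, c3, c4, c5⟩ := hr
  obtain ⟨s1, s2⟩ := newton_sandwich S M a hS0 m hm t ht0 hf c1 c2
  have haS : S ≤ a := by
    unfold lnchk at c3
    simp only [force_eq, Bool.and_eq_true] at c3
    have := Nat.le_of_ble_eq_true c3.1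
    exact (Nat.le_mul_of_pos_left S (by positivity)).trans this
  obtain ⟨u1, u2⟩ := log_close S a t hS0 haS s1 s2
  obtain ⟨v1, v2⟩ := log_close S (a+S) (1+t) hS0 (by omega) (by push_cast; linarith) (by push_cast; linarith)
  obtain ⟨x1, x2⟩ := lnx_bound S n l2 a k hS hn hl1 hl2 c3
  obtain ⟨y1, y2⟩ := lnx_bound S n l2 (a+S) k' hS hn hl1 hl2 c4
  set x := lnx S n l2 a k
  set y := lnx S n l2 (a+S) k'
  clear_value x y
  have hb := redLoop_sound Q R x y X Z (by exact_mod_cast hX) (by exact_mod_cast hXQ) 150 y x 0 1 1 0 1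
    (by norm_num) (by simp) (by simp) (by simp) c5
  have hbR : (R:ℝ) ≤ |(Z:ℝ)*y-X*x| := by exact_mod_cast hb
  obtain ⟨A, hA⟩ : ∃ A, A = Real.log t := ⟨_, rfl⟩
  obtain ⟨C, hC⟩ : ∃ C, C = Real.log (1+t) := ⟨_, rfl⟩
  rw [← hA] at u1 u2 ⊢
  rw [← hC] at v1 v2 ⊢
  obtain ⟨E, hE⟩ : ∃ E : ℝ, E = 11*(6*n+6)+4 := ⟨_, rfl⟩
  have hE0 : 0 ≤ E := by rw [hE]; positivity
  rw [← hE]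
  have f1 : 0 ≤ S*A - x := by linarith
  have f2 : S*A - x ≤ E := by linarith
  have g1 : 0 ≤ S*C - y := by linarith
  have g2 : S*C - y ≤ E := by linarith
  have hXr : (0:ℝ) ≤ X := by positivity
  have hZr : (0:ℝ) ≤ Z := by positivity
  have hXQr : (X:ℝ) ≤ Q := by exact_mod_cast hXQ
  have hZXr : (Z:ℝ) ≤ X := by exact_mod_cast hZX
  have k1 : (X:ℝ)*(S*A-x) ≤ Q*E := mul_le_mul hXQr f2 f1 (by linarith)
  have k2 : (Z:ℝ)*(S*C-y) ≤ Q*E := mul_le_mul (by linarith) g2 g1 (by linarith)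
  have k3 : 0 ≤ (X:ℝ)*(S*A-x) := by positivity
  have k4 : 0 ≤ (Z:ℝ)*(S*C-y) := by positivity
  have hfin : |(Z:ℝ)*y-X*x| ≤ |S*(X*A-Z*C)| + Q*E := by
    have e : (Z:ℝ)*y-X*x = -(S*(X*A-Z*C)) + (X*(S*A-x) - Z*(S*C-y)) := by ring
    rw [e]
    refine (abs_add_le _ _).trans ?_
    rw [abs_neg]
    have : |(X:ℝ)*(S*A-x) - Z*(S*C-y)| ≤ Q*E := by rw [abs_le]; constructor <;> linarith
    linarith
  rw [abs_mul, abs_of_pos hSr] at hfin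
  linarith

theorem redRange_sound (S n Q R M0 : ℕ) : ∀ cnt, redRange S n Q R M0 cnt = true → ∀ i < cnt,
    redM S n Q R (2*lnz S n (2*S) S) (M0+i) = true := by
  intro cnt
  have e0 : ∀ c, redRange S n Q R M0 c = (Nat.rec true (fun i ih => redM S n Q R (2*lnz S n (2*S) S) (M0+i) && ih) c : Bool) := by
    intro c; unfold redRange; rw [force_eq]
  induction cnt with
  | zero => intro _ i hi; omega
  | succ k ih =>
    intro h i hi
    have e : redRange S n Q R M0 (k+1) = (redM S n Q R (2*lnz S n (2*S) S) (M0+k) && redRange S n Q R M0 k) := by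
      rw [e0, e0]
    rw [e, Bool.and_eq_true] at h
    rcases Nat.lt_succ_iff_lt_or_eq.mp hi with h1 | rfl
    · exact ih h.2 i h1
    · exact h.1

theorem l2_bound (S n : ℕ) (hS : 6 ≤ S) (hn : S ≤ 3^(2*n)) :
    ((2*lnz S n (2*S) S : ℕ):ℝ) ≤ S*Real.log 2 ∧ S*Real.log 2 ≤ ((2*lnz S n (2*S) S : ℕ):ℝ) + (6*n+6) := by
  have h := lnz_bound S n (2*S) S hS (by omega) (by omega) ?_ hn
  · have : (((2*S : ℕ):ℝ))/S = 2 := by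
      have : (S:ℝ) ≠ 0 := by exact_mod_cast (by omega : S ≠ 0)
      push_cast; field_simp
    rw [this] at h
    push_cast at h ⊢
    exact h
  · have e : 2*S - S = S := by omega
    rw [e]
    have : S*S/(2*S+S) = S/3 := by
      rw [show 2*S+S = S*3 by ring]
      exact Nat.mul_div_mul_left _ _ (by omega)
    rw [this]; omega
end SC


namespace SC
theorem red_use (m : ℤ) (hm1 : -1 ≤ m) (hm : m ≤ 999) (t : ℝ) (ht0 : 0 < t)
    (hf : fR m t = 0) (X Z : ℕ) (hX : 0 < X) (hXQ : X ≤ 10^32) (hZX : Z ≤ X) :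
    (1:ℝ)/2^126 ≤ |X*Real.log t - Z*Real.log (1+t)| := by
  have hS : 6 ≤ 2^256 := by norm_num
  have hn : 2^256 ≤ 3^(2*82) := by norm_num
  obtain ⟨b1, b2⟩ := l2_bound (2^256) 82 hS hn
  obtain ⟨M, hM⟩ : ∃ M : ℕ, m + 1 = M := ⟨(m+1).toNat, by omega⟩
  have hMle : M ≤ 1000 := by omega
  have hr : redM (2^256) 82 (10^32) (2^131) (2*lnz (2^256) 82 (2*2^256) (2^256)) M = true := by
    rcases lt_or_ge M 250 with h | h
    · have := redRange_sound _ _ _ _ _ _ redr_0 M h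
      rwa [Nat.zero_add] at this
    rcases lt_or_ge M 500 with h' | h'
    · have := redRange_sound _ _ _ _ _ _ redr_1 (M-250) (by omega)
      rwa [show 250 + (M-250) = M by omega] at this
    rcases lt_or_ge M 750 with h2 | h2
    · have := redRange_sound _ _ _ _ _ _ redr_2 (M-500) (by omega)
      rwa [show 500 + (M-500) = M by omega] at this
    · have := redRange_sound _ _ _ _ _ _ redr_3 (M-750) (by omega)
      rwa [show 750 + (M-750) = M by omega] at this
  have := red_main (2^256) 82 (10^32) (2^131) _ M hS hn b1 b2 hr m hM t ht0 hf X Z hX hXQ hZX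
  set V := |X*Real.log t - Z*Real.log (1+t)|
  push_cast at this
  have h2 : ((2:ℝ)^130) ≤ 2^256 * V := by
    norm_num at this ⊢
    linarith
  by_contra hc
  push Not at hc
  have : (2:ℝ)^256 * V < 2^256 * (1/2^126) := by gcongr
  have e : (2:ℝ)^256 * (1/2^126) = 2^130 := by norm_num
  linarith

theorem cf_small (M : ℕ) (h : M < 1000) : cfM (2^168) (2^52) M = true := by
  have h0 := List.all_eq_true.mp cfr_small (M/250) (by rw [List.mem_range]; omega)
  have := cfRange_sound _ _ _ _ h0 (M % 250) (by omega)
  rwa [show 250*(M/250) + M%250 = M by omega] at this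

theorem cf_big (M : ℕ) (h1 : 1000 ≤ M) (h : M < 6500) : cfM (2^276) (2^88) M = true := by
  have h0 : cfRange (2^276) (2^88) (250*(M/250)) 250 = true := by
    have a1 : 4 ≤ M/250 := by omega
    have a2 : M/250 ≤ 25 := by omega
    generalize M/250 = k at *
    interval_cases k
    exacts [cfr_4, cfr_5, cfr_6, cfr_7, cfr_8, cfr_9, cfr_10, cfr_11, cfr_12, cfr_13, cfr_14, cfr_15,
      cfr_16, cfr_17, cfr_18, cfr_19, cfr_20, cfr_21, cfr_22, cfr_23, cfr_24, cfr_25]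
  have := cfRange_sound _ _ _ _ h0 (M % 250) (by omega)
  rwa [show 250*(M/250) + M%250 = M by omega] at this
end SC


namespace SC

theorem f_eval {A : Type*} [CommRing A] [Algebra ℚ A] (m : ℤ) (x : A) :
    aeval x (f m) = x^3 - m*x^2 - (m+3)*x - 1 := by
  unfold f
  have h3 : algebraMap ℚ A 3 = 3 := map_ofNat _ 3
  simp [h3]

theorem f_natDegree (m : ℤ) : (f m).natDegree = 3 := by
  unfold f
  compute_degree!

theorem f_monic (m : ℤ) : (f m).Monic := by
  unfold f
  monicity!

theorem no_rat_root (m : ℤ) (r : ℚ) (h : r^3 - m*r^2 - (m+3)*r - 1 = 0) : False := by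
  have hintg : IsIntegral ℤ r := by
    refine ⟨X^3 - C m * X^2 - C (m+3) * X - 1, by monicity!, ?_⟩
    rw [← aeval_def]
    simp only [map_sub, map_mul, map_pow, aeval_X, map_one, eq_intCast, map_intCast, map_add, map_ofNat]
    exact h
  obtain ⟨k, hk⟩ := IsIntegrallyClosed.isIntegral_iff.mp hintg
  rw [← hk] at h
  simp only [algebraMap_int_eq, eq_intCast] at h
  have h2 : k^3 - m*k^2 - (m+3)*k - 1 = 0 := by exact_mod_cast h
  have h3 : k ∣ 1 := ⟨k^2 - m*k - (m+3), by linear_combination -h2⟩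
  rcases Int.isUnit_iff.mp (isUnit_of_dvd_one h3) with rfl | rfl <;> omega

theorem f_irred (m : ℤ) : Irreducible (f m) := by
  apply Polynomial.irreducible_of_degree_le_three_of_not_isRoot
  · rw [f_natDegree]; simp
  · intro r hr
    have h : aeval r (f m) = 0 := by simpa [IsRoot.def] using hr
    rw [f_eval] at h
    exact no_rat_root m r h

theorem f_minpoly {A : Type*} [Field A] [Algebra ℚ A] (m : ℤ) (x : A)
    (h : x^3 - m*x^2 - (m+3)*x - 1 = 0) : minpoly ℚ x = f m :=
  (minpoly.eq_of_irreducible_of_monic (f_irred m) (by rw [f_eval]; exact h) (f_monic m)).symm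

theorem f_integral {A : Type*} [Field A] [Algebra ℚ A] (m : ℤ) (x : A)
    (h : x^3 - m*x^2 - (m+3)*x - 1 = 0) : IsIntegral ℚ x :=
  ⟨f m, f_monic m, by rw [← aeval_def, f_eval]; exact h⟩

theorem root_ne {A : Type*} [Field A] (m : ℤ) (x : A)
    (h : x^3 - m*x^2 - (m+3)*x - 1 = 0) : x ≠ 0 ∧ 1 + x ≠ 0 := by
  constructor
  · rintro rfl; simp at h
  · intro h1
    have : x = -1 := by linear_combination h1
    rw [this] at h; ring_nf at h; exact one_ne_zero h

theorem root_fac {A : Type*} [Field A] (m : ℤ) (x w : A)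
    (h : x^3 - m*x^2 - (m+3)*x - 1 = 0) :
    w^3 - m*w^2 - (m+3)*w - 1 = (w-x)*(w+1/(1+x))*(w+(1+x)/x) := by
  obtain ⟨h0, h1⟩ := root_ne m x h
  have hm : (m:A) = (x^3-3*x-1)/(x*(1+x)) := by
    rw [eq_div_iff (mul_ne_zero h0 h1)]; linear_combination -h
  rw [hm]; field_simp; ring

theorem root_cases {A : Type*} [Field A] (m : ℤ) (x w : A)
    (h : x^3 - m*x^2 - (m+3)*x - 1 = 0) (hw : w^3 - m*w^2 - (m+3)*w - 1 = 0) :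
    w = x ∨ w = -1/(1+x) ∨ w = -(1+x)/x := by
  rw [root_fac m x w h] at hw
  rcases mul_eq_zero.mp hw with hw | hw
  · rcases mul_eq_zero.mp hw with hw | hw
    · left; linear_combination hw
    · right; left; rw [neg_div]; linear_combination hw
  · right; right; rw [neg_div]; linear_combination hw

theorem root_next {A : Type*} [Field A] (m : ℤ) (x : A)
    (h : x^3 - m*x^2 - (m+3)*x - 1 = 0) :
    (-1/(1+x))^3 - m*(-1/(1+x))^2 - (m+3)*(-1/(1+x)) - 1 = 0 := by
  rw [root_fac m x _ h]; ring

theorem root_prev {A : Type*} [Field A] (m : ℤ) (x : A)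
    (h : x^3 - m*x^2 - (m+3)*x - 1 = 0) :
    (-(1+x)/x)^3 - m*(-(1+x)/x)^2 - (m+3)*(-(1+x)/x) - 1 = 0 := by
  rw [root_fac m x _ h]; ring

theorem mem_rootSet_f {A : Type*} [Field A] [Algebra ℚ A] (m : ℤ) (x : A) :
    x ∈ (f m).rootSet A ↔ x^3 - m*x^2 - (m+3)*x - 1 = 0 := by
  rw [Polynomial.mem_rootSet_of_ne (f_monic m).ne_zero, f_eval]

theorem L_le {E : IntermediateField ℚ (AlgebraicClosure ℚ)} (m : ℤ) (x : AlgebraicClosure ℚ)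
    (h : x^3 - m*x^2 - (m+3)*x - 1 = 0) (hx : x ∈ E) : L m ≤ E := by
  unfold L
  rw [IntermediateField.adjoin_le_iff]
  intro w hw
  have h1x : 1 + x ∈ E := E.add_mem E.one_mem hx
  rcases root_cases m x w h ((mem_rootSet_f m w).mp hw) with rfl | rfl | rfl
  · exact hx
  · exact E.div_mem (E.neg_mem E.one_mem) h1x
  · exact E.div_mem (E.neg_mem h1x) hx

theorem root_mem (m : ℤ) (x : AlgebraicClosure ℚ)
    (h : x^3 - m*x^2 - (m+3)*x - 1 = 0) : x ∈ L m :=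
  IntermediateField.subset_adjoin _ _ ((mem_rootSet_f m x).mpr h)

theorem exists_root (m : ℤ) : ∃ x : AlgebraicClosure ℚ, x^3 - m*x^2 - (m+3)*x - 1 = 0 := by
  obtain ⟨x, hx⟩ := IsAlgClosed.exists_aeval_eq_zero (AlgebraicClosure ℚ) (f m)
    (by rw [Polynomial.degree_eq_natDegree (f_monic m).ne_zero, f_natDegree]; simp)
  exact ⟨x, by rw [f_eval] at hx; exact hx⟩

theorem L_eq_of (m n : ℤ) (x y : AlgebraicClosure ℚ) (h : x^3 - m*x^2 - (m+3)*x - 1 = 0)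
    (hy : y^3 - n*y^2 - (n+3)*y - 1 = 0) (hx : x ∈ L n) (hy' : y ∈ L m) : L m = L n :=
  le_antisymm (L_le m x h hx) (L_le n y hy hy')

theorem ratl_ne (m : ℤ) (x : AlgebraicClosure ℚ) (p q : ℤ) (hq : q ≠ 0)
    (h : x^3 - m*x^2 - (m+3)*x - 1 = 0) : (q:AlgebraicClosure ℚ)*x - p ≠ 0 := by
  intro h0
  have hq' : (q:AlgebraicClosure ℚ) ≠ 0 := by exact_mod_cast hq
  have e : x = algebraMap ℚ _ ((p:ℚ)/q) := by
    simp only [map_div₀, map_intCast]; rw [eq_div_iff hq']; linear_combination h0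
  rw [e] at h
  apply no_rat_root m ((p:ℚ)/q)
  apply (algebraMap ℚ (AlgebraicClosure ℚ)).injective
  simp only [map_sub, map_pow, map_mul, map_add, map_intCast, map_one, map_zero, map_ofNat]
  exact h


theorem L_eq1 (m n p q : ℤ) (hq : q ≠ 0) (hF : p^3-m*p^2*q-(m+3)*p*q^2-q^3 ≠ 0)
    (hn : (n+3)*(p^3-m*p^2*q-(m+3)*p*q^2-q^3) = (m+3)*(p^3-3*p*q^2-q^3)+9*(p*q*(p+q))) :
    L m = L n := by
  obtain ⟨x, h⟩ := exists_root m
  have hd : (p:AlgebraicClosure ℚ) - q*x ≠ 0 := by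
    have := ratl_ne m x p q hq h
    intro h1; apply this; linear_combination -h1
  have hnK := congrArg (fun z : ℤ => (z : AlgebraicClosure ℚ)) hn
  have hFK : ((p^3-m*p^2*q-(m+3)*p*q^2-q^3 : ℤ) : AlgebraicClosure ℚ) ≠ 0 := by exact_mod_cast hF
  push_cast at hnK hFK
  obtain ⟨y, hyx⟩ : ∃ y : AlgebraicClosure ℚ, y*(p-q*x) = q+q*x+p*x :=
    ⟨(q+q*x+p*x)/(p-q*x), by field_simp⟩
  have hy : y^3 - n*y^2 - (n+3)*y - 1 = 0 := by
    apply (mul_eq_zero.mp (?_ : (((p^3-m*p^2*q-(m+3)*p*q^2-q^3)*(p-q*x)^3)*(y^3 - n*y^2 - (n+3)*y - 1) : AlgebraicClosure ℚ) = 0)).resolve_left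
      (mul_ne_zero hFK (pow_ne_zero 3 hd))
    have e : ((p-q*x)^3*(y^3 - n*y^2 - (n+3)*y - 1) : AlgebraicClosure ℚ) = (y*(p-q*x))^3 - n*(y*(p-q*x))^2*(p-q*x)
      - (n+3)*(y*(p-q*x))*(p-q*x)^2 - (p-q*x)^3 := by ring
    rw [mul_assoc, e, hyx]
    linear_combination (p^2+p*q+q^2)^3*h - ((q+q*x+p*x)^2*(p-q*x)+(q+q*x+p*x)*(p-q*x)^2)*hnK
  have hpI : ∀ (E : IntermediateField ℚ (AlgebraicClosure ℚ)) (k : ℤ), (k : AlgebraicClosure ℚ) ∈ E := fun E k => intCast_mem E k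
  have hy1 : y ∈ L m := by
    have e : y = (q+q*x+p*x)/(p-q*x) := by rw [eq_div_iff hd]; exact hyx
    rw [e]
    have hx := root_mem m x h
    exact div_mem (add_mem (add_mem (hpI _ q) (mul_mem (hpI _ q) hx)) (mul_mem (hpI _ p) hx))
      (sub_mem (hpI _ p) (mul_mem (hpI _ q) hx))
  have hd2 : (q:AlgebraicClosure ℚ)*y - (-(q+p) : ℤ) ≠ 0 := ratl_ne n y _ q hq hy
  have hx1 : x ∈ L n := by
    have e : x = (p*y-q)/(q*y-(-(q+p) : ℤ)) := by
      rw [eq_div_iff hd2]; push_cast; linear_combination -hyx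
    rw [e]
    have hx := root_mem n y hy
    exact div_mem (sub_mem (mul_mem (hpI _ p) hx) (hpI _ q)) (sub_mem (mul_mem (hpI _ q) hx) (hpI _ _))
  exact L_eq_of m n x y h hy hx1 hy1

theorem L_eq2 (m n p q : ℤ) (hq : q ≠ 0) (hF : p^3-m*p^2*q-(m+3)*p*q^2-q^3 ≠ 0)
    (hn : -n*(p^3-m*p^2*q-(m+3)*p*q^2-q^3) = (m+3)*(p^3-3*p*q^2-q^3)+9*(p*q*(p+q))) :
    L m = L n := by
  obtain ⟨x, h⟩ := exists_root m
  have hd : q*x - (p:AlgebraicClosure ℚ) ≠ 0 := ratl_ne m x p q hq h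
  have hnK := congrArg (fun z : ℤ => (z : AlgebraicClosure ℚ)) hn
  have hFK : ((p^3-m*p^2*q-(m+3)*p*q^2-q^3 : ℤ) : AlgebraicClosure ℚ) ≠ 0 := by exact_mod_cast hF
  push_cast at hnK hFK
  obtain ⟨y, hyx⟩ : ∃ y : AlgebraicClosure ℚ, y*(q*x-p) = q+p+p*x :=
    ⟨(q+p+p*x)/(q*x-p), by field_simp⟩
  have hy : y^3 - n*y^2 - (n+3)*y - 1 = 0 := by
    apply (mul_eq_zero.mp (?_ : (((p^3-m*p^2*q-(m+3)*p*q^2-q^3)*(q*x-p)^3)*(y^3 - n*y^2 - (n+3)*y - 1) : AlgebraicClosure ℚ) = 0)).resolve_left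
      (mul_ne_zero hFK (pow_ne_zero 3 hd))
    have e : ((q*x-p)^3*(y^3 - n*y^2 - (n+3)*y - 1) : AlgebraicClosure ℚ) = (y*(q*x-p))^3 - n*(y*(q*x-p))^2*(q*x-p)
      - (n+3)*(y*(q*x-p))*(q*x-p)^2 - (q*x-p)^3 := by ring
    rw [mul_assoc, e, hyx]
    linear_combination (p^2+p*q+q^2)^3*h + ((q+p+p*x)^2*(q*x-p)+(q+p+p*x)*(q*x-p)^2)*hnK
  have hpI : ∀ (E : IntermediateField ℚ (AlgebraicClosure ℚ)) (k : ℤ), (k : AlgebraicClosure ℚ) ∈ E := fun E k => intCast_mem E k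
  have hy1 : y ∈ L m := by
    have e : y = (q+p+p*x)/(q*x-p) := by rw [eq_div_iff hd]; exact hyx
    rw [e]
    have hx := root_mem m x h
    exact div_mem (add_mem (add_mem (hpI _ q) (hpI _ p)) (mul_mem (hpI _ p) hx))
      (sub_mem (mul_mem (hpI _ q) hx) (hpI _ p))
  have hd2 : (q:AlgebraicClosure ℚ)*y - p ≠ 0 := ratl_ne n y _ q hq hy
  have hx1 : x ∈ L n := by
    have e : x = (q+p+p*y)/(q*y-p) := by
      rw [eq_div_iff hd2]; linear_combination hyx
    rw [e]
    have hx := root_mem n y hy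
    exact div_mem (add_mem (add_mem (hpI _ q) (hpI _ p)) (mul_mem (hpI _ p) hx))
      (sub_mem (mul_mem (hpI _ q) hx) (hpI _ p))
  exact L_eq_of m n x y h hy hx1 hy1

theorem L_m1_5 : L (-1) = L 5 := L_eq1 (-1) 5 2 1 (by norm_num) (by norm_num) (by norm_num)
theorem L_5_12 : L 5 = L 12 := L_eq2 5 12 4 1 (by norm_num) (by norm_num) (by norm_num)
theorem L_12_1259 : L 12 = L 1259 := L_eq2 12 1259 13 1 (by norm_num) (by norm_num) (by norm_num)
theorem L_0_3 : L 0 = L 3 := L_eq2 0 3 1 1 (by norm_num) (by norm_num) (by norm_num)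
theorem L_3_54 : L 3 = L 54 := L_eq2 3 54 4 1 (by norm_num) (by norm_num) (by norm_num)
theorem L_1_66 : L 1 = L 66 := L_eq2 1 66 5 2 (by norm_num) (by norm_num) (by norm_num)
theorem L_2_2389 : L 2 = L 2389 := L_eq2 2 2389 7 2 (by norm_num) (by norm_num) (by norm_num)
end SC


namespace SC

/-- A field with an automorphism of order three, with rational fixed field, and a real embedding. -/
structure GS (E : Type) [Field E] where
  σ : E →+* E
  ι : E →+* ℝ
  cub : ∀ x, σ (σ (σ x)) = x
  fix : ∀ x, σ x = x → ∃ r : ℚ, x = (r : E)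

def rt {A : Type*} [Field A] (m : ℤ) (x : A) : Prop := x^3 - m*x^2 - (m+3)*x - 1 = 0

theorem rt_map {A B : Type*} [Field A] [Field B] (φ : A →+* B) (m : ℤ) (x : A) (h : rt m x) : rt m (φ x) := by
  have := congrArg φ h
  simp only [map_sub, map_pow, map_mul, map_add, map_intCast, map_one, map_zero, map_ofNat] at this
  exact this

theorem pb_hom {A B : Type*} [Field A] [Algebra ℚ A] [Field B] [Algebra ℚ B] (pb : PowerBasis ℚ A)
    (m : ℤ) (h : rt m pb.gen) (y : B) (hy : rt m y) : ∃ φ : A →ₐ[ℚ] B, φ pb.gen = y := by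
  have hmin : minpoly ℚ pb.gen = f m := f_minpoly m _ h
  have h1 : aeval y (minpoly ℚ pb.gen) = 0 := by rw [hmin, f_eval]; exact hy
  exact ⟨pb.lift y h1, pb.lift_gen y h1⟩

theorem gs_of_pb {E : Type} [Field E] [Algebra ℚ E] (pb : PowerBasis ℚ E) (ι : E →+* ℝ)
    (m : ℤ) (θ : E) (hpbgen : pb.gen = θ) (hθ : rt m θ) : ∃ G : GS E, G.ι = ι ∧ G.σ θ = -1/(1+θ) := by
  have hmin : minpoly ℚ pb.gen = f m := by rw [hpbgen]; exact f_minpoly m θ hθ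
  have hnext : rt m (-1/(1+θ)) := root_next m θ hθ
  obtain ⟨σ, hσ⟩ := pb_hom pb m (hpbgen ▸ hθ) _ hnext
  rw [hpbgen] at hσ
  obtain ⟨h0, h1⟩ := root_ne m θ hθ
  have hσ2 : σ (-1/(1+θ)) = -(1+θ)/θ := by
    rw [map_div₀, map_neg, map_one, map_add, map_one, hσ]
    have : 1 + -1/(1+θ) = θ/(1+θ) := by field_simp; ring
    rw [this]; field_simp
  have hσ3 : σ (-(1+θ)/θ) = θ := by
    rw [map_div₀, map_neg, map_add, map_one, hσ]
    have : 1 + -1/(1+θ) = θ/(1+θ) := by field_simp; ring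
    rw [this]; field_simp
  have hdim : pb.dim = 3 := by
    have := pb.natDegree_minpoly
    rw [hmin, f_natDegree] at this
    exact this.symm
  have hrep : ∀ x : E, ∃ a b c : ℚ, x = (a:E) + b*θ + c*θ^2 := by
    intro x
    obtain ⟨g, hg, hx⟩ := pb.exists_eq_aeval x
    rw [hpbgen] at hx
    rw [hdim] at hg
    refine ⟨g.coeff 0, g.coeff 1, g.coeff 2, ?_⟩
    rw [hx, aeval_eq_sum_range' hg, Finset.sum_range_succ, Finset.sum_range_succ, Finset.sum_range_one]
    simp [Algebra.smul_def]
  have hcub : ∀ x, σ (σ (σ x)) = x := by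
    intro x
    obtain ⟨a, b, c, rfl⟩ := hrep x
    simp only [map_add, map_mul, map_pow, map_ratCast, hσ, hσ2, hσ3]
  have hne : θ ≠ -(1+θ)/θ ∧ θ ≠ -1/(1+θ) := by
    have hsq : θ^2 + θ + 1 ≠ 0 := by
      intro h
      have h' := congrArg (ι) h
      simp only [map_add, map_pow, map_one, map_zero] at h'
      nlinarith [sq_nonneg (ι θ + 1/2)]
    constructor
    · intro h; rw [eq_div_iff h0] at h; apply hsq; linear_combination h
    · intro h; rw [eq_div_iff h1] at h; apply hsq; linear_combination h
  have hfix : ∀ x, σ x = x → ∃ r : ℚ, x = (r : E) := by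
    intro x hx
    obtain ⟨a, b, c, rfl⟩ := hrep x
    refine ⟨a, ?_⟩
    have e1 := hx
    simp only [map_add, map_mul, map_pow, map_ratCast, hσ] at e1
    have e2 := congrArg σ e1
    simp only [map_add, map_mul, map_pow, map_ratCast, hσ, hσ2] at e2
    have hne3 : -(1+θ)/θ ≠ -1/(1+θ) := by
      intro h
      have := congrArg σ h
      rw [hσ3, hσ2] at this
      exact hne.1 this
    set x1 := -1/(1+θ)
    set x2 := -(1+θ)/θ
    have k1 : (b:E) + c*(x1+θ) = 0 := by
      apply (mul_eq_zero.mp (?_ : (θ - x1)*((b:E) + c*(x1+θ)) = 0)).resolve_left (sub_ne_zero.mpr hne.2)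
      linear_combination -e1
    have k2 : (b:E) + c*(x1+x2) = 0 := by
      apply (mul_eq_zero.mp (?_ : (x2 - x1)*((b:E) + c*(x1+x2)) = 0)).resolve_left (sub_ne_zero.mpr hne3)
      linear_combination e2
    have k3 : (c:E) = 0 := by
      apply (mul_eq_zero.mp (?_ : (θ - x2)*(c:E) = 0)).resolve_left (sub_ne_zero.mpr hne.1)
      linear_combination k1 - k2
    have k4 : (b:E) = 0 := by rw [k3] at k1; simpa using k1
    rw [k3, k4]; ring
  exact ⟨⟨σ.toRingHom, ι, hcub, hfix⟩, rfl, hσ⟩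

open IntermediateField in
theorem gs_exists (m n : ℤ) (hL : L m = L n) (t : ℝ) (ht : rt m t) :
    ∃ (E : Type) (_ : Field E) (G : GS E) (θ ϑ : E), G.ι θ = t ∧ rt m θ ∧ rt n ϑ ∧
      G.σ θ = -1/(1+θ) := by
  have hti : IsIntegral ℚ t := f_integral m t ht
  have hθ : rt m (AdjoinSimple.gen ℚ t) := by
    apply Subtype.ext
    have := ht
    unfold rt at this
    exact this
  obtain ⟨G, hG1, hG2⟩ := gs_of_pb (adjoin.powerBasis hti) (algebraMap ℚ⟮t⟯ ℝ) m
    (AdjoinSimple.gen ℚ t) (adjoin.powerBasis_gen hti) hθ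
  obtain ⟨x, hx⟩ := exists_root m
  obtain ⟨y, hy⟩ := exists_root n
  have hxi : IsIntegral ℚ x := f_integral m x hx
  have hyx : y ∈ ℚ⟮x⟯ := by
    have h1 : y ∈ L m := by rw [hL]; exact root_mem n y hy
    exact L_le m x hx (mem_adjoin_simple_self ℚ x) h1
  have hx' : rt m (AdjoinSimple.gen ℚ x) := by
    apply Subtype.ext
    exact hx
  obtain ⟨φ, -⟩ := pb_hom (adjoin.powerBasis hxi) m (by rw [adjoin.powerBasis_gen hxi]; exact hx') _ hθ
  refine ⟨ℚ⟮t⟯, inferInstance, G, AdjoinSimple.gen ℚ t, φ ⟨y, hyx⟩, ?_, hθ, ?_, hG2⟩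
  · rw [hG1]; rfl
  · apply rt_map φ.toRingHom n
    apply Subtype.ext
    exact hy

variable {E : Type} [Field E]

theorem GS.charZero (G : GS E) : CharZero E := G.ι.charZero

theorem GS.int (G : GS E) (x : E) (hx : G.σ x = x) (hi : IsIntegral ℤ x) : ∃ k : ℤ, x = k := by
  have := G.charZero
  obtain ⟨r, rfl⟩ := G.fix x hx
  have h2 : IsIntegral ℤ r := by
    have : (r:E) = algebraMap ℚ E r := by simp
    rw [this] at hi
    exact (isIntegral_algebraMap_iff (algebraMap ℚ E).injective).mp hi
  obtain ⟨k, hk⟩ := IsIntegrallyClosed.isIntegral_iff.mp h2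
  refine ⟨k, ?_⟩
  rw [← hk]; simp

theorem rt_integral (m : ℤ) (x : E) (h : rt m x) : IsIntegral ℤ x := by
  refine ⟨X^3 - C m * X^2 - C (m+3) * X - 1, by monicity!, ?_⟩
  rw [← aeval_def]
  simp only [map_sub, map_mul, map_pow, aeval_X, map_one, eq_intCast, map_intCast, map_add, map_ofNat]
  exact h

theorem normHyp_of (G : GS E) (m : ℤ) (θ : E) (hθ : rt m θ) (hσ : G.σ θ = -1/(1+θ)) : NormHyp (G.ι θ) := by
  intro P hP
  have := G.charZero
  obtain ⟨h0, h1⟩ := root_ne m θ hθ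
  have hσ2 : G.σ (-1/(1+θ)) = -(1+θ)/θ := by
    rw [map_div₀, map_neg, map_one, map_add, map_one, hσ]
    have : 1 + -1/(1+θ) = θ/(1+θ) := by field_simp; ring
    rw [this]; field_simp
  have hmapι : ∀ x : E, G.ι (aeval x P) = aeval (G.ι x) P := fun x => by
    rw [aeval_def, aeval_def, hom_eval₂]; congr 1; exact RingHom.ext_int _ _
  have hmapσ : ∀ x : E, G.σ (aeval x P) = aeval (G.σ x) P := fun x => by
    rw [aeval_def, aeval_def, hom_eval₂]; congr 1; exact RingHom.ext_int _ _
  set u := aeval θ P with hu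
  have hui : IsIntegral ℤ u := by
    have := rt_integral m θ hθ
    have h2 : u ∈ integralClosure ℤ E := by
      rw [hu, ← coe_aeval_mk_apply (S := integralClosure ℤ E) θ (p := P) this]; exact Subtype.property _
    exact h2
  have hu0 : u ≠ 0 := by
    intro h; apply hP; rw [← hmapι, ← hu, h, map_zero]
  have hN : G.σ (u * G.σ u * G.σ (G.σ u)) = u * G.σ u * G.σ (G.σ u) := by
    rw [map_mul, map_mul, G.cub]; ring
  have hσi : ∀ x, IsIntegral ℤ x → IsIntegral ℤ (G.σ x) := fun x hx => hx.map (G.σ.toIntAlgHom)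
  obtain ⟨k, hk⟩ := G.int _ hN ((hui.mul (hσi _ hui)).mul (hσi _ (hσi _ hui)))
  have hk0 : k ≠ 0 := by
    rintro rfl
    rw [Int.cast_zero] at hk
    have : ∀ x, x ≠ 0 → G.σ x ≠ 0 := fun x hx => (map_ne_zero G.σ).mpr hx
    exact mul_ne_zero (mul_ne_zero hu0 (this _ hu0)) (this _ (this _ hu0)) hk
  have h3 := congrArg G.ι hk
  rw [hu, hmapσ, hσ, hmapσ, hσ2, map_mul, map_mul, hmapι, hmapι, hmapι, map_intCast] at h3
  simp only [map_div₀, map_neg, map_add, map_one] at h3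
  rw [← abs_mul, ← abs_mul, h3]
  exact_mod_cast Int.one_le_abs hk0

theorem gs_pos (m n : ℤ) (hL : L m = L n) (t : ℝ) (ht : rt m t) :
    ∃ (E : Type) (_ : Field E) (G : GS E) (θ ϑ : E), G.ι θ = t ∧ rt m θ ∧ rt n ϑ ∧
      G.σ θ = -1/(1+θ) ∧ 0 < G.ι ϑ ∧ (G.σ ϑ = -1/(1+ϑ) ∨ G.σ ϑ = -(1+ϑ)/ϑ) := by
  obtain ⟨E, _, G, θ, ϑ, h1, h2, h3, h4⟩ := gs_exists m n hL t ht
  have := G.charZero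
  suffices h : ∃ x : E, rt n x ∧ 0 < G.ι x by
    obtain ⟨x, hx, hx0⟩ := h
    refine ⟨E, _, G, θ, x, h1, h2, hx, h4, hx0, ?_⟩
    rcases root_cases n x (G.σ x) hx (rt_map G.σ n x hx) with h | h
    · exfalso
      obtain ⟨r, rfl⟩ := G.fix x h
      apply no_rat_root n r
      have : ((r^3 - n*r^2 - (n+3)*r - 1 : ℚ) : E) = 0 := by
        push_cast; exact hx
      exact_mod_cast this
    · exact h
  obtain ⟨a0, a1⟩ := root_ne n (G.ι ϑ) (rt_map G.ι n ϑ h3)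
  by_cases c1 : 0 < G.ι ϑ
  · exact ⟨ϑ, h3, c1⟩
  have c2 : G.ι ϑ < 0 := lt_of_le_of_ne (not_lt.mp c1) a0
  by_cases c3 : 0 < 1 + G.ι ϑ
  · refine ⟨-(1+ϑ)/ϑ, root_prev n ϑ h3, ?_⟩
    simp only [map_div₀, map_neg, map_add, map_one]
    exact div_pos_of_neg_of_neg (by linarith) c2
  · have c4 : 1 + G.ι ϑ < 0 := lt_of_le_of_ne (not_lt.mp c3) a1
    refine ⟨-1/(1+ϑ), root_next n ϑ h3, ?_⟩
    simp only [map_div₀, map_neg, map_add, map_one]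
    exact div_pos_of_neg_of_neg (by norm_num) c4
end SC


namespace SC

theorem rt_fR (m : ℤ) (x : ℝ) : rt m x ↔ fR m x = 0 := Iff.rfl

theorem exists_t (m : ℤ) (hm : -1 ≤ m) : ∃ t : ℝ, 6/5 ≤ t ∧ fR m t = 0 ∧ (m:ℝ)+1 ≤ t ∧ t ≤ m+3 := by
  have hm' : (-1:ℝ) ≤ m := by exact_mod_cast hm
  have hc : ContinuousOn (fR m) (Set.Icc (6/5:ℝ) (m+3)) := by unfold fR; fun_prop
  have h1 : fR m (6/5) ≤ 0 := by unfold fR; linarith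
  have h2 : 0 ≤ fR m ((m:ℝ)+3) := by
    unfold fR
    have : ((m:ℝ)+3)^3 - m*((m:ℝ)+3)^2 - (m+3)*((m:ℝ)+3) - 1 = 2*((m:ℝ)+3)^2 - 1 := by ring
    rw [this]; nlinarith
  obtain ⟨t, ⟨ht1, ht2⟩, ht3⟩ := intermediate_value_Icc (by linarith) hc ⟨h1, h2⟩
  refine ⟨t, ht1, ht3, ?_, ht2⟩
  have := m_le (by linarith) ht3
  linarith

theorem T_gt (m n : ℤ) (hmn : m < n) (t T : ℝ) (ht : 0 < t) (hf : fR m t = 0) (hT : 0 < T) (hF : fR n T = 0) : t < T := by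
  have hmn' : (m:ℝ) < n := by exact_mod_cast hmn
  have e : fR m T = (n-m)*(T^2+T) := by
    have : fR m T = fR n T + (n-m)*(T^2+T) := by unfold fR; ring
    rw [this, hF]; ring
  have h1 : 0 < fR m T := by
    rw [e]; have : (0:ℝ) < n - m := by linarith
    positivity
  have h2 := (fR_pos_iff ht hf hT.le).mp h1.le
  rcases h2.lt_or_eq with h | h
  · exact h
  · rw [← h, hf] at h1; exact absurd h1 (lt_irrefl 0)

theorem F_dvd (m F H p q k : ℤ) (hco : IsCoprime p q) (hF : F = FF m p q) (hH : H = HH m p q) (hk : H = F*k) :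
    F ∣ m^2+3*m+9 := by
  have e1 : (m^2+3*m+9)*(p^3-3*p*q^2-q^3) = m*H+9*F := by rw [hF, hH]; unfold FF HH; ring
  have e2 : (m^2+3*m+9)*(p*q*(p+q)) = H-(m+3)*F := by rw [hF, hH]; unfold FF HH; ring
  have d1 : F ∣ (m^2+3*m+9)*(p^3-3*p*q^2-q^3) := by rw [e1, hk]; exact ⟨m*k+9, by ring⟩
  have d2 : F ∣ (m^2+3*m+9)*(p*q*(p+q)) := by rw [e2, hk]; exact ⟨k-(m+3), by ring⟩
  have c1 : IsCoprime (p^3-3*p*q^2-q^3) p := by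
    have h0 : IsCoprime (-q^3) p := (hco.symm.pow_left (m := 3)).neg_left
    have := h0.add_mul_left_left (p^2-3*q^2)
    convert this using 1 <;> first | rfl | ring
  have c2 : IsCoprime (p^3-3*p*q^2-q^3) q := by
    have h0 : IsCoprime (p^3) q := hco.pow_left (m := 3)
    have := h0.add_mul_left_left (-3*p*q-q^2)
    convert this using 1 <;> first | rfl | ring
  have c3 : IsCoprime (p^3-3*p*q^2-q^3) (p+q) := by
    have h00 : IsCoprime q (p+q) := by
      have := hco.symm.add_mul_left_right 1
      convert this using 1 <;> first | rfl | ring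
    have h0 : IsCoprime (q^3) (p+q) := h00.pow_left (m := 3)
    have := h0.add_mul_left_left (p^2-p*q-2*q^2)
    convert this using 1 <;> first | rfl | ring
  have c : IsCoprime (p^3-3*p*q^2-q^3) (p*q*(p+q)) := (c1.mul_right c2).mul_right c3
  obtain ⟨u, v, huv⟩ := c
  have : m^2+3*m+9 = u*((m^2+3*m+9)*(p^3-3*p*q^2-q^3)) + v*((m^2+3*m+9)*(p*q*(p+q))) := by
    linear_combination -(m^2+3*m+9)*huv
  rw [this]
  exact dvd_add (d1.mul_left u) (d2.mul_left v)

theorem fR_neg_of_lt {m t w : ℝ} (ht : 0 < t) (h : fR m t = 0) (hw : 0 ≤ w) (hlt : w < t) : fR m w < 0 := by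
  by_contra hc; push Not at hc
  have := (fR_pos_iff ht h hw).mp hc; linarith

theorem FF_pos (m : ℤ) (t : ℝ) (ht : 0 < t) (hf : fR m t = 0) (p q : ℕ) (hq : 0 < q) (h : (q:ℝ)*t < p) :
    0 < FF m p q := by
  have hqr : (0:ℝ) < q := by exact_mod_cast hq
  have h1 : t < (p:ℝ)/q := by rw [lt_div_iff₀ hqr]; linarith
  have h2 : 0 < fR m ((p:ℝ)/q) := by
    rw [fR_fac ht hf]
    have : 0 < (p:ℝ)/q - t := by linarith
    positivity
  have e : ((FF m p q : ℤ):ℝ) = (q:ℝ)^3*fR m ((p:ℝ)/q) := by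
    unfold FF fR; push_cast; field_simp
  have : (0:ℝ) < ((FF m p q : ℤ):ℝ) := by rw [e]; positivity
  exact_mod_cast this

theorem FF_neg (m : ℤ) (t : ℝ) (ht : 0 < t) (hf : fR m t = 0) (p q : ℕ) (hq : 0 < q) (h : (p:ℝ) < q*t) :
    FF m p q < 0 := by
  have hqr : (0:ℝ) < q := by exact_mod_cast hq
  have h1 : (p:ℝ)/q < t := by rw [div_lt_iff₀ hqr]; linarith
  have h2 : fR m ((p:ℝ)/q) < 0 := fR_neg_of_lt ht hf (by positivity) h1
  have e : ((FF m p q : ℤ):ℝ) = (q:ℝ)^3*fR m ((p:ℝ)/q) := by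
    unfold FF fR; push_cast; field_simp
  have : ((FF m p q : ℤ):ℝ) < 0 := by rw [e]; exact mul_neg_of_pos_of_neg (by positivity) h2
  exact_mod_cast this

theorem pq_of_rat (r : ℚ) (hr : 0 < r) : ∃ p q : ℕ, 0 < p ∧ 0 < q ∧ Nat.Coprime p q ∧ (r:ℝ)*q = p := by
  refine ⟨r.num.natAbs, r.den, ?_, r.pos, r.reduced, ?_⟩
  · exact Int.natAbs_pos.mpr (Rat.num_pos.mpr hr).ne'
  · have h1 : ((r.num.natAbs : ℕ):ℝ) = ((r.num : ℤ):ℝ) := by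
      have : ((r.num.natAbs : ℕ):ℤ) = r.num := Int.natAbs_of_nonneg (Rat.num_pos.mpr hr).le
      rw [← Int.cast_natCast, this]
    rw [h1]
    have := Rat.mul_den_eq_num r
    exact_mod_cast congrArg (fun z : ℚ => (z:ℝ)) this

theorem B1_case1 {E : Type} [Field E] (G : GS E) (m n : ℤ) (hmn : m < n) (θ ϑ : E) (hθ : rt m θ) (hϑ : rt n ϑ)
    (hs : G.σ θ = -1/(1+θ)) (hs2 : G.σ ϑ = -1/(1+ϑ)) (ht : 0 < G.ι θ) (hT : 0 < G.ι ϑ) :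
    ∃ p q : ℕ, 0 < p ∧ 0 < q ∧ Nat.Coprime p q ∧ FF m p q ∣ m^2+3*m+9 ∧ 0 < FF m p q ∧
      (n+3)*FF m p q = HH m p q ∧
      G.ι ϑ*(p - q*G.ι θ) = q+q*G.ι θ+p*G.ι θ := by
  have := G.charZero
  have hf : fR m (G.ι θ) = 0 := rt_map G.ι m θ hθ
  have hF : fR n (G.ι ϑ) = 0 := rt_map G.ι n ϑ hϑ
  have htT := T_gt m n hmn _ _ ht hf hT hF
  obtain ⟨a0, a1⟩ := root_ne m θ hθ
  obtain ⟨b0, b1⟩ := root_ne n ϑ hϑ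
  have hd : ϑ - θ ≠ 0 := by
    intro h
    have := congrArg G.ι h
    rw [map_sub, map_zero] at this; linarith
  have hz : G.σ ((1+θ+θ*ϑ)/(ϑ-θ)) = (1+θ+θ*ϑ)/(ϑ-θ) := by
    simp only [map_div₀, map_sub, map_add, map_mul, map_one, hs, hs2]
    have e1 : -1/(1+ϑ) - -1/(1+θ) = (ϑ-θ)/((1+θ)*(1+ϑ)) := by field_simp; ring
    have e2 : 1 + -1/(1+θ) + -1/(1+θ)*(-1/(1+ϑ)) = (1+θ+θ*ϑ)/((1+θ)*(1+ϑ)) := by field_simp; ring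
    rw [e1, e2]; field_simp
  obtain ⟨r, hr⟩ := G.fix _ hz
  rw [div_eq_iff hd] at hr
  have hrR := congrArg G.ι hr
  simp only [map_sub, map_add, map_mul, map_one, map_ratCast] at hrR
  set t := G.ι θ
  set T := G.ι ϑ
  have hr0 : (0:ℝ) < r := by
    have h1 : 0 < (r:ℝ)*(T-t) := by rw [← hrR]; positivity
    exact pos_of_mul_pos_left h1 (by linarith)
  obtain ⟨p, q, hp, hq, hco, hpq⟩ := pq_of_rat r (by exact_mod_cast hr0)
  have hqr : (0:ℝ) < q := by exact_mod_cast hq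
  have hpr : (0:ℝ) < p := by exact_mod_cast hp
  have hrel : T*(p - q*t) = q+q*t+p*t := by rw [← hpq]; linear_combination -(q:ℝ)*hrR
  have hv : 0 < (p:ℝ) - q*t := by
    have h1 : 0 < T*((p:ℝ) - q*t) := by rw [hrel]; positivity
    exact pos_of_mul_pos_right h1 hT.le
  have hFp := FF_pos m t ht hf p q hq (by linarith)
  have hH : (n+3)*FF m p q = HH m p q := by
    have hG : (q+q*t+p*t)^3 - n*(q+q*t+p*t)^2*(p-q*t) - (n+3)*(q+q*t+p*t)*(p-q*t)^2 - (p-q*t)^3 = (0:ℝ) := by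
      rw [← hrel]
      have : (T*(p-q*t))^3 - n*(T*(p-q*t))^2*(p-q*t) - (n+3)*(T*(p-q*t))*(p-q*t)^2 - (p-q*t)^3 = (p-q*t)^3*fR n T := by
        unfold fR; ring
      rw [this, hF, mul_zero]
    have hB : ((q+q*t+p*t)^2*(p-q*t)+(q+q*t+p*t)*(p-q*t)^2) ≠ 0 := by positivity
    have : (((n+3)*FF m p q : ℤ):ℝ) = ((HH m p q : ℤ):ℝ) := by
      rw [← sub_eq_zero]
      apply (mul_eq_zero.mp (?_ : ((q+q*t+p*t)^2*(p-q*t)+(q+q*t+p*t)*(p-q*t)^2)*_ = 0)).resolve_left hB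
      have hf' := hf
      unfold fR at hf'
      unfold FF HH; push_cast
      linear_combination (p^2+p*q+q^2)^3*hf' - (p^3-m*p^2*q-(m+3)*p*q^2-q^3)*hG
    exact_mod_cast this
  have hdv := F_dvd m _ _ p q (n+3) (Nat.isCoprime_iff_coprime.mpr hco) rfl rfl (by rw [← hH]; ring)
  exact ⟨p, q, hp, hq, hco, hdv, hFp, hH, hrel⟩

theorem B1_case2 {E : Type} [Field E] (G : GS E) (m n : ℤ) (hmn : m < n) (θ ϑ : E) (hθ : rt m θ) (hϑ : rt n ϑ)
    (hs : G.σ θ = -1/(1+θ)) (hs2 : G.σ ϑ = -(1+ϑ)/ϑ) (ht : 1 < G.ι θ) (hT : 0 < G.ι ϑ) :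
    ∃ p q : ℕ, 0 < p ∧ 0 < q ∧ Nat.Coprime p q ∧ FF m p q ∣ m^2+3*m+9 ∧ FF m p q < 0 ∧
      -n*FF m p q = HH m p q ∧ ((G.ι θ)^2-1)*q ≤ (2*G.ι θ+1)*p ∧
      G.ι ϑ*(q*G.ι θ - p) = q+p+p*G.ι θ := by
  have := G.charZero
  have hf : fR m (G.ι θ) = 0 := rt_map G.ι m θ hθ
  have hF : fR n (G.ι ϑ) = 0 := rt_map G.ι n ϑ hϑ
  have ht0 : 0 < G.ι θ := by linarith
  have htT := T_gt m n hmn _ _ ht0 hf hT hF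
  obtain ⟨a0, a1⟩ := root_ne m θ hθ
  obtain ⟨b0, b1⟩ := root_ne n ϑ hϑ
  have hd : 1+θ+ϑ ≠ 0 := by
    intro h
    have := congrArg G.ι h
    rw [map_add, map_add, map_one, map_zero] at this; linarith
  have hz : G.σ ((θ*ϑ-1)/(1+θ+ϑ)) = (θ*ϑ-1)/(1+θ+ϑ) := by
    simp only [map_div₀, map_sub, map_add, map_mul, map_one, hs, hs2]
    have e1 : 1 + -1/(1+θ) + -(1+ϑ)/ϑ = -(1+θ+ϑ)/((1+θ)*ϑ) := by field_simp; ring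
    have e2 : -1/(1+θ)*(-(1+ϑ)/ϑ) - 1 = -(θ*ϑ-1)/((1+θ)*ϑ) := by field_simp; ring
    rw [e1, e2]; field_simp
  obtain ⟨r, hr⟩ := G.fix _ hz
  rw [div_eq_iff hd] at hr
  have hrR := congrArg G.ι hr
  simp only [map_sub, map_add, map_mul, map_one, map_ratCast] at hrR
  set t := G.ι θ
  set T := G.ι ϑ
  have hr0 : (0:ℝ) < r := by
    have h1 : 0 < (r:ℝ)*(1+t+T) := by rw [← hrR]; nlinarith
    exact pos_of_mul_pos_left h1 (by linarith)
  obtain ⟨p, q, hp, hq, hco, hpq⟩ := pq_of_rat r (by exact_mod_cast hr0)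
  have hqr : (0:ℝ) < q := by exact_mod_cast hq
  have hpr : (0:ℝ) < p := by exact_mod_cast hp
  have hrel : T*(q*t - p) = q+p+p*t := by rw [← hpq]; linear_combination (q:ℝ)*hrR
  have hv : 0 < q*t - (p:ℝ) := by
    have h1 : 0 < T*(q*t - p) := by rw [hrel]; positivity
    exact pos_of_mul_pos_right h1 hT.le
  have hFp := FF_neg m t ht0 hf p q hq (by linarith)
  have hH : -n*FF m p q = HH m p q := by
    have hG : (q+p+p*t)^3 - n*(q+p+p*t)^2*(q*t-p) - (n+3)*(q+p+p*t)*(q*t-p)^2 - (q*t-p)^3 = (0:ℝ) := by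
      rw [← hrel]
      have : (T*(q*t-p))^3 - n*(T*(q*t-p))^2*(q*t-p) - (n+3)*(T*(q*t-p))*(q*t-p)^2 - (q*t-p)^3 = (q*t-p)^3*fR n T := by
        unfold fR; ring
      rw [this, hF, mul_zero]
    have hB : ((q+p+p*t)^2*(q*t-p)+(q+p+p*t)*(q*t-p)^2) ≠ 0 := by positivity
    have : ((-n*FF m p q : ℤ):ℝ) = ((HH m p q : ℤ):ℝ) := by
      rw [← sub_eq_zero]
      apply (mul_eq_zero.mp (?_ : ((q+p+p*t)^2*(q*t-p)+(q+p+p*t)*(q*t-p)^2)*_ = 0)).resolve_left hB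
      have hf' := hf
      unfold fR at hf'
      unfold FF HH; push_cast
      linear_combination -(p^2+p*q+q^2)^3*hf' + (p^3-m*p^2*q-(m+3)*p*q^2-q^3)*hG
    exact_mod_cast this
  have hdv := F_dvd m _ _ p q (-n) (Nat.isCoprime_iff_coprime.mpr hco) rfl rfl (by rw [← hH]; ring)
  refine ⟨p, q, hp, hq, hco, hdv, hFp, hH, ?_, hrel⟩
  have : t*(q*t-p) ≤ T*(q*t-p) := by gcongr
  nlinarith
end SC


namespace SC

theorem exp_sum_eq (x y z : ℝ) (k : ℤ) (h0 : x+y+z = 0) (h : x^2+y^2+z^2 < 1)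
    (hk : Real.exp x + Real.exp y + Real.exp z = k) : x = 0 ∧ y = 0 ∧ z = 0 := by
  have hb : ∀ w : ℝ, w^2 < 1 → Real.exp w ≤ 1 + w + w^2 := by
    intro w hw
    have h1 : |w| ≤ 1 := by
      rw [abs_le]; constructor <;> nlinarith
    have := (abs_le.mp (Real.abs_exp_sub_one_sub_id_le h1)).2
    linarith
  have hx := hb x (by nlinarith [sq_nonneg y, sq_nonneg z])
  have hy := hb y (by nlinarith [sq_nonneg x, sq_nonneg z])
  have hz := hb z (by nlinarith [sq_nonneg y, sq_nonneg x])
  have hk4 : (k:ℝ) < 4 := by linarith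
  have hk4' : k < 4 := by exact_mod_cast hk4
  have hk3 : (k:ℝ) ≤ 3 := by exact_mod_cast (by omega : k ≤ 3)
  have lx := Real.add_one_le_exp x
  have ly := Real.add_one_le_exp y
  have lz := Real.add_one_le_exp z
  refine ⟨?_, ?_, ?_⟩ <;> by_contra hc <;> have := Real.add_one_lt_exp hc <;> linarith

variable {E : Type} [Field E]

theorem rt_inv_integral (m : ℤ) (x : E) (h : rt m x) : IsIntegral ℤ x⁻¹ := by
  obtain ⟨h0, -⟩ := root_ne m x h
  have e : x⁻¹ = x^2 - m*x - (m+3) := by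
    have : x*(x^2 - m*x - (m+3)) = 1 := by unfold rt at h; linear_combination h
    exact (eq_inv_of_mul_eq_one_right this).symm
  rw [e]
  have hx := rt_integral m x h
  have hm : IsIntegral ℤ ((m:ℤ):E) := isIntegral_algebraMap (R := ℤ) (x := m)
  have hm3 : IsIntegral ℤ ((m:E)+3) := by
    have : ((m:E)+3) = ((m+3 : ℤ):E) := by push_cast; ring
    rw [this]; exact isIntegral_algebraMap (R := ℤ) (x := m+3)
  exact ((hx.pow 2).sub (hm.mul hx)).sub hm3

theorem zpow_integral (x : E) (h1 : IsIntegral ℤ x) (h2 : IsIntegral ℤ x⁻¹) (k : ℤ) : IsIntegral ℤ (x^k) := by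
  obtain ⟨n, rfl | rfl⟩ := Int.eq_nat_or_neg k
  · rw [zpow_natCast]; exact h1.pow n
  · rw [zpow_neg, zpow_natCast, ← inv_pow]; exact h2.pow n

/-- discreteness of the logarithmic lattice -/
theorem unit_disc (G : GS E) (u : E) (hu0 : u ≠ 0) (hu : IsIntegral ℤ u)
    (h0 : Real.log |G.ι u| + Real.log |G.ι (G.σ u)| + Real.log |G.ι (G.σ (G.σ u))| = 0)
    (h : (Real.log |G.ι u|)^2 + (Real.log |G.ι (G.σ u)|)^2 + (Real.log |G.ι (G.σ (G.σ u))|)^2 < 1/4) :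
    Real.log |G.ι u| = 0 ∧ Real.log |G.ι (G.σ u)| = 0 ∧ Real.log |G.ι (G.σ (G.σ u))| = 0 := by
  have hσi : ∀ x, IsIntegral ℤ x → IsIntegral ℤ (G.σ x) := fun x hx => hx.map (G.σ.toIntAlgHom)
  have hσ0 : ∀ x, x ≠ 0 → G.σ x ≠ 0 := fun x hx => (map_ne_zero G.σ).mpr hx
  have hι0 : ∀ x, x ≠ 0 → G.ι x ≠ 0 := fun x hx => (map_ne_zero G.ι).mpr hx
  have hN : G.σ (u^2 + (G.σ u)^2 + (G.σ (G.σ u))^2) = u^2 + (G.σ u)^2 + (G.σ (G.σ u))^2 := by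
    simp only [map_add, map_pow, G.cub]; ring
  obtain ⟨k, hk⟩ := G.int _ hN (((hu.pow 2).add ((hσi _ hu).pow 2)).add ((hσi _ (hσi _ hu)).pow 2))
  have hkR := congrArg G.ι hk
  simp only [map_add, map_pow, map_intCast] at hkR
  have he : ∀ w : ℝ, w ≠ 0 → w^2 = Real.exp (2*Real.log |w|) := by
    intro w hw
    rw [two_mul, Real.exp_add, Real.exp_log (abs_pos.mpr hw), ← sq, sq_abs]
  rw [he _ (hι0 _ hu0), he _ (hι0 _ (hσ0 _ hu0)), he _ (hι0 _ (hσ0 _ (hσ0 _ hu0)))] at hkR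
  obtain ⟨e1, e2, e3⟩ := exp_sum_eq _ _ _ k (by linarith) (by nlinarith) hkR
  exact ⟨by linarith, by linarith, by linarith⟩

/-- simultaneous approximation by pigeonhole -/
theorem pigeon (α β : ℝ) (T0 : ℕ) (hT0 : 0 < T0) : ∃ (k : ℕ) (x y : ℤ), 1 ≤ k ∧ k ≤ T0^2 ∧
    |k*α - x| ≤ 1/T0 ∧ |k*β - y| ≤ 1/T0 := by
  have hTr : (0:ℝ) < T0 := by exact_mod_cast hT0
  have hfl : ∀ z : ℝ, ⌊T0*Int.fract z⌋₊ < T0 := by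
    intro z
    rw [Nat.floor_lt (mul_nonneg hTr.le (Int.fract_nonneg z))]
    have := Int.fract_lt_one z
    nlinarith
  obtain ⟨i, hi, j, hj, hne, hij⟩ := Finset.exists_ne_map_eq_of_card_lt_of_maps_to
    (s := Finset.range (T0^2+1)) (t := Finset.range T0 ×ˢ Finset.range T0)
    (f := fun k : ℕ => (⌊T0*Int.fract (k*α)⌋₊, ⌊T0*Int.fract (k*β)⌋₊))
    (by simp [sq]) (by
      intro k _
      simp only [Finset.coe_product, Finset.coe_range, Set.mem_prod, Set.mem_Iio]
      exact ⟨hfl _, hfl _⟩)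
  wlog hlt : i < j generalizing i j
  · exact this j hj i hi hne.symm hij.symm (by omega)
  rw [Finset.mem_range] at hi hj
  have key : ∀ z : ℝ, ⌊T0*Int.fract (i*z)⌋₊ = ⌊T0*Int.fract (j*z)⌋₊ →
      |((j-i : ℕ):ℝ)*z - ((⌊j*z⌋ - ⌊i*z⌋ : ℤ):ℝ)| ≤ 1/T0 := by
    intro z hz
    have e : ((j-i : ℕ):ℝ)*z - ((⌊j*z⌋ - ⌊i*z⌋ : ℤ):ℝ) = Int.fract (j*z) - Int.fract (i*z) := by
      rw [Nat.cast_sub hlt.le]; push_cast; unfold Int.fract; ring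
    rw [e, le_div_iff₀ hTr]
    have n1 := Nat.floor_le (mul_nonneg hTr.le (Int.fract_nonneg (i*z)))
    have n2 := Nat.floor_le (mul_nonneg hTr.le (Int.fract_nonneg (j*z)))
    have n3 := Nat.lt_floor_add_one (T0*Int.fract (i*z))
    have n4 := Nat.lt_floor_add_one (T0*Int.fract (j*z))
    rw [hz] at n1 n3
    have : |Int.fract (j*z) - Int.fract (i*z)| * T0 = |T0*Int.fract (j*z) - T0*Int.fract (i*z)| := by
      rw [← mul_sub, abs_mul, abs_of_pos hTr]; ring
    rw [this, abs_le]
    constructor <;> linarith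
  have h1 := congrArg Prod.fst hij
  have h2 := congrArg Prod.snd hij
  exact ⟨j-i, ⌊j*α⌋ - ⌊i*α⌋, ⌊j*β⌋ - ⌊i*β⌋, by omega, by omega, key α h1, key β h2⟩

theorem usm (a c D ε δ : ℝ) (hD : D = a^2-a*c+c^2) (hDp : 0 < D) (T0 : ℕ) (hTr : (0:ℝ) < T0)
    (hT0 : 24*D < T0^2) (hx : |ε| ≤ 1/T0) (hy : |δ| ≤ 1/T0) :
    (ε*a - δ*c)^2 + (-ε*c + δ*(c-a))^2 + (ε*(c-a) + δ*a)^2 < 1/4 := by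
  have e : (ε*a - δ*c)^2 + (-ε*c + δ*(c-a))^2 + (ε*(c-a) + δ*a)^2 = 2*D*(ε^2+δ^2-ε*δ) := by
    rw [hD]; ring
  have s1 : |ε|^2 ≤ (1/T0)^2 := by gcongr
  have s2 : |δ|^2 ≤ (1/T0)^2 := by gcongr
  have s3 : |ε| * |δ| ≤ (1/T0)*(1/T0) := by gcongr
  have s4 : -(ε*δ) ≤ |ε| * |δ| := by rw [← abs_mul]; exact neg_le_abs _
  rw [sq_abs] at s1 s2
  rw [e]
  have : 2*D*(ε^2+δ^2-ε*δ) ≤ 2*D*(3*(1/T0:ℝ)^2) := by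
    apply mul_le_mul_of_nonneg_left _ (by linarith)
    nlinarith
  have h6 : 2*D*(3*(1/T0:ℝ)^2) < (1/4:ℝ) := by
    have : 2*D*(3*(1/T0:ℝ)^2) = (6*D)/T0^2 := by field_simp; ring
    rw [this, div_lt_iff₀ (by positivity)]; linarith
  linarith

/-- abstract lattice statement: `ϑ` is a unit with log vector `(A, Y, -A-Y)` -/
theorem unit_rel (G : GS E) (m n : ℤ) (θ ϑ : E) (hθ : rt m θ) (hϑ : rt n ϑ)
    (hs : G.σ θ = -1/(1+θ)) (ht : 0 < G.ι θ) (a c A Y : ℝ) (ha : a = Real.log (G.ι θ))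
    (hc : c = Real.log (1+G.ι θ)) (hA : A = Real.log |G.ι ϑ|) (hY : Y = Real.log |G.ι (G.σ ϑ)|)
    (hZ : -A-Y = Real.log |G.ι (G.σ (G.σ ϑ))|) (hcp : 0 < c) (T0 : ℕ) (hT0 : 24*(a^2-a*c+c^2) < T0^2) :
    ∃ (k : ℕ) (x y : ℤ), 1 ≤ k ∧ k ≤ T0^2 ∧ k*A = x*a - y*c ∧ k*Y = -x*c + y*(c-a) := by
  obtain ⟨h0, h1⟩ := root_ne m θ hθ
  obtain ⟨b0, -⟩ := root_ne n ϑ hϑ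
  have hσ2 : G.σ (-1/(1+θ)) = -(1+θ)/θ := by
    rw [map_div₀, map_neg, map_one, map_add, map_one, hs]
    have : 1 + -1/(1+θ) = θ/(1+θ) := by field_simp; ring
    rw [this]; field_simp
  have hσ3 : G.σ (-(1+θ)/θ) = θ := by
    have := G.cub θ
    rw [hs, hσ2] at this; exact this
  have hDp : 0 < a^2-a*c+c^2 := by nlinarith [sq_nonneg (a-c/2)]
  have hT0p : 0 < T0 := by
    rcases Nat.eq_zero_or_pos T0 with h | h
    · rw [h] at hT0; norm_num at hT0; linarith
    · exact h
  set D := a^2-a*c+c^2 with hD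
  obtain ⟨k, x, y, hk1, hk2, hx, hy⟩ := pigeon ((A*(a-c) - Y*c)/D) ((-(A*c)-Y*a)/D) T0 hT0p
  set α := (A*(a-c) - Y*c)/D with hα
  set β := (-(A*c)-Y*a)/D with hβ
  have eA : A = α*a - β*c := by
    rw [hα, hβ]; field_simp; rw [hD]; ring
  have eY : Y = -α*c + β*(c-a) := by
    rw [hα, hβ]; field_simp; rw [hD]; ring
  refine ⟨k, x, y, hk1, hk2, ?_⟩
  obtain ⟨θ', hθ'⟩ : ∃ w, w = -1/(1+θ) := ⟨_, rfl⟩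
  have hθ'r : rt m θ' := by rw [hθ']; exact root_next m θ hθ
  obtain ⟨θ'', hθ''⟩ : ∃ w, w = -(1+θ)/θ := ⟨_, rfl⟩
  rw [← hθ'] at hs hσ2
  rw [← hθ''] at hσ2 hσ3
  have h0' : θ' ≠ 0 := (root_ne m θ' hθ'r).1
  have l0 : Real.log |G.ι θ| = a := by rw [abs_of_pos ht, ha]
  have l1 : Real.log |G.ι θ'| = -c := by
    rw [hθ']; simp only [map_div₀, map_neg, map_add, map_one]
    rw [neg_div, abs_neg, abs_of_pos (by positivity), one_div, Real.log_inv, hc]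
  have l2 : Real.log |G.ι θ''| = c - a := by
    rw [hθ'']; simp only [map_div₀, map_neg, map_add, map_one]
    rw [neg_div, abs_neg, abs_of_pos (by positivity), Real.log_div (by positivity) ht.ne', hc, ha]
  have hθ''0 : θ'' ≠ 0 := by rw [← hσ2]; exact (map_ne_zero G.σ).mpr h0'
  set u := ϑ^(k:ℤ) * θ^(-x) * θ'^(-y) with hu
  have hι0 : ∀ x, x ≠ 0 → |G.ι x| ≠ 0 := fun x hx => abs_ne_zero.mpr ((map_ne_zero G.ι).mpr hx)
  have hlog : ∀ p q r : E, p ≠ 0 → q ≠ 0 → r ≠ 0 → Real.log |G.ι (p^(k:ℤ) * q^(-x) * r^(-y))| =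
      k*Real.log |G.ι p| - x*Real.log |G.ι q| - y*Real.log |G.ι r| := by
    intro p q r hp hq hr
    simp only [map_mul, map_zpow₀, abs_mul, abs_zpow]
    rw [Real.log_mul (mul_ne_zero (zpow_ne_zero _ (hι0 _ hp)) (zpow_ne_zero _ (hι0 _ hq)))
      (zpow_ne_zero _ (hι0 _ hr)), Real.log_mul (zpow_ne_zero _ (hι0 _ hp)) (zpow_ne_zero _ (hι0 _ hq)),
      Real.log_zpow, Real.log_zpow, Real.log_zpow]
    push_cast; ring
  have b1 : G.σ ϑ ≠ 0 := (map_ne_zero G.σ).mpr b0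
  have b2 : G.σ (G.σ ϑ) ≠ 0 := (map_ne_zero G.σ).mpr b1
  have u0 : Real.log |G.ι u| = k*A - x*a - y*(-c) := by
    rw [hu, hlog _ _ _ b0 h0 h0', l0, l1, hA]
  have hσu : G.σ u = (G.σ ϑ)^(k:ℤ) * θ'^(-x) * θ''^(-y) := by
    rw [hu]; simp only [map_mul, map_zpow₀, hs, hσ2]
  have hσσu : G.σ (G.σ u) = (G.σ (G.σ ϑ))^(k:ℤ) * θ''^(-x) * θ^(-y) := by
    rw [hσu]; simp only [map_mul, map_zpow₀, hσ2, hσ3]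
  have u1 : Real.log |G.ι (G.σ u)| = k*Y - x*(-c) - y*(c-a) := by
    rw [hσu, hlog _ _ _ b1 h0' hθ''0, l1, l2, hY]
  have u2 : Real.log |G.ι (G.σ (G.σ u))| = k*(-A-Y) - x*(c-a) - y*a := by
    rw [hσσu, hlog _ _ _ b2 hθ''0 h0, l0, l2, hZ]
  have hu0 : u ≠ 0 := mul_ne_zero (mul_ne_zero (zpow_ne_zero _ b0) (zpow_ne_zero _ h0)) (zpow_ne_zero _ h0')
  have hui : IsIntegral ℤ u :=
    ((zpow_integral _ (rt_integral n ϑ hϑ) (rt_inv_integral n ϑ hϑ) _).mul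
      (zpow_integral _ (rt_integral m θ hθ) (rt_inv_integral m θ hθ) _)).mul
      (zpow_integral _ (rt_integral m θ' hθ'r) (rt_inv_integral m θ' hθ'r) _)
  obtain ⟨ε, hε⟩ : ∃ ε, ε = k*α - x := ⟨_, rfl⟩
  obtain ⟨δ, hδ⟩ : ∃ δ, δ = k*β - y := ⟨_, rfl⟩
  rw [← hε] at hx
  rw [← hδ] at hy
  have w0 : k*A - x*a - y*(-c) = ε*a - δ*c := by rw [eA, hε, hδ]; ring
  have w1 : k*Y - x*(-c) - y*(c-a) = -ε*c + δ*(c-a) := by rw [eY, hε, hδ]; ring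
  have w2 : k*(-A-Y) - x*(c-a) - y*a = ε*(c-a) + δ*a := by rw [eA, eY, hε, hδ]; ring
  have hTr : (0:ℝ) < T0 := by exact_mod_cast hT0p
  have hsm : (ε*a - δ*c)^2 + (-ε*c + δ*(c-a))^2 + (ε*(c-a) + δ*a)^2 < 1/4 := usm a c D ε δ hD hDp T0 hTr hT0 hx hy
  obtain ⟨r0, r1, r2⟩ := unit_disc G u hu0 hui (by rw [u0, u1, u2]; ring) (by rw [u0, u1, u2, w0, w1, w2]; exact hsm)
  rw [u0] at r0
  rw [u1] at r1
  exact ⟨by linarith, by linarith⟩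
end SC


namespace SC

theorem unit_case1 (a c A B D : ℝ) (hD : D = a^2-a*c+c^2) (ha : 0 < a) (hac : a < c) (hA : a ≤ A)
    (hB : 0 < B) (hBb : B < c-a) (k : ℕ) (hk : 1 ≤ k) (x y : ℤ) (h1 : k*A = x*a - y*c)
    (h2 : k*(-(A+B)) = -x*c + y*(c-a)) :
    ∃ X Z : ℕ, Z + 1 ≤ X ∧ |X*a - Z*c| = k*B ∧ D*X ≤ k*(c*A+c*B) := by
  have hDp : 0 < D := by rw [hD]; nlinarith
  have hkr : (0:ℝ) < k := by exact_mod_cast hk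
  have ex : D*x = k*(A*a+B*c) := by rw [hD]; linear_combination (-1)*(a-c)*h1 + c*h2
  have ey : D*y = k*(a*B-(c-a)*A) := by rw [hD]; linear_combination (c)*h1 + a*h2
  have hx : 0 < x := by
    have : 0 < D*(x:ℝ) := by
      rw [ex]
      have := mul_pos (ha.trans_le hA) ha
      have := mul_pos hB (ha.trans hac)
      positivity
    exact_mod_cast pos_of_mul_pos_right this hDp.le
  have hy : y < 0 := by
    have h3 : a*B < (c-a)*A := by
      have : a*B < a*(c-a) := mul_lt_mul_of_pos_left hBb ha
      have : (c-a)*a ≤ (c-a)*A := mul_le_mul_of_nonneg_left hA (by linarith)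
      linarith
    have : D*(y:ℝ) < 0 := by
      rw [ey]; apply mul_neg_of_pos_of_neg hkr; linarith
    have : (y:ℝ) < 0 := by
      by_contra h; push Not at h
      have := mul_nonneg hDp.le h
      linarith
    exact_mod_cast this
  refine ⟨(x-y).toNat, x.toNat, by omega, ?_, ?_⟩
  · have e1 : (((x-y).toNat : ℕ):ℝ) = x - y := by
      have : (((x-y).toNat : ℕ):ℤ) = x - y := Int.toNat_of_nonneg (by omega)
      exact_mod_cast this
    have e2 : ((x.toNat : ℕ):ℝ) = x := by
      have : ((x.toNat : ℕ):ℤ) = x := Int.toNat_of_nonneg (by omega)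
      exact_mod_cast this
    rw [e1, e2]
    have : (x-y:ℝ)*a - x*c = -(k*B) := by linear_combination -h1 - h2
    rw [this, abs_neg, abs_of_pos (by positivity)]
  · have e1 : (((x-y).toNat : ℕ):ℝ) = x - y := by
      have : (((x-y).toNat : ℕ):ℤ) = x - y := Int.toNat_of_nonneg (by omega)
      exact_mod_cast this
    rw [e1, mul_sub, ex, ey, ← mul_sub]
    apply mul_le_mul_of_nonneg_left _ hkr.le
    have := mul_pos ha hB
    linarith

theorem unit_case2 (a c A B D : ℝ) (hD : D = a^2-a*c+c^2) (ha : 0 < a) (hac : a < c) (hA : a ≤ A)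
    (hB : 0 < B) (hz : (c-a)*B ≤ a*A) (k : ℕ) (hk : 1 ≤ k) (x y : ℤ) (h1 : k*A = x*a - y*c)
    (h2 : k*B = -x*c + y*(c-a)) :
    ∃ X Z : ℕ, Z + 1 ≤ X ∧ |X*a - Z*c| = k*B ∧ D*X ≤ k*(c*A+c*B) := by
  have hDp : 0 < D := by rw [hD]; nlinarith
  have hkr : (0:ℝ) < k := by exact_mod_cast hk
  have ex : D*x = -(k*((c-a)*A+c*B)) := by rw [hD]; linear_combination (-1)*(a-c)*h1 + c*h2
  have ey : D*y = -(k*(c*A+a*B)) := by rw [hD]; linear_combination (c)*h1 + a*h2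
  have hx : x < 0 := by
    have : D*(x:ℝ) < 0 := by
      rw [ex]
      have := mul_pos (sub_pos.mpr hac) (ha.trans_le hA)
      have := mul_pos (ha.trans hac) hB
      have : 0 < k*((c-a)*A+c*B) := by positivity
      linarith
    have : (x:ℝ) < 0 := by
      by_contra h; push Not at h
      have := mul_nonneg hDp.le h
      linarith
    exact_mod_cast this
  have hxy : 0 ≤ x - y := by
    have : 0 ≤ D*((x:ℝ)-y) := by
      rw [mul_sub, ex, ey]
      have : 0 ≤ k*(a*A-(c-a)*B) := mul_nonneg hkr.le (by linarith)
      linarith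
    have : 0 ≤ (x:ℝ)-y := by
      by_contra h; push Not at h
      have := mul_neg_of_pos_of_neg hDp h
      linarith
    exact_mod_cast this
  have e1 : (((-y).toNat : ℕ):ℝ) = -y := by
    have : (((-y).toNat : ℕ):ℤ) = -y := Int.toNat_of_nonneg (by omega)
    exact_mod_cast this
  have e2 : (((x-y).toNat : ℕ):ℝ) = x-y := by
    have : (((x-y).toNat : ℕ):ℤ) = x-y := Int.toNat_of_nonneg (by omega)
    exact_mod_cast this
  refine ⟨(-y).toNat, (x-y).toNat, by omega, ?_, ?_⟩
  · rw [e1, e2]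
    have : (-y:ℝ)*a - (x-y)*c = (k*B) := by linear_combination -h2
    rw [this, abs_of_pos (by positivity)]
  · rw [e1]
    have : D*(-(y:ℝ)) = k*(c*A+a*B) := by linear_combination -ey
    rw [this]
    apply mul_le_mul_of_nonneg_left _ hkr.le
    have := mul_le_mul_of_nonneg_right hac.le hB.le
    linarith

variable {E : Type} [Field E]

theorem unit_use (G : GS E) (m n : ℤ) (θ ϑ : E) (hθ : rt m θ) (hϑ : rt n ϑ)
    (hs : G.σ θ = -1/(1+θ)) (hs2 : G.σ ϑ = -1/(1+ϑ) ∨ G.σ ϑ = -(1+ϑ)/ϑ) (t T a c A B : ℝ)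
    (htE : t = G.ι θ) (hTE : T = G.ι ϑ) (ht : 1 < t) (htT : t < T)
    (ha : a = Real.log t) (hc : c = Real.log (1+t)) (hA : A = Real.log T) (hB : B = Real.log (1+T) - Real.log T)
    (hz : (c-a)*B ≤ a*A) (T0 : ℕ) (hT0 : 24*(a^2-a*c+c^2) < T0^2) :
    ∃ k X Z : ℕ, 1 ≤ k ∧ k ≤ T0^2 ∧ Z + 1 ≤ X ∧ |X*a - Z*c| = k*B ∧ (a^2-a*c+c^2)*X ≤ k*(c*A+c*B) := by
  have hTp : 0 < T := by linarith
  have htp : 0 < t := by linarith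
  obtain ⟨b0, b1⟩ := root_ne n ϑ hϑ
  have ha0 : 0 < a := by rw [ha]; exact Real.log_pos ht
  have hac : a < c := by rw [ha, hc]; exact Real.log_lt_log htp (by linarith)
  have haA : a ≤ A := by rw [ha, hA]; exact Real.log_le_log htp htT.le
  have hB0 : 0 < B := by rw [hB, sub_pos]; exact Real.log_lt_log hTp (by linarith)
  have hBb : B < c - a := by
    rw [hB, ha, hc, ← Real.log_div (by positivity) (by positivity), ← Real.log_div (by positivity) (by positivity)]
    apply Real.log_lt_log (by positivity)
    rw [div_lt_div_iff₀ hTp htp]; linarith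
  have hAabs : A = Real.log |G.ι ϑ| := by rw [← hTE, abs_of_pos hTp, hA]
  have v1 : Real.log |G.ι (-1/(1+ϑ))| = -(A+B) := by
    simp only [map_div₀, map_neg, map_add, map_one]
    rw [← hTE, neg_div, abs_neg, abs_of_pos (by positivity), one_div, Real.log_inv, hA, hB]; ring
  have v2 : Real.log |G.ι (-(1+ϑ)/ϑ)| = B := by
    simp only [map_div₀, map_neg, map_add, map_one]
    rw [← hTE, neg_div, abs_neg, abs_of_pos (by positivity), Real.log_div (by positivity) hTp.ne', hB]
  rcases hs2 with h | h
  · have h2 : G.σ (G.σ ϑ) = -(1+ϑ)/ϑ := by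
      rw [h, map_div₀, map_neg, map_one, map_add, map_one, h]
      have : 1 + -1/(1+ϑ) = ϑ/(1+ϑ) := by field_simp; ring
      rw [this]; field_simp
    obtain ⟨k, x, y, k1, k2, e1, e2⟩ := unit_rel G m n θ ϑ hθ hϑ hs (by rw [← htE]; exact htp) a c A (-(A+B))
      (by rw [← htE, ha]) (by rw [← htE, hc]) hAabs (by rw [h, v1]) (by rw [h2, v2]; ring) (by linarith) T0 hT0
    obtain ⟨X, Z, r1, r2, r3⟩ := unit_case1 a c A B _ rfl ha0 hac haA hB0 hBb k k1 x y e1 e2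
    exact ⟨k, X, Z, k1, k2, r1, r2, r3⟩
  · have h2 : G.σ (G.σ ϑ) = -1/(1+ϑ) := by
      rw [h, map_div₀, map_neg, map_add, map_one, h]
      have : 1 + -(1+ϑ)/ϑ = -1/ϑ := by field_simp; ring
      rw [this]; field_simp
    obtain ⟨k, x, y, k1, k2, e1, e2⟩ := unit_rel G m n θ ϑ hθ hϑ hs (by rw [← htE]; exact htp) a c A B
      (by rw [← htE, ha]) (by rw [← htE, hc]) hAabs (by rw [h, v2]) (by rw [h2, v1]; ring) (by linarith) T0 hT0
    obtain ⟨X, Z, r1, r2, r3⟩ := unit_case2 a c A B _ rfl ha0 hac haA hB0 hz k k1 x y e1 e2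
    exact ⟨k, X, Z, k1, k2, r1, r2, r3⟩
end SC


namespace SC

theorem baker_num (X : ℕ) (hX : 10^32 < X) : ∃ L : ℕ, 1000 ≤ L ∧ 401*L ≤ X ∧ (X:ℝ) ≤ Real.exp (L/24) ∧
    10^10*(L:ℝ)^4 + 2000 ≤ (X:ℝ)/2450 := by
  have hXr : (10:ℝ)^32 < X := by exact_mod_cast hX
  have hX0 : (0:ℝ) < X := by linarith [show (0:ℝ) < 10^32 by norm_num]
  obtain ⟨z, hz⟩ : ∃ z : ℝ, z = (X:ℝ)^((1:ℝ)/16) := ⟨_, rfl⟩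
  have hz0 : 0 < z := by rw [hz]; positivity
  have hz16 : z^16 = X := by
    rw [hz, ← Real.rpow_natCast, ← Real.rpow_mul hX0.le]; norm_num
  have hz100 : 100 ≤ z := by
    by_contra h
    push Not at h
    have : z^16 < 100^16 := by gcongr
    rw [hz16] at this
    norm_num at this hXr
    linarith
  have hlog : Real.log X ≤ 16*(z-1) := by
    rw [← hz16, Real.log_pow]
    have := Real.log_le_sub_one_of_pos hz0
    push_cast; linarith
  have hlog1 : 64 ≤ Real.log X := by
    have h2 := Real.log_two_gt_d9
    have : Real.log (2^96) ≤ Real.log X := by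
      apply Real.log_le_log (by norm_num)
      refine le_trans ?_ hXr.le
      norm_num
    rw [Real.log_pow] at this
    push_cast at this; linarith
  have c1 := Nat.le_ceil (24*Real.log X)
  have c2 := Nat.ceil_lt_add_one (a := 24*Real.log X) (by linarith)
  refine ⟨⌈24*Real.log X⌉₊, ?_⟩
  set L := ⌈24*Real.log X⌉₊
  have hL1 : (1536:ℝ) ≤ L := by linarith
  have hL2 : (L:ℝ) ≤ 384*z := by linarith
  have h15 : (100:ℝ)^15 ≤ z^15 := by gcongr
  have h12 : (100:ℝ)^12 ≤ z^12 := by gcongr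
  refine ⟨?_, ?_, ?_, ?_⟩
  · exact_mod_cast (by linarith : (1000:ℝ) ≤ L)
  · have : (401:ℝ)*L ≤ X := by
      rw [← hz16, show z^16 = z^15*z by ring]
      have : (100:ℝ)^15*z ≤ z^15*z := by gcongr
      norm_num at this
      linarith
    exact_mod_cast this
  · rw [← Real.log_le_iff_le_exp hX0]; linarith
  · have e1 : (L:ℝ)^4 ≤ (384*z)^4 := by gcongr
    have e2 : (100:ℝ)^12*z^4 ≤ z^12*z^4 := by gcongr
    have e3 : (100:ℝ)^4 ≤ z^4 := by gcongr
    rw [← hz16, show z^16 = z^12*z^4 by ring, mul_pow] at *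
    norm_num at e1 e2 e3
    linarith

variable {E : Type} [Field E]

theorem small_contra (G : GS E) (m n : ℤ) (θ ϑ : E) (hθ : rt m θ) (hϑ : rt n ϑ)
    (hs : G.σ θ = -1/(1+θ)) (hs2 : G.σ ϑ = -1/(1+ϑ) ∨ G.σ ϑ = -(1+ϑ)/ϑ) (t T : ℝ)
    (htE : t = G.ι θ) (hTE : T = G.ι ϑ) (ht : 6/5 ≤ t) (hf : fR m t = 0) (hm1 : -1 ≤ m) (hm : m ≤ 999)
    (ht3 : t ≤ m + 3) (hT : 2^140 ≤ T) : False := by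
  have htp : 0 < t := by linarith
  have hmr : (m:ℝ) ≤ 999 := by exact_mod_cast hm
  norm_num at hT
  have hTp : 0 < T := by linarith
  obtain ⟨a, ha⟩ : ∃ a, a = Real.log t := ⟨_, rfl⟩
  obtain ⟨c, hc⟩ : ∃ a, a = Real.log (1+t) := ⟨_, rfl⟩
  obtain ⟨A, hA⟩ : ∃ a, a = Real.log T := ⟨_, rfl⟩
  obtain ⟨B, hB⟩ : ∃ a, a = Real.log (1+T) - Real.log T := ⟨_, rfl⟩
  have ha6 : 1/6 ≤ a := by
    have := Real.one_sub_inv_le_log_of_pos htp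
    have h2 : t⁻¹ ≤ (6/5)⁻¹ := inv_anti₀ (by norm_num) ht
    norm_num at h2
    linarith
  have hac : a < c := by rw [ha, hc]; exact Real.log_lt_log htp (by linarith)
  have hca : c - a ≤ 1 := by
    rw [ha, hc, ← Real.log_div (by positivity) (by positivity)]
    have := Real.log_le_sub_one_of_pos (x := (1+t)/t) (by positivity)
    have e : (1+t)/t - 1 = 1/t := by field_simp; ring
    have : 1/t ≤ 1 := by rw [div_le_one htp]; linarith
    linarith
  have hBT : B ≤ 1/T := by
    rw [hB, ← Real.log_div (by positivity) (by positivity)]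
    have := Real.log_le_sub_one_of_pos (x := (1+T)/T) (by positivity)
    have e : (1+T)/T - 1 = 1/T := by field_simp; ring
    linarith
  have hB0 : 0 < B := by rw [hB, sub_pos]; exact Real.log_lt_log hTp (by linarith)
  have hB1 : B ≤ 1/6 := by
    refine hBT.trans ?_
    apply div_le_div_of_nonneg_left (by norm_num) (by norm_num); linarith
  have hc7 : c ≤ 7 := by
    rw [hc, Real.log_le_iff_le_exp (by linarith)]
    have h1 := Real.exp_one_gt_d9
    have : Real.exp 7 = (Real.exp 1)^7 := by rw [← Real.exp_nat_mul]; norm_num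
    rw [this]
    have : (2.71:ℝ)^7 ≤ (Real.exp 1)^7 := by gcongr; linarith
    norm_num at this
    linarith
  have hc1 : 2/3 ≤ c := by
    rw [hc]
    have h2 := Real.log_two_gt_d9
    have : Real.log 2 ≤ Real.log (1+t) := Real.log_le_log (by norm_num) (by linarith)
    linarith
  have hA1 : 1 ≤ A := by
    rw [hA, Real.le_log_iff_exp_le hTp]
    have := Real.exp_one_lt_d9; linarith
  have hz : (c-a)*B ≤ a*A := by
    calc (c-a)*B ≤ 1*(1/6) := by gcongr
      _ ≤ a*1 := by linarith
      _ ≤ a*A := by gcongr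
  have hD2 : a^2-a*c+c^2 ≤ 49 := by nlinarith
  have hD1 : 3/4*c^2 ≤ a^2-a*c+c^2 := by nlinarith [sq_nonneg (a-c/2)]
  have htT : t < T := by linarith
  obtain ⟨k, X, Z, k1, k2, hZX, hΛ, hX⟩ := unit_use G m n θ ϑ hθ hϑ hs hs2 t T a c A B htE hTE (by linarith) htT
    ha hc hA hB hz 35 (by norm_num; linarith)
  have hkr : (k:ℝ) ≤ 1225 := by exact_mod_cast k2
  have hkp : (1:ℝ) ≤ k := by exact_mod_cast k1
  have hkB : k*B ≤ 1225/T := by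
    calc k*B ≤ 1225*(1/T) := by gcongr
      _ = _ := by ring
  have hXA : (X:ℝ) ≤ 2450*(A+1) := by
    have h1 : 3/4*c^2*X ≤ k*(c*A+c*B) := (mul_le_mul_of_nonneg_right hD1 (by positivity)).trans hX
    have h2 : c*(3/4*c*X) ≤ c*(k*(A+B)) := by linarith
    have h3 := le_of_mul_le_mul_left h2 (by linarith)
    have h4 : 3/4*(2/3)*X ≤ 3/4*c*(X:ℝ) := by gcongr
    have h5 : k*(A+B) ≤ 1225*(A+1) := by gcongr; linarith
    linarith
  -- reduce
  obtain ⟨g, hg⟩ : ∃ g, g = Nat.gcd X Z := ⟨_, rfl⟩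
  have hg0 : 0 < g := by rw [hg]; exact Nat.gcd_pos_of_pos_left _ (by omega)
  obtain ⟨X', hX'⟩ : g ∣ X := by rw [hg]; exact Nat.gcd_dvd_left _ _
  obtain ⟨Z', hZ'⟩ : g ∣ Z := by rw [hg]; exact Nat.gcd_dvd_right _ _
  have hco : Nat.Coprime X' Z' := by
    have h1 : Nat.gcd (g*X') (g*Z') = g * 1 := by rw [← hX', ← hZ', ← hg, mul_one]
    rw [Nat.gcd_mul_left] at h1
    exact Nat.eq_of_mul_eq_mul_left hg0 h1
  have hX'0 : 0 < X' := by
    rcases Nat.eq_zero_or_pos X' with h | h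
    · rw [h, mul_zero] at hX'; omega
    · exact h
  have hZX' : Z' ≤ X' := by
    have : g*Z' ≤ g*X' := by rw [← hX', ← hZ']; omega
    exact Nat.le_of_mul_le_mul_left this hg0
  have hgr : (1:ℝ) ≤ g := by exact_mod_cast hg0
  have hΛ' : |X'*a - Z'*c| ≤ 1225/T := by
    have e : (X:ℝ)*a-Z*c = g*(X'*a-Z'*c) := by rw [hX', hZ']; push_cast; ring
    rw [e, abs_mul, abs_of_pos (by linarith)] at hΛ
    have : 1*|X'*a-Z'*c| ≤ g*|X'*a-Z'*c| := by gcongr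
    linarith
  have hX'A : (X':ℝ) ≤ 2450*(A+1) := by
    refine le_trans ?_ hXA
    have : X' ≤ X := by rw [hX']; exact Nat.le_mul_of_pos_left _ hg0
    exact_mod_cast this
  rcases Nat.lt_or_ge (10^32) X' with hbig | hsm
  · obtain ⟨L, l1, l2, l3, l4⟩ := baker_num X' hbig
    have NH : NormHyp t := by rw [htE]; exact normHyp_of G m θ hθ hs
    refine baker t (by linarith) (by rw [← hc]; exact hc7) NH X' Z' L hco hZX' l1 l2 l3 ?_
    rw [← ha, ← hc]
    refine hΛ'.trans ?_
    have hTA : T = Real.exp A := by rw [hA, Real.exp_log hTp]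
    have h1225 : (1225:ℝ) ≤ Real.exp 1225 := by linarith [Real.add_one_le_exp (1225:ℝ)]
    rw [hTA, div_le_iff₀ (Real.exp_pos _), ← Real.exp_add]
    refine h1225.trans (Real.exp_le_exp.mpr ?_)
    have : (X':ℝ)/2450 ≤ A+1 := by rw [div_le_iff₀ (by norm_num)]; linarith
    linarith
  · have := red_use m hm1 hm t htp hf X' Z' hX'0 hsm hZX'
    rw [← ha, ← hc] at this
    have h1 := this.trans hΛ'
    rw [div_le_div_iff₀ (by norm_num) hTp] at h1
    norm_num at h1
    linarith

end SC


namespace SC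

theorem gap_c (t c : ℝ) (ht : 6500 ≤ t) (hc : c = Real.log (1+t)) : 87/10 ≤ c ∧ 2*(5*c+1)^2 ≤ t := by
  have hexp : Real.exp c = 1+t := by rw [hc, Real.exp_log (by linarith)]
  have h1 : 87/10 ≤ c := by
    rw [hc, Real.le_log_iff_exp_le (by linarith)]
    have e1 : Real.exp (87/10) * Real.exp (3/10) = Real.exp 9 := by
      rw [← Real.exp_add]; norm_num
    have e2 : Real.exp 9 ≤ 2.7183^9 := by
      have := Real.exp_one_lt_d9
      have e : Real.exp 9 = Real.exp 1^9 := by rw [← Real.exp_nat_mul]; norm_num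
      rw [e]
      gcongr; linarith
    have e3 := Real.quadratic_le_exp_of_nonneg (x := 3/10) (by norm_num)
    norm_num at e2 e3
    have e4 : Real.exp (87/10) * (269/200) ≤ Real.exp (87/10) * Real.exp (3/10) := by gcongr
    linarith
  refine ⟨h1, ?_⟩
  have e1 : Real.exp 8 * Real.exp (c-8) = 1+t := by rw [← hexp, ← Real.exp_add]; congr 1; ring
  have e2 : (2.718:ℝ)^8 ≤ Real.exp 8 := by
    have := Real.exp_one_gt_d9
    have e : Real.exp 8 = Real.exp 1^8 := by rw [← Real.exp_nat_mul]; norm_num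
    rw [e]; gcongr; linarith
  have e3 := Real.quadratic_le_exp_of_nonneg (x := c-8) (by linarith)
  have e2' : (2978:ℝ) ≤ Real.exp 8 := le_trans (by norm_num) e2
  have e4 : 2978*(1+(c-8)+(c-8)^2/2) ≤ Real.exp 8 * Real.exp (c-8) := by
    apply mul_le_mul e2' e3 _ (Real.exp_pos _).le
    nlinarith
  rw [e1] at e4
  nlinarith

theorem gap_a (a : ℝ) (h : 8699/1000 ≤ a) : (5*(a+1/1000)+1)^2 ≤ 28*(a*(a-1/2)) := by
  have := mul_nonneg (sub_nonneg.mpr h) (by linarith : 0 ≤ a)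
  nlinarith

variable {E : Type} [Field E]

theorem gap (G : GS E) (m n : ℤ) (θ ϑ : E) (hθ : rt m θ) (hϑ : rt n ϑ)
    (hs : G.σ θ = -1/(1+θ)) (hs2 : G.σ ϑ = -1/(1+ϑ) ∨ G.σ ϑ = -(1+ϑ)/ϑ) (t T : ℝ)
    (htE : t = G.ι θ) (hTE : T = G.ι ϑ) (ht : 6500 ≤ t) (htT : t < T) : t/28 - 1/1000 ≤ Real.log T := by
  have htp : 0 < t := by linarith
  have hTp : 0 < T := by linarith
  obtain ⟨a, ha⟩ : ∃ a, a = Real.log t := ⟨_, rfl⟩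
  obtain ⟨c, hc⟩ : ∃ a, a = Real.log (1+t) := ⟨_, rfl⟩
  obtain ⟨A, hA⟩ : ∃ a, a = Real.log T := ⟨_, rfl⟩
  obtain ⟨B, hB⟩ : ∃ a, a = Real.log (1+T) - Real.log T := ⟨_, rfl⟩
  obtain ⟨hc8, hct⟩ := gap_c t c ht hc
  have hac : a < c := by rw [ha, hc]; exact Real.log_lt_log htp (by linarith)
  have hca : c - a ≤ 1/t := by
    rw [ha, hc, ← Real.log_div (by positivity) (by positivity)]
    have := Real.log_le_sub_one_of_pos (x := (1+t)/t) (by positivity)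
    have e : (1+t)/t - 1 = 1/t := by field_simp; ring
    linarith
  have hBT : B ≤ 1/T := by
    rw [hB, ← Real.log_div (by positivity) (by positivity)]
    have := Real.log_le_sub_one_of_pos (x := (1+T)/T) (by positivity)
    have e : (1+T)/T - 1 = 1/T := by field_simp; ring
    linarith
  have hB0 : 0 < B := by rw [hB, sub_pos]; exact Real.log_lt_log hTp (by linarith)
  have ht1 : 1/t ≤ 1/1000 := by
    apply div_le_div_of_nonneg_left (by norm_num) (by norm_num); linarith
  have hT1 : 1/T ≤ 1/t := by
    apply div_le_div_of_nonneg_left (by norm_num) htp htT.le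
  have haA : a ≤ A := by rw [ha, hA]; exact Real.log_le_log htp htT.le
  have hz : (c-a)*B ≤ a*A := by
    calc (c-a)*B ≤ 1*1 := by gcongr <;> linarith
      _ ≤ a*A := by nlinarith
  obtain ⟨T0, hT0⟩ : ∃ T0, T0 = ⌈5*c⌉₊ := ⟨_, rfl⟩
  have c1 := Nat.le_ceil (5*c)
  have c2 := Nat.ceil_lt_add_one (a := 5*c) (by linarith)
  rw [← hT0] at c1 c2
  obtain ⟨k, X, Z, k1, k2, hZX, hΛ, hX⟩ := unit_use G m n θ ϑ hθ hϑ hs hs2 t T a c A B htE hTE (by linarith) htT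
    ha hc hA hB hz T0 (by
      have : (5*c)^2 ≤ (T0:ℝ)^2 := by gcongr
      nlinarith)
  have hkp : (1:ℝ) ≤ k := by exact_mod_cast k1
  have hkr : (k:ℝ) ≤ (5*c+1)^2 := by
    have h1 : (k:ℝ) ≤ (T0:ℝ)^2 := by exact_mod_cast k2
    have h2 : (T0:ℝ)^2 ≤ (5*c+1)^2 := by gcongr
    linarith
  have hkB : k*B ≤ 1/2 := by
    calc k*B ≤ (5*c+1)^2*(1/t) := by gcongr; linarith
      _ ≤ (t/2)*(1/t) := by gcongr; linarith
      _ = 1/2 := by field_simp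
  have hs1 : (Z:ℝ)+1 ≤ X := by exact_mod_cast hZX
  have hZ1 : a - 1/2 ≤ Z*(c-a) := by
    have := le_abs_self (X*a-Z*c)
    have : ((Z:ℝ)+1)*a ≤ X*a := by gcongr; linarith
    linarith
  have hZ2 : (a-1/2)*t ≤ Z := by
    have : Z*(c-a) ≤ Z*(1/t) := by gcongr
    have h3 : a-1/2 ≤ Z/t := by
      calc a - 1/2 ≤ Z*(1/t) := by linarith
        _ = Z/t := by ring
    rwa [le_div_iff₀ htp] at h3
  have hXk : a*X ≤ k*(A+B) := by
    have h1 : (a*c)*X ≤ (a^2-a*c+c^2)*X := by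
      gcongr; nlinarith [sq_nonneg (a-c)]
    have h2 : c*(a*X) ≤ c*(k*(A+B)) := by linarith
    exact le_of_mul_le_mul_left h2 (by linarith)
  have ha8 : 8 ≤ a := by linarith
  have h1 : a*((a-1/2)*t) ≤ (5*c+1)^2*(A+B) := by
    calc a*((a-1/2)*t) ≤ a*X := by gcongr; linarith
      _ ≤ k*(A+B) := hXk
      _ ≤ _ := by gcongr; linarith
  have h2 : (5*c+1)^2 ≤ 28*(a*(a-1/2)) := by
    have h3 : c ≤ a + 1/1000 := by linarith
    have : (5*c+1)^2 ≤ (5*(a+1/1000)+1)^2 := by gcongr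
    exact this.trans (gap_a a (by linarith))
  have h3 : (5*c+1)^2*t ≤ (5*c+1)^2*(28*(A+B)) := by
    have : (5*c+1)^2*t ≤ 28*(a*(a-1/2))*t := by gcongr
    linarith
  have h4 := le_of_mul_le_mul_left h3 (by positivity)
  rw [← hA]
  linarith

/-- final contradiction for large `m` -/
theorem large_num (m : ℤ) (hm : 6499 ≤ m) (p : ℕ) (hp : 0 < p) (t T : ℝ) (htm : (m:ℝ)+1 ≤ t) (hT0 : 0 < T)
    (hT : T ≤ (m+5)*(p:ℝ)^3) (hA : t/28 - 1/1000 ≤ Real.log T) : (m^2+3*m+9)^5 ≤ 90000000*(p:ℤ) := by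
  have hmr : (6499:ℝ) ≤ m := by exact_mod_cast hm
  have hpr : (0:ℝ) < p := by exact_mod_cast hp
  have hm5 : (0:ℝ) < m+5 := by linarith
  obtain ⟨l, hl⟩ : ∃ l, l = Real.log ((m:ℝ)+5) := ⟨_, rfl⟩
  have hlog : Real.log T ≤ l + 3*Real.log p := by
    have := Real.log_le_log hT0 hT
    rw [Real.log_mul (by positivity) (by positivity), Real.log_pow, ← hl] at this
    push_cast at this; linarith
  have hl1 : l ≤ 8 + (m+5)/8100 := by
    have e : Real.exp 9 = Real.exp 1^9 := by rw [← Real.exp_nat_mul]; norm_num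
    have e2 : (2.7182:ℝ)^9 ≤ Real.exp 9 := by
      have := Real.exp_one_gt_d9
      rw [e]; gcongr; linarith
    have e3 : (8100:ℝ) ≤ Real.exp 9 := le_trans (by norm_num) e2
    have h1 := Real.log_le_sub_one_of_pos (x := ((m:ℝ)+5)/Real.exp 9) (by positivity)
    rw [Real.log_div (by positivity) (Real.exp_pos _).ne', Real.log_exp, ← hl] at h1
    have h2 : ((m:ℝ)+5)/Real.exp 9 ≤ (m+5)/8100 := by gcongr
    linarith
  have hkey : 10*l ≤ 18 + Real.log p := by linarith
  have e18 : Real.exp 18 ≤ 90000000 := by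
    have e : Real.exp 18 = Real.exp 1^18 := by rw [← Real.exp_nat_mul]; norm_num
    have := Real.exp_one_lt_d9
    have e2 : Real.exp 1^18 ≤ 2.7183^18 := by gcongr; linarith
    rw [e]; refine e2.trans (by norm_num)
  have h10 : ((m:ℝ)+5)^10 = Real.exp (10*l) := by
    rw [hl, ← Real.exp_log (by positivity : 0 < ((m:ℝ)+5)^10), Real.log_pow]; push_cast; ring
  have hN : ((m:ℝ)^2+3*m+9)^5 ≤ ((m:ℝ)+5)^10 := by
    have : ((m:ℝ)+5)^10 = (((m:ℝ)+5)^2)^5 := by ring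
    rw [this]; gcongr; nlinarith
  have : ((m:ℝ)^2+3*m+9)^5 ≤ 90000000*(p:ℝ) := by
    calc _ ≤ Real.exp (10*l) := by rw [← h10]; exact hN
      _ ≤ Real.exp (18+Real.log p) := Real.exp_le_exp.mpr hkey
      _ = Real.exp 18 * p := by rw [Real.exp_add, Real.exp_log hpr]
      _ ≤ _ := by gcongr
  exact_mod_cast this
end SC


namespace SC

theorem T_big (t T : ℝ) (p q : ℕ) (ht : 6/5 ≤ t) (hT : 0 < T) (h4 : 4 ≤ q)
    (l3 : |(p:ℝ)-q*t| ≤ q/2) (l4 : (q:ℝ)^2*|(p:ℝ)-q*t| ≤ 37/20)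
    (hr : p*t ≤ T*|(p:ℝ)-q*t|) : 2/5*(q:ℝ)^3 ≤ T := by
  have hq : (0:ℝ) < q := by exact_mod_cast (by omega : 0 < q)
  have h1 : 7/10*(q:ℝ) ≤ p := by
    have := (abs_le.mp l3).1
    have : (q:ℝ)*(6/5) ≤ q*t := by gcongr
    linarith
  have h2 : 7/10*(q:ℝ)*(6/5) ≤ p*t := by gcongr
  have h3 : (q:ℝ)^2*(7/10*(q:ℝ)*(6/5)) ≤ q^2*(T*|(p:ℝ)-q*t|) := by
    apply mul_le_mul_of_nonneg_left (h2.trans hr); positivity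
  have h4 : T*((q:ℝ)^2*|(p:ℝ)-q*t|) ≤ T*(37/20) := by gcongr
  have h5 : 0 < (q:ℝ)^3 := by positivity
  nlinarith

theorem HH_le (m p q : ℤ) (hm : 0 ≤ m) (hq : 0 < q) (hp : 100*q ≤ p) : HH m p q ≤ (m+4)*p^3 := by
  unfold HH
  have h1 : 0 ≤ (m+3)*(3*p*q^2+q^3) := by
    have : 0 < p := by linarith
    positivity
  have h2 : 9*(p*q*(p+q)) ≤ p^3 := by
    have hp0 : 0 < p := by linarith
    have a1 : 9*(q*(p+q)) ≤ p^2 := by nlinarith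
    have := mul_le_mul_of_nonneg_left a1 hp0.le
    linarith
  linarith

theorem mid_num (m : ℤ) (h1 : 1000 ≤ m) (h2 : m ≤ 6498) (p q : ℤ) (hq : 2^88 ≤ q) (hp : (m-4)*q ≤ p) :
    (m^2+3*m+9)^5 ≤ 90000000*p := by
  have a1 : (m^2+3*m+9)^5 ≤ ((m+2)^2)^5 := by
    have : m^2+3*m+9 ≤ (m+2)^2 := by nlinarith
    have : 0 ≤ m^2+3*m+9 := by positivity
    gcongr
  have a2 : (m+2)^9 ≤ 6500^9 := by
    have : 0 ≤ m + 2 := by linarith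
    gcongr; linarith
  have a3 : ((m+2)^2)^5 ≤ 6500^9*(m+2) := by
    rw [show ((m+2)^2)^5 = (m+2)^9*(m+2) by ring]
    apply mul_le_mul_of_nonneg_right a2; linarith
  have a4 : (m-4)*2^88 ≤ (m-4)*q := by
    apply mul_le_mul_of_nonneg_left hq; linarith
  norm_num at a4 a3
  linarith

theorem pow_aux : 400*(2^88)^3 ≤ 2^276 := by
  calc 400*(2^88)^3 ≤ 2^12*(2^88)^3 := Nat.mul_le_mul_right _ (by norm_num)
    _ = 2^276 := by rw [← pow_mul, ← pow_add]

theorem forward (m n : ℤ) (hm : -1 ≤ m) (hmn : m < n) (hL : L m = L n) : (m, n) ∈ okSet := by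
  obtain ⟨t, ht, hf, htm, htm3⟩ := exists_t m hm
  have htp : 0 < t := by linarith
  obtain ⟨E, _, G, θ, ϑ, htE, hθ, hϑ, hs, hTp, hs2⟩ := gs_pos m n hL t ((rt_fR _ _).mpr hf)
  obtain ⟨T, hTE⟩ : ∃ T, T = G.ι ϑ := ⟨_, rfl⟩
  have hfT : fR n T = 0 := by rw [hTE]; exact (rt_fR _ _).mp (rt_map G.ι n ϑ hϑ)
  have hTp' : 0 < T := by rw [hTE]; exact hTp
  have htT := T_gt m n hmn t T htp hf hTp' hfT
  have hdata : ∃ p q : ℕ, 0 < p ∧ 0 < q ∧ Nat.Coprime p q ∧ FF m p q ∣ m^2+3*m+9 ∧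
      ((0 < FF m p q ∧ (n+3)*FF m p q = HH m p q) ∨
      (FF m p q < 0 ∧ -n*FF m p q = HH m p q ∧ (t^2-1)*q ≤ (2*t+1)*p)) ∧
      (p:ℝ)*t ≤ T*|(p:ℝ)-q*t| := by
    rcases hs2 with h | h
    · obtain ⟨p, q, h1, h2, h3, h4, h5, h6, h7⟩ := B1_case1 G m n hmn θ ϑ hθ hϑ hs h (by rw [htE]; exact htp) hTp
      rw [htE, ← hTE] at h7
      refine ⟨p, q, h1, h2, h3, h4, Or.inl ⟨h5, h6⟩, ?_⟩
      have : T*(p-q*t) ≤ T*|(p:ℝ)-q*t| := by gcongr; exact le_abs_self _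
      have : 0 ≤ (q:ℝ)+q*t := by positivity
      linarith
    · obtain ⟨p, q, h1, h2, h3, h4, h5, h6, h7, h8⟩ := B1_case2 G m n hmn θ ϑ hθ hϑ hs h (by rw [htE]; linarith) hTp
      rw [htE] at h7 h8
      rw [← hTE] at h8
      refine ⟨p, q, h1, h2, h3, h4, Or.inr ⟨h5, h6, h7⟩, ?_⟩
      have : T*(q*t-p) ≤ T*|(p:ℝ)-q*t| := by
        gcongr; rw [abs_sub_comm]; exact le_abs_self _
      have : 0 ≤ (q:ℝ)+p := by positivity
      linarith
  obtain ⟨p, q, hp, hq, hco, hdvd, hc, hpT⟩ := hdata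
  obtain ⟨l1, l2, l3, l4⟩ := loc_main m t p q ht hf hq hdvd (by tauto)
  obtain ⟨M, hM⟩ : ∃ M : ℕ, m + 1 = M := ⟨(m+1).toNat, by omega⟩
  have hqr : (0:ℝ) < q := by exact_mod_cast hq
  rcases lt_or_ge m 1000 with hm1 | hm1
  · rcases Nat.lt_or_ge (2^52) q with hqb | hqs
    · exfalso
      have hT := T_big t T p q ht hTp' (by omega) (l3 (by omega)) (l4 (by omega)) hpT
      refine small_contra G m n θ ϑ hθ hϑ hs hs2 t T htE.symm hTE ht hf hm (by omega) htm3 (le_trans ?_ hT)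
      have h1 : (2:ℝ)^52 ≤ q := by exact_mod_cast hqb.le
      have h2 : ((2:ℝ)^52)^3 ≤ (q:ℝ)^3 := by gcongr
      norm_num at h2 ⊢
      linarith
    · rcases lt_or_ge M 1000 with h | h
      · exact cf_main (2^168) (2^52) M (by norm_num) (by norm_num) (cf_small M h) m n hM hmn t ht hf p q hq hqs
          hco hdvd hc
      · exact cf_main (2^276) (2^88) M (by norm_num) pow_aux (cf_big M h (by omega)) m n hM hmn t ht hf p q hq
          (hqs.trans (by norm_num)) hco hdvd hc
  have hmr : (1000:ℝ) ≤ m := by exact_mod_cast hm1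
  have hNp : 0 < m^2+3*m+9 := by positivity
  have hFN := Int.le_of_dvd hNp ((abs_dvd _ _).mpr hdvd)
  have hpq : (m-4)*(q:ℤ) ≤ p := by
    have : ((m:ℝ)-4)*q ≤ (t-5)*q := mul_le_mul_of_nonneg_right (by linarith) hqr.le
    have h2 : ((m:ℝ)-4)*q ≤ p := by linarith
    exact_mod_cast h2
  have hqz : (0:ℤ) < q := by exact_mod_cast hq
  have hp100 : 100*(q:ℤ) ≤ p := by
    refine le_trans ?_ hpq
    apply mul_le_mul_of_nonneg_right _ hqz.le; linarith
  rcases lt_or_ge m 6499 with hm2 | hm2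
  · rcases Nat.lt_or_ge (2^88) q with hqb | hqs
    · exfalso
      refine hyp m p q (FF m p q) hm1 hqz hp100 rfl hFN (mid_num m hm1 (by omega) p q ?_ hpq)
      exact_mod_cast hqb.le
    · exact cf_main (2^276) (2^88) M (by norm_num) pow_aux (cf_big M (by omega) (by omega)) m n hM hmn t ht hf p q hq
          hqs hco hdvd hc
  · exfalso
    have hm2r : (6499:ℝ) ≤ m := by exact_mod_cast hm2
    have hA := gap G m n θ ϑ hθ hϑ hs hs2 t T htE.symm hTE (by linarith) htT
    have hnH : n ≤ HH m p q := by
      rcases hc with ⟨h1, h2⟩ | ⟨h1, h2, -⟩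
      · rw [← h2]
        have : (n+3)*1 ≤ (n+3)*FF m p q := by
          apply mul_le_mul_of_nonneg_left (by omega); linarith
        linarith
      · rw [← h2]
        have : n*1 ≤ n*(-FF m p q) := by
          apply mul_le_mul_of_nonneg_left (by omega); linarith
        linarith
    have hH := HH_le m p q (by linarith) hqz hp100
    have hpz : (1:ℤ) ≤ p := by exact_mod_cast hp
    have hp3 : (100:ℤ)^3 ≤ (p:ℤ)^3 := by
      have : (100:ℤ) ≤ p := by linarith
      gcongr
    have hn5 : n + 3 ≤ (m+5)*(p:ℤ)^3 := by linarith
    have hn5r : (n:ℝ) + 3 ≤ (m+5)*(p:ℝ)^3 := by exact_mod_cast hn5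
    have hnr : (m:ℝ) < n := by exact_mod_cast hmn
    have hTn : T ≤ n+3 := by
      apply (fR_pos_iff hTp' hfT (by linarith)).mp
      unfold fR
      nlinarith
    exact hyp m p q (FF m p q) hm1 hqz hp100 rfl hFN
      (large_num m hm2 p hp t T htm hTp' (hTn.trans hn5r) hA)
end SC

theorem stmt3 :
    (∀ m n : ℤ, -1 ≤ m → m < n → L m = L n →
      m ∈ ({-1, 0, 1, 2, 3, 5, 12, 54, 66, 1259, 2389} : Set ℤ) ∧
      n ∈ ({-1, 0, 1, 2, 3, 5, 12, 54, 66, 1259, 2389} : Set ℤ)) ∧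
    (L (-1) = L 5 ∧ L 5 = L 12 ∧ L 12 = L 1259) ∧
    (L 0 = L 3 ∧ L 3 = L 54) ∧ L 1 = L 66 ∧ L 2 = L 2389 ∧
    (∀ m n : ℤ, -1 ≤ m → m < n →
      (L m = L n ↔ (m, n) ∈ ({(-1, 5), (-1, 12), (-1, 1259), (5, 12), (5, 1259), (12, 1259),
        (0, 3), (0, 54), (3, 54), (1, 66), (2, 2389)} : Set (ℤ × ℤ)))) := by
  refine ⟨?_, ⟨SC.L_m1_5, SC.L_5_12, SC.L_12_1259⟩, ⟨SC.L_0_3, SC.L_3_54⟩, SC.L_1_66, SC.L_2_2389, ?_⟩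
  · intro m n hm hmn hL
    have h := SC.forward m n hm hmn hL
    simp only [SC.okSet, Set.mem_insert_iff, Set.mem_singleton_iff, Prod.mk.injEq] at h ⊢
    omega
  · intro m n hm hmn
    refine ⟨fun hL => SC.forward m n hm hmn hL, ?_⟩
    intro h
    simp only [Set.mem_insert_iff, Set.mem_singleton_iff, Prod.mk.injEq] at h
    have a1 := SC.L_m1_5
    have a2 := SC.L_5_12
    have a3 := SC.L_12_1259
    have a4 := SC.L_0_3
    have a5 := SC.L_3_54
    rcases h with h | h | h | h | h | h | h | h | h | h | h <;> obtain ⟨rfl, rfl⟩ := h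
    · exact a1
    · exact a1.trans a2
    · exact (a1.trans a2).trans a3
    · exact a2
    · exact a2.trans a3
    · exact a3
    · exact a4
    · exact a4.trans a5
    · exact a5
    · exact SC.L_1_66
    · exact SC.L_2_2389
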